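/- The family ν satisfies the (k·2^{k−1}, 3k−4, k)-linear forms condition. -/

import Mathlib

open Finset Filter
open scoped Classical

noncomputable section

/-- `ε_k := 1/(2^k (k+4)!)`. -/
def epsk (k : ℕ) : ℝ := 1 / (2 ^ k * (Nat.factorial (k + 4)))

/-- `W(N) := ∏_{p ≤ w(N)} p`. -/
def Wprim (w : ℕ → ℕ) (N : ℕ) : ℕ := ∏ p ∈ (Finset.range (w N + 1)).filter Nat.Prime, p

/-- W-tricked von Mangoldt function. -/
def tildeLambda (W n : ℕ) : ℝ :=
  if Nat.Prime (W * n + 1) then (Nat.totient W : ℝ) / W * Real.log (W * n + 1) else 0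

/-- truncated divisor sum `Λ_R`. -/
def LambdaR (R : ℝ) (n : ℕ) : ℝ :=
  ∑ d ∈ n.divisors.filter (fun d : ℕ => (d : ℝ) ≤ R),
    ((ArithmeticFunction.moebius d : ℤ) : ℝ) * Real.log (R / (d : ℝ))

/-- the representative of `n : ZMod m` lying in `[N, N+m)`. -/
def reprN (N : ℕ) {m : ℕ} (n : ZMod m) : ℕ := N + (n - (N : ZMod m)).val

/-- the condition `ε_k M ≤ n - N ≤ 2 ε_k M` on the representative in `[N, N+m)`. -/
def inWindow (k N : ℕ) {m : ℕ} (n : ZMod m) : Prop :=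
  epsk k * m ≤ ((n - (N : ZMod m)).val : ℝ) ∧ ((n - (N : ZMod m)).val : ℝ) ≤ 2 * epsk k * m

/-- `R := M^(1/(k 2^(k+4)))`. -/
def Rpar (k m : ℕ) : ℝ := (m : ℝ) ^ ((1 : ℝ) / (k * 2 ^ (k + 4)))

/-- the Green–Tao majorant `ν`. -/
def nuGT (k N W : ℕ) {m : ℕ} (n : ZMod m) : ℝ :=
  if inWindow k N n then
    (Nat.totient W : ℝ) / W * (LambdaR (Rpar k m) (W * reprN N n + 1)) ^ 2 / Real.log (Rpar k m)
  else 1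

/-- the function `f`. -/
def fGT (k N W : ℕ) {m : ℕ} (n : ZMod m) : ℝ :=
  if inWindow k N n then tildeLambda W (reprN N n) / (k * 2 ^ (k + 5)) else 0

/-- the set of integers `n` with `ε_k M ≤ n - N ≤ 2 ε_k M`. -/
def windowSet (k N m : ℕ) : Finset ℕ :=
  (Finset.range (N + m + 1)).filter
    (fun n => epsk k * m ≤ (n : ℝ) - N ∧ (n : ℝ) - N ≤ 2 * epsk k * m)

/-- `E(Λ̃(n) | ε_k M ≤ n - N ≤ 2 ε_k M)`. -/
def avgWindow (k N m W : ℕ) : ℝ :=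
  (∑ n ∈ windowSet k N m, tildeLambda W n) / (windowSet k N m).card

/-- `E(g(x) | x ∈ Z_m)`. -/
def avgZ (m : ℕ) (g : ZMod m → ℝ) : ℝ := (∑ x ∈ Finset.range m, g (x : ZMod m)) / m

/-- `E(g(x) g(x+r) ⋯ g(x+(k-1)r) | x, r ∈ Z_m)`. -/
def apAvg (k m : ℕ) (g : ZMod m → ℝ) : ℝ :=
  (∑ x ∈ Finset.range m, ∑ r ∈ Finset.range m,
    ∏ i ∈ Finset.range k, g ((x : ZMod m) + (i : ZMod m) * (r : ZMod m))) / (m : ℝ) ^ 2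

/-- a rational number interpreted in `ZMod m`. -/
def ratZMod (q : ℚ) (m : ℕ) : ZMod m := (q.num : ZMod m) * (q.den : ZMod m)⁻¹

/-- the `(m₀,t₀,L₀)`-linear forms condition for a family `ν = ν_N : Z_{M(N)} → ℝ`. -/
def LinearFormsCondition (M : ℕ → ℕ) (ν : ∀ N : ℕ, ZMod (M N) → ℝ) (m₀ t₀ L₀ : ℕ) : Prop :=
  ∀ m t : ℕ, m ≤ m₀ → t ≤ t₀ →
    ∀ L : Fin m → Fin t → ℚ,
      (∀ i j, (L i j).num.natAbs ≤ L₀ ∧ (L i j).den ≤ L₀) →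
      (∀ i, L i ≠ 0) →
      (∀ i i', i ≠ i' → ∀ q : ℚ, L i ≠ q • L i') →
      ∀ δ : ℝ, 0 < δ → ∃ N₀ : ℕ, ∀ N ≥ N₀, L₀ < M N →
        ∀ b : Fin m → ZMod (M N),
          |(∑ x : Fin t → Fin (M N), ∏ i : Fin m,
              ν N (∑ j : Fin t, ratZMod (L i j) (M N) * ((x j : ℕ) : ZMod (M N)) + b i)) /
              (M N : ℝ) ^ t - 1| ≤ δ

/-- the `m₀`-correlation condition for a family `ν = ν_N : Z_{M(N)} → ℝ`. -/
def CorrelationCondition (M : ℕ → ℕ) (ν : ∀ N : ℕ, ZMod (M N) → ℝ) (m₀ : ℕ) : Prop :=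
  ∀ m : ℕ, 1 < m → m ≤ m₀ →
    ∃ τ : ∀ N : ℕ, ZMod (M N) → ℝ,
      (∀ N n, 0 ≤ τ N n) ∧
      (∀ q : ℝ, 1 ≤ q → ∃ C : ℝ, ∀ N, avgZ (M N) (fun n => τ N n ^ q) ≤ C) ∧
      (∀ N : ℕ, ∀ h : Fin m → ZMod (M N),
        avgZ (M N) (fun x => ∏ i, ν N (x + h i)) ≤
          ∑ i : Fin m, ∑ j : Fin m, if i < j then τ N (h i - h j) else 0)

/-- `k`-pseudorandom measure. -/
def Pseudorandom (k : ℕ) (M : ℕ → ℕ) (ν : ∀ N : ℕ, ZMod (M N) → ℝ) : Prop :=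
  (∀ δ : ℝ, 0 < δ → ∃ N₀, ∀ N ≥ N₀, |avgZ (M N) (ν N) - 1| ≤ δ) ∧
  LinearFormsCondition M ν (k * 2 ^ (k - 1)) (3 * k - 4) k ∧
  CorrelationCondition M ν (2 ^ (k - 1))

open MeasureTheory Topology FourierTransform SchwartzMap Complex in
/-- The Laplace transform of a function of linear growth, tested against a Fourier kernel. -/
theorem integral_laplace_mul_fourierInv (h : ℝ → ℂ) (Λ : ℝ) (hc : Continuous h)
    (hb : ∀ x, ‖h x‖ ≤ Λ * |x|) (E : ℂ → ℂ)
    (hLap : ∀ s : ℂ, 0 < s.re → ∫ x in Set.Ioi (0 : ℝ), h x * cexp (-s * x) = E s)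
    (ψ : 𝓢(ℝ, ℂ)) (l v σ : ℝ) (hσ : 0 < σ) :
    ∫ x in Set.Ioi (0 : ℝ), h x * cexp (-σ * x) * (𝓕⁻ ψ) (l * (v - x)) =
      ∫ t : ℝ, ψ t * cexp (2 * Real.pi * I * t * l * v) * E (σ + 2 * Real.pi * I * l * t) := by
  have hint : IntegrableOn (fun x : ℝ => h x * cexp (-σ * x)) (Set.Ioi 0) := by
    have h1 : IntegrableOn (fun x : ℝ => Λ * (x ^ (1 : ℝ) * Real.exp (-σ * x))) (Set.Ioi 0) := by
      apply Integrable.const_mul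
      have := integrableOn_rpow_mul_exp_neg_mul_rpow (s := 1) (p := 1) (b := σ) (by norm_num)
        (by norm_num) hσ
      simpa [IntegrableOn] using this
    refine Integrable.mono' h1 (by fun_prop) ?_
    refine (ae_restrict_iff' measurableSet_Ioi).2 (Eventually.of_forall fun x hx => ?_)
    have hx : (0 : ℝ) < x := hx
    rw [norm_mul, Complex.norm_exp]
    have : (-(σ : ℂ) * x).re = -σ * x := by simp
    rw [this, Real.rpow_one, ← mul_assoc]
    have := hb x
    rw [abs_of_pos hx] at this
    gcongr
  have hK : ∀ u : ℝ, (𝓕⁻ ψ) u = ∫ t : ℝ, cexp (2 * Real.pi * I * t * u) * ψ t := by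
    intro u
    rw [SchwartzMap.fourierInv_coe, Real.fourierInv_eq']
    refine integral_congr_ae (Eventually.of_forall fun t => ?_)
    simp only [smul_eq_mul]
    congr 2
    simp
    ring
  simp_rw [hK, ← integral_const_mul]
  rw [integral_integral_swap]
  · refine integral_congr_ae (Eventually.of_forall fun t => ?_)
    simp only
    rw [← hLap _ (by simp [hσ]), ← integral_const_mul]
    refine integral_congr_ae (Eventually.of_forall fun x => ?_)
    simp only
    have : cexp (2 * Real.pi * I * t * ((l * (v - x) : ℝ) : ℂ)) * cexp (-σ * x) =
        cexp (2 * Real.pi * I * t * l * v) * cexp (-(σ + 2 * Real.pi * I * l * t) * x) := by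
      rw [← Complex.exp_add, ← Complex.exp_add]
      congr 1
      push_cast
      ring
    linear_combination (h x * ψ t) * this
  · have h2 : Integrable (fun z : ℝ × ℝ => (h z.1 * cexp (-σ * z.1)) * ψ z.2)
        ((volume.restrict (Set.Ioi 0)).prod volume) := hint.mul_prod ψ.integrable
    refine h2.mono (by fun_prop) (Eventually.of_forall fun z => ?_)
    simp only [Function.uncurry, norm_mul]
    have : ‖cexp (2 * Real.pi * I * z.2 * ((l * (v - z.1) : ℝ) : ℂ))‖ = 1 := by
      rw [Complex.norm_exp]
      simp
    rw [this, one_mul]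

set_option maxHeartbeats 1000000 in
open MeasureTheory Topology FourierTransform SchwartzMap Complex in
/-- A Tauberian theorem: a Lipschitz function whose Laplace transform extends continuously
to the closed right half-plane tends to zero. -/
theorem tendsto_zero_of_laplace_continuousOn (h : ℝ → ℂ) (Λ : ℝ) (hΛ : 0 ≤ Λ)
    (hLip : ∀ x y, ‖h x - h y‖ ≤ Λ * |x - y|) (h0 : ∀ x ≤ 0, h x = 0) (E : ℂ → ℂ)
    (hE : ContinuousOn E {s | 0 ≤ s.re})
    (hLap : ∀ s : ℂ, 0 < s.re → ∫ x in Set.Ioi (0 : ℝ), h x * cexp (-s * x) = E s) :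
    Tendsto h atTop (𝓝 0) := by
  have hc : Continuous h := by
    have : LipschitzWith Λ.toNNReal h := LipschitzWith.of_dist_le_mul fun x y => by
      rw [dist_eq_norm, Real.dist_eq, Real.coe_toNNReal _ hΛ]
      exact hLip x y
    exact this.continuous
  have hb : ∀ x, ‖h x‖ ≤ Λ * |x| := fun x => by simpa [h0 0 le_rfl] using hLip x 0
  obtain ⟨ψ, hψc, hψ0⟩ : ∃ ψ : 𝓢(ℝ, ℂ), HasCompactSupport ψ ∧ ψ 0 = 1 := by
    let f : ContDiffBump (0 : ℝ) := ⟨1, 2, by norm_num, by norm_num⟩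
    have h1 : HasCompactSupport (fun x => (f x : ℂ)) := 
      f.hasCompactSupport.comp_left (g := fun x : ℝ => (x : ℂ)) Complex.ofReal_zero
    have h2 : ContDiff ℝ (⊤ : ℕ∞) (fun x => (f x : ℂ)) :=
      Complex.ofRealCLM.contDiff.comp f.contDiff
    refine ⟨h1.toSchwartzMap h2, ?_, ?_⟩
    · exact h1
    · have : f 0 = 1 := f.one_of_mem_closedBall (by simp [f])
      change ((f 0 : ℝ) : ℂ) = 1
      rw [this]; simp
  set K : 𝓢(ℝ, ℂ) := 𝓕⁻ ψ with hKdef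
  have hK1 : ∫ u : ℝ, K u = 1 := by
    have h1 : (𝓕 K) 0 = 1 := by rw [hKdef, FourierTransform.fourier_fourierInv_eq, hψ0]
    rw [SchwartzMap.fourier_coe, Real.fourier_eq'] at h1
    simpa using h1
  obtain ⟨A, hA⟩ : ∃ A : ℝ, A = ∫ u : ℝ, |u| * ‖K u‖ := ⟨_, rfl⟩
  have hAint : Integrable (fun u : ℝ => |u| * ‖K u‖) := by
    simpa using K.integrable_pow_mul volume 1
  have hA0 : 0 ≤ A := by rw [hA]; positivity
  have hscale : ∀ (F : ℝ → ℂ) (l : ℝ), 0 < l → ∀ v : ℝ,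
      ∫ x : ℝ, F (l * (v - x)) = (l : ℂ)⁻¹ * ∫ u : ℝ, F u := by
    intro F l hl v
    have h1 := integral_sub_left_eq_self (fun x : ℝ => F (l * x)) volume v
    rw [h1, Measure.integral_comp_mul_left, abs_of_pos (by positivity)]
    simp
  -- the smoothed function tends to zero
  have key : ∀ l : ℝ, 0 < l →
      Tendsto (fun v : ℝ => ∫ x in Set.Ioi (0 : ℝ), h x * K (l * (v - x))) atTop (𝓝 0) := by
    intro l hl
    set G : ℝ → ℂ := fun t => ψ t * E (2 * Real.pi * I * l * t) with hG
    have hEline : ∀ σ : ℝ, 0 ≤ σ → Continuous fun t : ℝ => E (σ + 2 * Real.pi * I * l * t) := by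
      intro σ hσ
      refine hE.comp_continuous (by fun_prop) fun t => ?_
      simpa using hσ
    have hIeq : ∀ v : ℝ, ∫ x in Set.Ioi (0 : ℝ), h x * K (l * (v - x)) =
        ∫ t : ℝ, ψ t * cexp (2 * Real.pi * I * t * l * v) * E (2 * Real.pi * I * l * t) := by
      intro v
      have hseq : Tendsto (fun n : ℕ => (1 / ((n : ℝ) + 1))) atTop (𝓝 0) :=
        tendsto_one_div_add_atTop_nhds_zero_nat
      have hpos : ∀ n : ℕ, (0 : ℝ) < 1 / ((n : ℝ) + 1) := fun n => by positivity
      have hle : ∀ n : ℕ, (1 : ℝ) / ((n : ℝ) + 1) ≤ 1 := fun n => by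
        rw [div_le_one (by positivity)]; linarith [n.cast_nonneg (α := ℝ)]
      have L1 : Tendsto (fun n : ℕ => ∫ x in Set.Ioi (0 : ℝ),
          h x * cexp (-((1 / ((n : ℝ) + 1) : ℝ) : ℂ) * x) * K (l * (v - x))) atTop
          (𝓝 (∫ x in Set.Ioi (0 : ℝ), h x * K (l * (v - x)))) := by
        have hdom : Integrable (fun x : ℝ => Λ * |x| * ‖K (l * (v - x))‖) := by
          have e1 : Integrable (fun u : ℝ => (Λ * (|v| + l⁻¹ * |u|)) * ‖K u‖) := by
            have := ((K.integrable.norm).const_mul (Λ * |v|)).add (hAint.const_mul (Λ * l⁻¹))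
            refine this.congr (Eventually.of_forall fun u => ?_)
            simp only [Pi.add_apply]; ring
          have e2 := (e1.comp_mul_left' hl.ne').comp_sub_left v
          refine e2.mono' (by fun_prop) (Eventually.of_forall fun x => ?_)
          rw [norm_mul, norm_mul, norm_norm, Real.norm_of_nonneg hΛ, Real.norm_eq_abs, abs_abs]
          have : |x| ≤ |v| + l⁻¹ * |l * (v - x)| := by
            rw [abs_mul, abs_of_pos hl, inv_mul_cancel_left₀ hl.ne']
            have := abs_sub_abs_le_abs_sub x v
            rw [abs_sub_comm] at this
            linarith
          gcongr
        refine tendsto_integral_of_dominated_convergence _ (fun n => by fun_prop)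
          hdom.integrableOn (fun n => ?_) ?_
        · refine (ae_restrict_iff' measurableSet_Ioi).2 (Eventually.of_forall fun x hx => ?_)
          have hx : (0 : ℝ) < x := hx
          rw [norm_mul, norm_mul, Complex.norm_exp]
          have : (-((1 / ((n : ℝ) + 1) : ℝ) : ℂ) * x).re = -(1 / ((n : ℝ) + 1) * x) := by
            rw [← Complex.ofReal_neg, ← Complex.ofReal_mul, Complex.ofReal_re]; ring
          rw [this]
          have e : Real.exp (-(1 / ((n : ℝ) + 1) * x)) ≤ 1 := by
            rw [Real.exp_le_one_iff]
            have := mul_pos (hpos n) hx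
            linarith
          have := hb x
          calc ‖h x‖ * Real.exp (-(1 / ((n : ℝ) + 1) * x)) * ‖K (l * (v - x))‖
              ≤ (Λ * |x|) * 1 * ‖K (l * (v - x))‖ := by gcongr
            _ = _ := by ring
        · refine Eventually.of_forall fun x => ?_
          have : Tendsto (fun n : ℕ => h x * cexp (-((1 / ((n : ℝ) + 1) : ℝ) : ℂ) * x) *
              K (l * (v - x))) atTop (𝓝 (h x * cexp (-((0 : ℝ) : ℂ) * x) * K (l * (v - x)))) := by
            have hcont : Continuous fun σ : ℝ => h x * cexp (-(σ : ℂ) * x) * K (l * (v - x)) := by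
              fun_prop
            exact (hcont.tendsto 0).comp hseq
          simpa using this
      have L2 : Tendsto (fun n : ℕ => ∫ t : ℝ, ψ t * cexp (2 * Real.pi * I * t * l * v) *
          E ((1 / ((n : ℝ) + 1) : ℝ) + 2 * Real.pi * I * l * t)) atTop
          (𝓝 (∫ t : ℝ, ψ t * cexp (2 * Real.pi * I * t * l * v) *
            E (2 * Real.pi * I * l * t))) := by
        obtain ⟨C, hC⟩ : ∃ C, ∀ σ ∈ Set.Icc (0 : ℝ) 1, ∀ t ∈ tsupport ψ,
            ‖E (σ + 2 * Real.pi * I * l * t)‖ ≤ C := by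
          have hcomp : IsCompact ((fun z : ℝ × ℝ => ((z.1 : ℂ) + 2 * Real.pi * I * l * z.2)) ''
              (Set.Icc (0 : ℝ) 1 ×ˢ tsupport ψ)) :=
            (isCompact_Icc.prod hψc).image (by fun_prop)
          have hsub : ((fun z : ℝ × ℝ => ((z.1 : ℂ) + 2 * Real.pi * I * l * z.2)) ''
              (Set.Icc (0 : ℝ) 1 ×ˢ tsupport ψ)) ⊆ {s | 0 ≤ s.re} := by
            rintro _ ⟨z, hz, rfl⟩
            simpa using hz.1.1
          obtain ⟨C, hC⟩ := hcomp.exists_bound_of_continuousOn (hE.mono hsub)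
          exact ⟨C, fun σ hσ t ht => hC _ ⟨(σ, t), ⟨hσ, ht⟩, rfl⟩⟩
        refine tendsto_integral_of_dominated_convergence (fun t => C * ‖ψ t‖) (fun n => ?_)
          (ψ.integrable.norm.const_mul C) (fun n => Eventually.of_forall fun t => ?_)
          (Eventually.of_forall fun t => ?_)
        · have := hEline _ (hpos n).le
          exact ((ψ.continuous.mul (by fun_prop)).mul this).aestronglyMeasurable
        · by_cases ht : ψ t = 0
          · simp [ht]
          · rw [norm_mul, norm_mul]
            have e : ‖cexp (2 * Real.pi * I * t * l * v)‖ = 1 := by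
              rw [Complex.norm_exp]; simp
            rw [e, mul_one, mul_comm]
            have := hC _ ⟨(hpos n).le, hle n⟩ t (subset_tsupport _ ht)
            gcongr
        · refine Tendsto.mul tendsto_const_nhds ?_
          have hcw : ContinuousWithinAt E {s | 0 ≤ s.re} (2 * Real.pi * I * l * t) :=
            hE _ (by simp)
          refine hcw.tendsto.comp (tendsto_nhdsWithin_iff.2 ⟨?_, ?_⟩)
          · have hcont : Continuous fun σ : ℝ => ((σ : ℂ) + 2 * Real.pi * I * l * t) := by fun_prop
            have := (hcont.tendsto 0).comp hseq
            simpa [Function.comp_def] using this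
          · refine Eventually.of_forall fun n => ?_
            have := (hpos n).le
            simp only [Set.mem_ofPred_eq, Complex.add_re, Complex.ofReal_re]
            simpa using this
      refine tendsto_nhds_unique L1 (L2.congr fun n => ?_)
      rw [integral_laplace_mul_fourierInv h Λ hc hb E hLap ψ l v _ (hpos n)]
    have hRL := Real.zero_at_infty_fourier G
    have hcomp : Tendsto (fun v : ℝ => -(l * v)) atTop (cocompact ℝ) := by
      rw [cocompact_eq_atBot_atTop]
      refine Tendsto.mono_right ?_ le_sup_left
      exact tendsto_neg_atTop_atBot.comp (tendsto_id.const_mul_atTop hl)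
    refine (hRL.comp hcomp).congr fun v => ?_
    rw [hIeq, Function.comp_apply, Real.fourier_eq']
    refine integral_congr_ae (Eventually.of_forall fun t => ?_)
    simp only [smul_eq_mul, hG]
    have : (((-2 * Real.pi * inner ℝ t (-(l * v)) : ℝ) : ℂ) * I) = 2 * Real.pi * I * t * l * v := by
      simp
      ring
    rw [this]; ring
  -- comparison of `h` with its smoothed version
  have hcmp : ∀ l : ℝ, 0 < l → ∀ v : ℝ,
      ‖h v - l * ∫ x in Set.Ioi (0 : ℝ), h x * K (l * (v - x))‖ ≤ Λ * A / l := by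
    intro l hl v
    have e0 : ∫ x in Set.Ioi (0 : ℝ), h x * K (l * (v - x)) = ∫ x : ℝ, h x * K (l * (v - x)) := by
      refine setIntegral_eq_integral_of_forall_compl_eq_zero fun x hx => ?_
      rw [h0 x (by simpa using hx), zero_mul]
    have e1 : ∫ x : ℝ, h x * K (l * (v - x)) = (l : ℂ)⁻¹ * ∫ u : ℝ, h (v - l⁻¹ * u) * K u := by
      rw [← hscale (fun u => h (v - l⁻¹ * u) * K u) l hl v]
      refine integral_congr_ae (Eventually.of_forall fun x => ?_)
      simp only [inv_mul_cancel_left₀ hl.ne', sub_sub_cancel]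
    have hl' : (l : ℂ) ≠ 0 := by exact_mod_cast hl.ne'
    have hi : Integrable (fun u : ℝ => (h v - h (v - l⁻¹ * u)) * K u) := by
      refine (hAint.const_mul (Λ * l⁻¹)).mono' (by fun_prop) (Eventually.of_forall fun u => ?_)
      rw [norm_mul]
      have := hLip v (v - l⁻¹ * u)
      rw [sub_sub_cancel, abs_mul, abs_of_pos (inv_pos.2 hl)] at this
      calc _ ≤ (Λ * (l⁻¹ * |u|)) * ‖K u‖ := by gcongr
        _ = _ := by ring
    have e2 : h v - l * ∫ x in Set.Ioi (0 : ℝ), h x * K (l * (v - x)) =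
        ∫ u : ℝ, (h v - h (v - l⁻¹ * u)) * K u := by
      rw [e0, e1, mul_inv_cancel_left₀ hl']
      have i1 : Integrable (fun u : ℝ => h v * K u) := K.integrable.const_mul _
      have i2 : Integrable (fun u : ℝ => h (v - l⁻¹ * u) * K u) := by
        refine (i1.sub hi).congr (Eventually.of_forall fun u => ?_)
        simp only [Pi.sub_apply]; ring
      have : h v = ∫ u : ℝ, h v * K u := by rw [integral_const_mul, hK1, mul_one]
      conv_lhs => rw [this]
      rw [← integral_sub i1 i2]
      refine integral_congr_ae (Eventually.of_forall fun u => ?_)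
      simp only; ring
    rw [e2]
    calc _ ≤ ∫ u : ℝ, (Λ * l⁻¹) * (|u| * ‖K u‖) := by
          refine norm_integral_le_of_norm_le (hAint.const_mul _) (Eventually.of_forall fun u => ?_)
          rw [norm_mul]
          have := hLip v (v - l⁻¹ * u)
          rw [sub_sub_cancel, abs_mul, abs_of_pos (inv_pos.2 hl)] at this
          calc _ ≤ (Λ * (l⁻¹ * |u|)) * ‖K u‖ := by gcongr
            _ = _ := by ring
      _ = _ := by rw [integral_const_mul, ← hA]; ring
  rw [Metric.tendsto_nhds]
  intro δ hδ
  set l : ℝ := 2 * (Λ * A + 1) / δ with hl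
  have hlpos : 0 < l := by positivity
  have hsmall : Λ * A / l < δ / 2 := by
    rw [hl, div_lt_iff₀ hlpos, hl]
    field_simp
    linarith
  have h2 := (key l hlpos).const_mul (l : ℂ)
  rw [mul_zero, Metric.tendsto_nhds] at h2
  filter_upwards [h2 (δ / 2) (by positivity)] with v hv
  rw [dist_zero_right] at hv ⊢
  have := norm_sub_norm_le (h v) (l * ∫ x in Set.Ioi (0 : ℝ), h x * K (l * (v - x)))
  linarith [hcmp l hlpos v]

/-- The positive integers up to `x` that are coprime to `q`. -/
def coprimeIoc (q : ℕ) (x : ℝ) : Finset ℕ :=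
  (Finset.Ioc 0 ⌊x⌋₊).filter (fun c => Nat.Coprime c q)

theorem mem_coprimeIoc {q c : ℕ} {x : ℝ} :
    c ∈ coprimeIoc q x ↔ (0 < c ∧ (c : ℝ) ≤ x) ∧ Nat.Coprime c q := by
  rw [coprimeIoc, Finset.mem_filter, Finset.mem_Ioc]
  refine and_congr_left fun _ => and_congr_right fun h => ?_
  exact Nat.le_floor_iff' h.ne'

/-- `∑_{c ≤ x, (c, q) = 1} μ(c) / c · log (x / c)`. -/
def muLogSum (q : ℕ) (x : ℝ) : ℝ :=
  ∑ c ∈ coprimeIoc q x, (ArithmeticFunction.moebius c : ℝ) / c * Real.log (x / c)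

theorem abs_moebius_real_le_one (n : ℕ) : |(ArithmeticFunction.moebius n : ℝ)| ≤ 1 := by
  have := ArithmeticFunction.abs_moebius_le_one (n := n)
  exact_mod_cast this

theorem abs_sum_moebius_div_le (n : ℕ) :
    |∑ c ∈ Finset.Ioc 0 n, (ArithmeticFunction.moebius c : ℝ) / c| ≤ 2 := by
  rcases Nat.eq_zero_or_pos n with rfl | hn
  · simp
  have h1 := ArithmeticFunction.sum_Ioc_mul_zeta_eq_sum (ArithmeticFunction.moebius) n
  rw [ArithmeticFunction.moebius_mul_coe_zeta] at h1
  have h2 : ∑ m ∈ Finset.Ioc 0 n, (1 : ArithmeticFunction ℤ) m = 1 := by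
    rw [Finset.sum_eq_single_of_mem 1 (by simp; omega)]
    · simp
    · intro b _ hb
      exact ArithmeticFunction.one_apply_ne hb
  rw [h2] at h1
  have h3 : (1 : ℝ) = ∑ c ∈ Finset.Ioc 0 n, (ArithmeticFunction.moebius c : ℝ) * ((n / c : ℕ) : ℝ) := by
    have h1' := congrArg (Int.cast : ℤ → ℝ) h1
    rw [Int.cast_sum, Int.cast_one] at h1'
    rw [h1']
    refine Finset.sum_congr rfl fun c _ => ?_
    rw [Int.cast_mul, Int.cast_natCast]
  have hn' : (0 : ℝ) < n := by exact_mod_cast hn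
  have h4 : (n : ℝ) * ∑ c ∈ Finset.Ioc 0 n, (ArithmeticFunction.moebius c : ℝ) / c - 1 =
      ∑ c ∈ Finset.Ioc 0 n, (ArithmeticFunction.moebius c : ℝ) * ((n : ℝ) / c - ((n / c : ℕ) : ℝ)) := by
    rw [h3, Finset.mul_sum, ← Finset.sum_sub_distrib]
    refine Finset.sum_congr rfl fun c _ => ?_
    ring
  have h5 : |(n : ℝ) * ∑ c ∈ Finset.Ioc 0 n, (ArithmeticFunction.moebius c : ℝ) / c - 1| ≤ n := by
    rw [h4]
    calc _ ≤ ∑ c ∈ Finset.Ioc 0 n, (1 : ℝ) := by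
          refine (Finset.abs_sum_le_sum_abs _ _).trans (Finset.sum_le_sum fun c hc => ?_)
          rw [abs_mul]
          have e1 : ((n / c : ℕ) : ℝ) ≤ (n : ℝ) / c := Nat.cast_div_le
          have e2 : (n : ℝ) / c < ((n / c : ℕ) : ℝ) + 1 := by
            have hc0 : (0 : ℝ) < c := by exact_mod_cast (Finset.mem_Ioc.1 hc).1
            rw [div_lt_iff₀ hc0]
            have := Nat.lt_mul_div_succ n (Finset.mem_Ioc.1 hc).1
            have h' : (n : ℝ) < (c : ℝ) * (((n / c : ℕ) : ℝ) + 1) := by exact_mod_cast this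
            linarith
          have := abs_moebius_real_le_one c
          have e3 : |(n : ℝ) / c - ((n / c : ℕ) : ℝ)| ≤ 1 := by
            rw [abs_le]; constructor <;> linarith
          calc _ ≤ (1 : ℝ) * 1 := by gcongr
            _ = 1 := by norm_num
      _ = n := by simp
  have h6 : (1 : ℝ) ≤ n := by exact_mod_cast hn
  rw [abs_le] at h5 ⊢
  constructor
  · by_contra hcon
    push Not at hcon
    nlinarith
  · by_contra hcon
    push Not at hcon
    nlinarith

/-- Abel's inequality. -/
theorem abs_sum_mul_le_of_antitone (a F : ℕ → ℝ) (C : ℝ) (n : ℕ)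
    (ha : ∀ k, |∑ i ∈ Finset.range k, a i| ≤ C) (hF : Antitone F) (hF0 : ∀ i, 0 ≤ F i) :
    |∑ i ∈ Finset.range n, F i * a i| ≤ C * F 0 := by
  have hparts := Finset.sum_range_by_parts F a n
  simp only [smul_eq_mul] at hparts
  rw [hparts]
  calc _ ≤ F (n - 1) * C + ∑ i ∈ Finset.range (n - 1), (F i - F (i + 1)) * C := by
        refine (abs_sub _ _).trans (add_le_add ?_ ?_)
        · rw [abs_mul, abs_of_nonneg (hF0 _)]
          exact mul_le_mul_of_nonneg_left (ha _) (hF0 _)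
        · refine (Finset.abs_sum_le_sum_abs _ _).trans (Finset.sum_le_sum fun i _ => ?_)
          have := hF (Nat.le_succ i)
          rw [abs_mul, abs_sub_comm, abs_of_nonneg (by simpa using this)]
          exact mul_le_mul_of_nonneg_left (ha _) (by simpa using this)
    _ = C * F 0 := by
        rw [← Finset.sum_mul, Finset.sum_range_sub']
        ring

/-- `muLogSum 1` in the exponential variable, as a sum of ramps. -/
theorem muLogSum_one_exp (v : ℝ) (n : ℕ) (hn : Real.exp v ≤ n) :
    muLogSum 1 (Real.exp v) =
      ∑ i ∈ Finset.range n, max (v - Real.log ((i + 1 : ℕ) : ℝ)) 0 *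
        ((ArithmeticFunction.moebius (i + 1) : ℝ) / ((i + 1 : ℕ) : ℝ)) := by
  have h1 : ∑ i ∈ Finset.range n, max (v - Real.log ((i + 1 : ℕ) : ℝ)) 0 *
        ((ArithmeticFunction.moebius (i + 1) : ℝ) / ((i + 1 : ℕ) : ℝ)) =
      ∑ c ∈ Finset.Ioc 0 n, max (v - Real.log (c : ℝ)) 0 *
        ((ArithmeticFunction.moebius c : ℝ) / (c : ℝ)) := by
    refine Finset.sum_bij (fun i _ => i + 1) ?_ ?_ ?_ ?_
    · intro i hi; simp at hi ⊢; omega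
    · intro i _ j _ h; omega
    · intro c hc; simp at hc; exact ⟨c - 1, by simp; omega, by omega⟩
    · intro i _; rfl
  rw [h1, muLogSum, coprimeIoc, Finset.filter_true_of_mem (fun c _ => Nat.coprime_one_right c)]
  have hfl : ⌊Real.exp v⌋₊ ≤ n := by
    have := Nat.floor_le_floor hn
    simpa using this
  rw [← Finset.sum_subset (Finset.Ioc_subset_Ioc_right hfl)]
  · refine Finset.sum_congr rfl fun c hc => ?_
    have hc0 : (0 : ℝ) < c := by exact_mod_cast (Finset.mem_Ioc.1 hc).1
    have hcx : (c : ℝ) ≤ Real.exp v :=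
      (Nat.le_floor_iff (Real.exp_pos v).le).1 (Finset.mem_Ioc.1 hc).2
    have : Real.log c ≤ v := (Real.log_le_iff_le_exp hc0).2 hcx
    rw [Real.log_div (Real.exp_pos v).ne' hc0.ne', Real.log_exp, max_eq_left (by linarith)]
    ring
  · intro c hc hc'
    have hc0 : 0 < c := (Finset.mem_Ioc.1 hc).1
    have : ⌊Real.exp v⌋₊ < c := by
      by_contra h
      exact hc' (Finset.mem_Ioc.2 ⟨hc0, not_lt.1 h⟩)
    have h2 := (Nat.floor_lt (Real.exp_pos v).le).1 this
    have h3 : v ≤ Real.log c := ((Real.lt_log_iff_exp_lt (by exact_mod_cast hc0)).2 h2).le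
    rw [max_eq_right (by linarith), zero_mul]

theorem abs_muLogSum_exp_sub_le (u v : ℝ) :
    |muLogSum 1 (Real.exp u) - muLogSum 1 (Real.exp v)| ≤ 2 * |u - v| := by
  wlog huv : v ≤ u generalizing u v
  · rw [abs_sub_comm, abs_sub_comm u]
    exact this v u (le_of_not_ge huv)
  set n := ⌈Real.exp u⌉₊
  have hn : Real.exp u ≤ n := Nat.le_ceil _
  rw [muLogSum_one_exp u n hn, muLogSum_one_exp v n ((Real.exp_le_exp.2 huv).trans hn),
    ← Finset.sum_sub_distrib]
  simp_rw [← sub_mul]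
  have hmono : ∀ i j : ℕ, i ≤ j → Real.log ((i + 1 : ℕ) : ℝ) ≤ Real.log ((j + 1 : ℕ) : ℝ) := by
    intro i j hij
    apply Real.log_le_log (by positivity)
    exact_mod_cast Nat.succ_le_succ hij
  have key := abs_sum_mul_le_of_antitone
    (fun i => (ArithmeticFunction.moebius (i + 1) : ℝ) / ((i + 1 : ℕ) : ℝ))
    (fun i => max (u - Real.log ((i + 1 : ℕ) : ℝ)) 0 - max (v - Real.log ((i + 1 : ℕ) : ℝ)) 0) 2 n
    (fun k => ?_) (fun i j hij => ?_) (fun i => ?_)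
  · refine key.trans ?_
    simp only [zero_add, Nat.cast_one, Real.log_one, sub_zero]
    rw [abs_of_nonneg (by linarith)]
    have : max u 0 - max v 0 ≤ u - v := by
      rcases le_total u 0 with h | h <;> rcases le_total v 0 with h' | h' <;> simp [h, h'] <;> linarith
    linarith
  · have := abs_sum_moebius_div_le k
    convert this using 2
    refine Finset.sum_bij (fun i _ => i + 1) ?_ ?_ ?_ ?_
    · intro i hi; simp at hi ⊢; omega
    · intro i _ j _ h; omega
    · intro c hc; simp at hc; exact ⟨c - 1, by simp; omega, by omega⟩
    · intro i _; rfl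
  · have := hmono i j hij
    simp only
    generalize Real.log ((i + 1 : ℕ) : ℝ) = a at *
    generalize Real.log ((j + 1 : ℕ) : ℝ) = b at *
    rcases le_total (u - a) 0 with h1 | h1 <;> rcases le_total (v - a) 0 with h2 | h2 <;>
    rcases le_total (u - b) 0 with h3 | h3 <;> rcases le_total (v - b) 0 with h4 | h4 <;>
    simp only [max_eq_left, max_eq_right, h1, h2, h3, h4] <;> linarith
  · simp only [sub_nonneg]
    exact max_le_max (by linarith) le_rfl

open MeasureTheory in
theorem integral_id_mul_cexp_neg (s : ℂ) (hs : 0 < s.re) :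
    ∫ u in Set.Ioi (0 : ℝ), (u : ℂ) * Complex.exp (-s * u) = 1 / s ^ 2 := by
  have hs0 : s ≠ 0 := by rintro rfl; simp at hs
  have hnorm : ∀ u : ℝ, ‖Complex.exp (-s * u)‖ = Real.exp (-s.re * u) := fun u => by
    rw [Complex.norm_exp]; simp
  have h1 : Tendsto (fun u : ℝ => (u : ℂ) * Complex.exp (-s * u)) atTop (nhds 0) := by
    rw [tendsto_zero_iff_norm_tendsto_zero]
    refine (tendsto_rpow_mul_exp_neg_mul_atTop_nhds_zero 1 s.re hs).congr' ?_
    filter_upwards [eventually_ge_atTop 0] with u hu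
    rw [norm_mul, hnorm, Complex.norm_real, Real.norm_of_nonneg hu, Real.rpow_one]
  have h2 : Tendsto (fun u : ℝ => Complex.exp (-s * u)) atTop (nhds 0) := by
    rw [tendsto_zero_iff_norm_tendsto_zero]
    refine (tendsto_rpow_mul_exp_neg_mul_atTop_nhds_zero 0 s.re hs).congr' ?_
    filter_upwards with u
    rw [hnorm, Real.rpow_zero, one_mul]
  have hint : IntegrableOn (fun u : ℝ => (u : ℂ) * Complex.exp (-s * u)) (Set.Ioi 0) := by
    have h3 := integrableOn_rpow_mul_exp_neg_mul_rpow (p := 1) (s := 1) (b := s.re)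
      (by norm_num) one_pos hs
    refine h3.mono' (Continuous.aestronglyMeasurable (by fun_prop)) ?_
    refine (ae_restrict_iff' measurableSet_Ioi).2 (Eventually.of_forall fun u hu => ?_)
    rw [norm_mul, hnorm, Complex.norm_real, Real.norm_of_nonneg (le_of_lt hu), Real.rpow_one]
  have hderiv : ∀ u ∈ Set.Ici (0 : ℝ), HasDerivAt (fun u : ℝ =>
      -(1 / s) * ((u : ℂ) * Complex.exp (-s * u)) - (1 / s ^ 2) * Complex.exp (-s * u))
      ((u : ℂ) * Complex.exp (-s * u)) u := by
    intro u _
    have hid : HasDerivAt (fun u : ℝ => (u : ℂ)) 1 u := Complex.ofRealCLM.hasDerivAt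
    have he : HasDerivAt (fun u : ℝ => Complex.exp (-s * u))
        (Complex.exp (-s * u) * (-s * 1)) u := (hid.const_mul (-s)).cexp
    convert! ((hid.mul he).const_mul (-(1 / s))).sub (he.const_mul (1 / s ^ 2)) using 1
    field_simp
    ring
  have := integral_Ioi_of_hasDerivAt_of_tendsto' hderiv hint
    ((h1.const_mul (-(1 / s))).sub (h2.const_mul (1 / s ^ 2)))
  rw [this]; simp

open MeasureTheory in
theorem integral_ramp_mul_exp (a : ℝ) (ha : 0 ≤ a) (s : ℂ) (hs : 0 < s.re) :
    IntegrableOn (fun v : ℝ => ((max (v - a) 0 : ℝ) : ℂ) * Complex.exp (-s * v)) (Set.Ioi 0) ∧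
    ∫ v in Set.Ioi (0 : ℝ), ((max (v - a) 0 : ℝ) : ℂ) * Complex.exp (-s * v) =
      Complex.exp (-s * a) / s ^ 2 := by
  have hs0 : s ≠ 0 := by rintro rfl; simp at hs
  have hint : ∀ f : ℝ → ℂ, (∀ v ≤ a, f v = 0) →
      ∫ v in Set.Ioi (0 : ℝ), f v = ∫ u in Set.Ioi (0 : ℝ), f (u + a) := by
    intro f hf
    have e1 : ∫ v in Set.Ioi (0 : ℝ), f v = ∫ v in Set.Ioi a, f v := by
      refine (setIntegral_eq_of_subset_of_forall_sdiff_eq_zero measurableSet_Ioi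
        (Set.Ioi_subset_Ioi ha) fun x hx => hf x ?_)
      simpa using hx.2
    rw [e1]
    have := (measurePreserving_add_right volume a).setIntegral_preimage_emb
      (measurableEmbedding_addRight a) f (Set.Ioi a)
    rw [← this]
    congr 2
    ext x; simp
  have hval : ∫ v in Set.Ioi (0 : ℝ), ((max (v - a) 0 : ℝ) : ℂ) * Complex.exp (-s * v) =
      Complex.exp (-s * a) / s ^ 2 := by
    rw [hint _ (fun v hv => by rw [max_eq_right (by linarith)]; simp)]
    calc _ = ∫ u in Set.Ioi (0 : ℝ), Complex.exp (-s * a) *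
            ((u : ℂ) * Complex.exp (-s * u)) := by
          refine setIntegral_congr_fun measurableSet_Ioi fun u hu => ?_
          have hu : (0 : ℝ) < u := hu
          simp only [add_sub_cancel_right, max_eq_left hu.le]
          have : Complex.exp (-s * ((u + a : ℝ) : ℂ)) =
              Complex.exp (-s * a) * Complex.exp (-s * u) := by
            rw [← Complex.exp_add]; congr 1; push_cast; ring
          rw [this]; ring
      _ = _ := by rw [integral_const_mul, integral_id_mul_cexp_neg s hs]; ring
  refine ⟨?_, hval⟩
  by_contra hni
  rw [integral_undef hni] at hval
  exact (div_ne_zero (Complex.exp_ne_zero _) (pow_ne_zero 2 hs0)) hval.symm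

open MeasureTheory in
theorem integral_muLogSum_exp (s : ℂ) (hs : 0 < s.re) :
    IntegrableOn (fun v : ℝ => (muLogSum 1 (Real.exp v) : ℂ) * Complex.exp (-s * v)) (Set.Ioi 0) ∧
    ∫ v in Set.Ioi (0 : ℝ), (muLogSum 1 (Real.exp v) : ℂ) * Complex.exp (-s * v) =
      1 / (s ^ 2 * riemannZeta (1 + s)) := by
  have hs1 : 1 < (1 + s).re := by simp [hs]
  set coef : ℕ → ℂ := fun i => (ArithmeticFunction.moebius (i + 1) : ℂ) / ((i + 1 : ℕ) : ℂ)
  set F : ℕ → ℝ → ℂ := fun i v => coef i *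
    (((max (v - Real.log ((i + 1 : ℕ) : ℝ)) 0 : ℝ) : ℂ) * Complex.exp (-s * v)) with hF
  have hlog : ∀ i : ℕ, 0 ≤ Real.log ((i + 1 : ℕ) : ℝ) := fun i =>
    Real.log_nonneg (by exact_mod_cast Nat.succ_le_succ (Nat.zero_le i))
  have hFint : ∀ i, IntegrableOn (F i) (Set.Ioi 0) := fun i =>
    (integral_ramp_mul_exp _ (hlog i) s hs).1.const_mul _
  have hexp : ∀ (i : ℕ) (z : ℂ), Complex.exp (-z * (Real.log ((i + 1 : ℕ) : ℝ) : ℂ)) =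
      ((i + 1 : ℕ) : ℂ) ^ (-z) := by
    intro i z
    rw [Complex.cpow_def_of_ne_zero (by exact_mod_cast Nat.succ_ne_zero i), Complex.natCast_log,
      mul_comm]
  have hterm : ∀ i : ℕ, coef i * ((i + 1 : ℕ) : ℂ) ^ (-s) =
      LSeries.term (fun n => (ArithmeticFunction.moebius n : ℂ)) (1 + s) (i + 1) := by
    intro i
    rw [LSeries.term_of_ne_zero (Nat.succ_ne_zero i)]
    have h0 : ((i + 1 : ℕ) : ℂ) ≠ 0 := by exact_mod_cast Nat.succ_ne_zero i
    rw [Complex.cpow_add _ _ h0, Complex.cpow_one, Complex.cpow_neg]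
    simp only [coef]
    field_simp
  have hFval : ∀ i, ∫ v in Set.Ioi (0 : ℝ), F i v =
      LSeries.term (fun n => (ArithmeticFunction.moebius n : ℂ)) (1 + s) (i + 1) / s ^ 2 := by
    intro i
    rw [hF]
    simp only
    rw [integral_const_mul, (integral_ramp_mul_exp _ (hlog i) s hs).2, hexp, ← mul_div_assoc, hterm]
  have hFnorm : ∀ i, ∫ v in Set.Ioi (0 : ℝ), ‖F i v‖ =
      ‖LSeries.term (fun n => (ArithmeticFunction.moebius n : ℂ)) (1 + s) (i + 1)‖ / s.re ^ 2 := by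
    intro i
    have hv := (integral_ramp_mul_exp _ (hlog i) (s.re : ℂ) (by simpa using hs)).2
    have e1 : ∫ v in Set.Ioi (0 : ℝ), ‖F i v‖ = ‖coef i‖ *
        ∫ v in Set.Ioi (0 : ℝ), max (v - Real.log ((i + 1 : ℕ) : ℝ)) 0 * Real.exp (-s.re * v) := by
      rw [← integral_const_mul]
      refine integral_congr_ae (Eventually.of_forall fun v => ?_)
      simp only [hF, norm_mul, Complex.norm_exp, Complex.norm_real]
      rw [Real.norm_of_nonneg (le_max_right _ _)]
      simp
    have e2 : ∫ v in Set.Ioi (0 : ℝ), max (v - Real.log ((i + 1 : ℕ) : ℝ)) 0 *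
        Real.exp (-s.re * v) = Real.exp (-s.re * Real.log ((i + 1 : ℕ) : ℝ)) / s.re ^ 2 := by
      have h3 := hv
      have : ∀ v : ℝ, ((max (v - Real.log ((i + 1 : ℕ) : ℝ)) 0 : ℝ) : ℂ) *
          Complex.exp (-(s.re : ℂ) * v) =
          ((max (v - Real.log ((i + 1 : ℕ) : ℝ)) 0 * Real.exp (-s.re * v) : ℝ) : ℂ) := by
        intro v; push_cast; rfl
      simp_rw [this] at h3
      rw [integral_complex_ofReal] at h3
      apply Complex.ofReal_injective
      rw [h3]; push_cast; rfl
    rw [e1, e2, ← hterm, norm_mul, ← hexp, Complex.norm_exp]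
    rw [mul_div_assoc]
    congr 3
    simp
  have hsummable : Summable fun i : ℕ =>
      LSeries.term (fun n => (ArithmeticFunction.moebius n : ℂ)) (1 + s) (i + 1) :=
    (summable_nat_add_iff 1).2 (ArithmeticFunction.LSeriesSummable_moebius_iff.2 hs1)
  have hsum : Summable fun i => ∫ v in Set.Ioi (0 : ℝ), ‖F i v‖ := by
    simp_rw [hFnorm]
    exact hsummable.norm.div_const _
  have hpt : ∀ v : ℝ, HasSum (fun i => F i v)
      ((muLogSum 1 (Real.exp v) : ℂ) * Complex.exp (-s * v)) := by
    intro v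
    have := muLogSum_one_exp v ⌈Real.exp v⌉₊ (Nat.le_ceil _)
    rw [this, Complex.ofReal_sum, Finset.sum_mul]
    have h0 : ∀ i ∉ Finset.range ⌈Real.exp v⌉₊, F i v = 0 := by
      intro i hi
      simp only [Finset.mem_range, not_lt] at hi
      have h1 : Real.exp v ≤ ((i + 1 : ℕ) : ℝ) :=
        (Nat.le_ceil _).trans (by exact_mod_cast hi.trans (Nat.le_succ i))
      have h2 : v ≤ Real.log ((i + 1 : ℕ) : ℝ) := (Real.le_log_iff_exp_le (by positivity)).2 h1
      simp only [hF]
      rw [max_eq_right (by linarith)]; simp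
    have h3 : HasSum (fun i => F i v) (∑ i ∈ Finset.range ⌈Real.exp v⌉₊, F i v) :=
      hasSum_sum_of_ne_finset_zero h0
    convert h3 using 1
    refine Finset.sum_congr rfl fun i _ => ?_
    simp only [hF, coef]
    push_cast
    ring
  have hmain := hasSum_integral_of_summable_integral_norm (μ := volume.restrict (Set.Ioi (0 : ℝ)))
    hFint hsum
  have heq : ∀ v : ℝ, ∑' i, F i v = (muLogSum 1 (Real.exp v) : ℂ) * Complex.exp (-s * v) :=
    fun v => (hpt v).tsum_eq
  simp_rw [heq, hFval] at hmain
  have hL := LSeries_one_mul_Lseries_moebius hs1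
  rw [LSeries_one_eq_riemannZeta hs1] at hL
  have hs0 : s ≠ 0 := by rintro rfl; simp at hs
  have hL2 : HasSum (fun i : ℕ => LSeries.term (fun n => (ArithmeticFunction.moebius n : ℂ))
      (1 + s) (i + 1)) (LSeries (fun n => (ArithmeticFunction.moebius n : ℂ)) (1 + s)) := by
    have := (ArithmeticFunction.LSeriesSummable_moebius_iff.2 hs1).LSeriesHasSum
    rw [LSeriesHasSum, ← hasSum_nat_add_iff' 1] at this
    simpa using this
  have hfin := hmain.unique (hL2.div_const (s ^ 2))
  have hz : riemannZeta (1 + s) ≠ 0 := left_ne_zero_of_mul_eq_one hL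
  have hval : ∫ v in Set.Ioi (0 : ℝ), (muLogSum 1 (Real.exp v) : ℂ) * Complex.exp (-s * v) =
      1 / (s ^ 2 * riemannZeta (1 + s)) := by
    rw [hfin, eq_div_of_mul_eq hz ((mul_comm _ _).trans hL), div_div, mul_comm (riemannZeta _)]
  refine ⟨?_, hval⟩
  by_contra hni
  rw [integral_undef hni] at hval
  exact (one_div_ne_zero (mul_ne_zero (pow_ne_zero 2 hs0) hz)) hval.symm

theorem muLogSum_eq_zero_of_le_one (q : ℕ) {x : ℝ} (hx : x ≤ 1) : muLogSum q x = 0 := by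
  refine Finset.sum_eq_zero fun c hc => ?_
  obtain ⟨⟨h1, h2⟩, -⟩ := mem_coprimeIoc.1 hc
  have h3 : (1 : ℝ) ≤ c := by exact_mod_cast h1
  have h4 : x / c = 1 := by
    rw [le_antisymm hx (h3.trans h2), le_antisymm (h2.trans hx) h3, div_one]
  rw [h4, Real.log_one, mul_zero]

/-- The analytic continuation of `s ζ(1 + s)`. -/
def mulZetaAddOne (s : ℂ) : ℂ := DirichletCharacter.LFunctionTrivChar₁ 1 (1 + s)

theorem mulZetaAddOne_zero : mulZetaAddOne 0 = 1 := by
  simp [mulZetaAddOne, DirichletCharacter.LFunctionTrivChar₁]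

theorem mulZetaAddOne_of_ne {s : ℂ} (hs : s ≠ 0) : mulZetaAddOne s = s * riemannZeta (1 + s) := by
  have : (1 : ℂ) + s ≠ 1 := by simpa using hs
  rw [mulZetaAddOne, DirichletCharacter.LFunctionTrivChar₁, Function.update_of_ne this,
    DirichletCharacter.LFunctionTrivChar, DirichletCharacter.LFunction_modOne_eq]
  simp

theorem mulZetaAddOne_ne_zero {s : ℂ} (hs : 0 ≤ s.re) : mulZetaAddOne s ≠ 0 := by
  rcases eq_or_ne s 0 with rfl | h
  · rw [mulZetaAddOne_zero]; exact one_ne_zero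
  · rw [mulZetaAddOne_of_ne h]
    exact mul_ne_zero h (riemannZeta_ne_zero_of_one_le_re (by simpa using hs))

theorem differentiable_mulZetaAddOne : Differentiable ℂ mulZetaAddOne := by
  have := DirichletCharacter.differentiable_LFunctionTrivChar₁ 1
  exact this.comp (by fun_prop)

open MeasureTheory in
theorem tendsto_muLogSum_one : Tendsto (muLogSum 1) atTop (nhds 1) := by
  set hr : ℝ → ℝ := fun v => muLogSum 1 (Real.exp v) - (1 - Real.exp (-max v 0)) with hhr
  set Φ : ℂ → ℂ := fun s => 1 / mulZetaAddOne s - 1 / (1 + s) with hΦ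
  have hne1 : ∀ s : ℂ, 0 ≤ s.re → 1 + s ≠ 0 := by
    intro s hs h
    have := congrArg Complex.re h
    simp at this; linarith
  have hΦdiff : ∀ s : ℂ, 0 ≤ s.re → DifferentiableAt ℂ Φ s := by
    intro s hs
    refine DifferentiableAt.sub ?_ ?_
    · exact (differentiableAt_const _).div (differentiable_mulZetaAddOne s)
        (mulZetaAddOne_ne_zero hs)
    · exact (differentiableAt_const _).div (by fun_prop) (hne1 s hs)
  have hE : ContinuousOn (dslope Φ 0) {s : ℂ | 0 ≤ s.re} := by
    intro s hs
    apply ContinuousAt.continuousWithinAt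
    rcases eq_or_ne s 0 with rfl | h
    · exact continuousAt_dslope_same.2 (hΦdiff 0 (by simp))
    · exact (continuousAt_dslope_of_ne h).2 (hΦdiff s hs).continuousAt
  have hmax : ∀ x y : ℝ, |Real.exp (-max x 0) - Real.exp (-max y 0)| ≤ |x - y| := by
    intro x y
    wlog hxy : x ≤ y generalizing x y
    · rw [abs_sub_comm, abs_sub_comm x]; exact this y x (le_of_not_ge hxy)
    have h1 : max x 0 ≤ max y 0 := max_le_max hxy le_rfl
    have h2 : max y 0 - max x 0 ≤ y - x := by
      rcases le_total x 0 with h | h <;> rcases le_total y 0 with h' | h' <;> simp [h, h'] <;> linarith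
    have h3 : Real.exp (-max y 0) ≤ Real.exp (-max x 0) := Real.exp_le_exp.2 (by linarith)
    rw [abs_of_nonneg (by linarith), abs_of_nonpos (by linarith)]
    have h4 : Real.exp (-max y 0) = Real.exp (-max x 0) * Real.exp (-(max y 0 - max x 0)) := by
      rw [← Real.exp_add]; congr 1; ring
    have h5 := Real.add_one_le_exp (-(max y 0 - max x 0))
    have h6 : Real.exp (-max x 0) ≤ 1 := Real.exp_le_one_iff.2 (by simp)
    have h7 := Real.exp_pos (-max x 0)
    have h8 : Real.exp (-max x 0) * (1 - Real.exp (-(max y 0 - max x 0))) ≤ 1 * (y - x) :=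
      mul_le_mul h6 (by linarith) (by
        rw [sub_nonneg, Real.exp_le_one_iff]; linarith) zero_le_one
    rw [h4]; linarith
  have key := tendsto_zero_of_laplace_continuousOn (fun v => (hr v : ℂ)) 3 (by norm_num)
    (fun x y => ?_) (fun x hx => ?_) (dslope Φ 0) hE (fun s hs => ?_)
  · have key' : Tendsto hr atTop (nhds 0) := by
      have := (Complex.continuous_re.tendsto 0).comp key
      simpa [Function.comp_def] using this
    have h1 : Tendsto (fun v : ℝ => hr v + (1 - Real.exp (-v))) atTop (nhds (0 + (1 - 0))) :=
      key'.add (tendsto_const_nhds.sub (Real.tendsto_exp_atBot.comp tendsto_neg_atTop_atBot))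
    have h2 : Tendsto (fun v : ℝ => muLogSum 1 (Real.exp v)) atTop (nhds 1) := by
      rw [zero_add, sub_zero] at h1
      refine h1.congr' ?_
      filter_upwards [eventually_ge_atTop 0] with v hv
      simp only [hhr, max_eq_left hv]; ring
    refine (h2.comp Real.tendsto_log_atTop).congr' ?_
    filter_upwards [eventually_gt_atTop 0] with x hx
    simp [Real.exp_log hx]
  · rw [← Complex.ofReal_sub, Complex.norm_real, Real.norm_eq_abs]
    have h1 := abs_muLogSum_exp_sub_le x y
    have h2 := hmax x y
    calc |hr x - hr y| = |(muLogSum 1 (Real.exp x) - muLogSum 1 (Real.exp y)) +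
          (Real.exp (-max x 0) - Real.exp (-max y 0))| := by
            simp only [hhr]; congr 1; ring
      _ ≤ 2 * |x - y| + |x - y| := (abs_add_le _ _).trans (add_le_add h1 h2)
      _ = 3 * |x - y| := by ring
  · simp only [hhr]
    rw [muLogSum_eq_zero_of_le_one 1 (Real.exp_le_one_iff.2 hx), max_eq_right hx]
    simp
  · have hs0 : s ≠ 0 := by rintro rfl; simp at hs
    have hs1 := hne1 s hs.le
    obtain ⟨i1, v1⟩ := integral_muLogSum_exp s hs
    have i2 : IntegrableOn (fun v : ℝ => Complex.exp (-s * v)) (Set.Ioi 0) :=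
      integrableOn_exp_mul_complex_Ioi (by simpa using hs) 0
    have v2 := integral_exp_mul_complex_Ioi (a := -s) (by simpa using hs) 0
    have hs1' : (-(1 + s)).re < 0 := by simp; linarith
    have i3 : IntegrableOn (fun v : ℝ => Complex.exp (-(1 + s) * v)) (Set.Ioi 0) :=
      integrableOn_exp_mul_complex_Ioi hs1' 0
    have v3 := integral_exp_mul_complex_Ioi hs1' 0
    have heq : ∫ v in Set.Ioi (0 : ℝ), (hr v : ℂ) * Complex.exp (-s * v) =
        ∫ v in Set.Ioi (0 : ℝ), ((muLogSum 1 (Real.exp v) : ℂ) * Complex.exp (-s * v) -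
          Complex.exp (-s * v) + Complex.exp (-(1 + s) * v)) := by
      refine setIntegral_congr_fun measurableSet_Ioi fun v hv => ?_
      have hv : (0 : ℝ) < v := hv
      simp only [hhr, max_eq_left hv.le]
      have : Complex.exp (-(1 + s) * v) = Complex.exp (-v) * Complex.exp (-s * v) := by
        rw [← Complex.exp_add]; congr 1; ring
      rw [this]; push_cast; ring
    have i12 : IntegrableOn (fun v : ℝ => (muLogSum 1 (Real.exp v) : ℂ) * Complex.exp (-s * v) -
          Complex.exp (-s * v)) (Set.Ioi 0) := i1.sub i2
    rw [heq, integral_add i12 i3, integral_sub i1 i2, v1, v2, v3, dslope_of_ne _ hs0, slope_def_field]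
    simp only [hΦ, mulZetaAddOne_zero, mulZetaAddOne_of_ne hs0]
    have hz := riemannZeta_ne_zero_of_one_le_re (s := 1 + s) (by simp [hs.le])
    simp only [Complex.ofReal_zero, mul_zero, Complex.exp_zero, neg_div_neg_eq, add_zero]
    field_simp
    ring

/-- A quantitative bound uniform in `x`. -/
theorem exists_abs_muLogSum_one_sub_one_le (δ : ℝ) (hδ : 0 < δ) :
    ∃ A : ℝ, 1 ≤ A ∧ ∀ x : ℝ, 0 < x → |muLogSum 1 x - 1| ≤ δ + A * x ^ (-(1 / 2) : ℝ) := by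
  obtain ⟨x₀, hx₀⟩ := Filter.eventually_atTop.1
    (Metric.tendsto_nhds.1 tendsto_muLogSum_one δ hδ)
  set X := max x₀ 1
  have hX : 1 ≤ X := le_max_right _ _
  set B := 2 * Real.log X + 1
  have hB : 1 ≤ B := by have := Real.log_nonneg hX; simp only [B]; linarith
  refine ⟨B * X ^ (1 / 2 : ℝ), ?_, fun x hx => ?_⟩
  · nlinarith [Real.one_le_rpow hX (by norm_num : (0 : ℝ) ≤ 1 / 2)]
  rcases le_or_gt X x with h | h
  · have h1 := hx₀ x ((le_max_left _ _).trans h)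
    rw [Real.dist_eq] at h1
    have : 0 ≤ B * X ^ (1 / 2 : ℝ) * x ^ (-(1 / 2) : ℝ) := by positivity
    linarith
  · have h1 : |muLogSum 1 x - 1| ≤ B := by
      rcases le_or_gt x 1 with h' | h'
      · rw [muLogSum_eq_zero_of_le_one 1 h']; simpa using hB
      · have h2 := abs_muLogSum_exp_sub_le (Real.log x) 0
        rw [Real.exp_log hx, Real.exp_zero, muLogSum_eq_zero_of_le_one 1 le_rfl, sub_zero,
          sub_zero, abs_of_nonneg (Real.log_nonneg h'.le)] at h2
        have h3 := Real.log_le_log hx h.le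
        calc _ ≤ |muLogSum 1 x| + |1| := abs_sub _ _
          _ ≤ B := by rw [abs_one]; simp only [B]; linarith
    have h2 : 1 ≤ X ^ (1 / 2 : ℝ) * x ^ (-(1 / 2) : ℝ) := by
      rw [Real.rpow_neg hx.le, ← div_eq_mul_inv, one_le_div (by positivity)]
      exact Real.rpow_le_rpow hx.le h.le (by norm_num)
    rw [mul_assoc]
    nlinarith

theorem squarefree_induction {P : (q : ℕ) → Squarefree q → Prop} (h1 : P 1 squarefree_one)
    (hmul : ∀ (p q : ℕ) (_ : p.Prime) (hq : Squarefree q) (_ : p.Coprime q)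
      (hpq : Squarefree (p * q)), P q hq → P (p * q) hpq) (q : ℕ) (hq : Squarefree q) : P q hq := by
  induction q using Nat.strong_induction_on with
  | _ q ih =>
    rcases eq_or_ne q 1 with rfl | hne
    · exact h1
    have hp := Nat.minFac_prime hne
    obtain ⟨r, hr⟩ := Nat.minFac_dvd q
    have hr0 : 0 < r := by
      rcases Nat.eq_zero_or_pos r with rfl | h
      · exact absurd hr (by simpa using hq.ne_zero)
      · exact h
    have hlt : r < q := by
      conv_rhs => rw [hr]
      exact lt_mul_of_one_lt_left hr0 hp.one_lt
    generalize q.minFac = p at hp hr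
    subst hr
    exact hmul p r hp hq.of_mul_right (Nat.coprime_of_squarefree_mul hq) hq
      (ih r hlt hq.of_mul_right)

theorem moebius_mul_real {a b : ℕ} (h : a.Coprime b) :
    (ArithmeticFunction.moebius (a * b) : ℝ) =
      ArithmeticFunction.moebius a * ArithmeticFunction.moebius b := by
  rw [ArithmeticFunction.isMultiplicative_moebius.map_mul_of_coprime h]
  push_cast; rfl

/-- Decompose a sum over `d` according to `gcd(d, e)`. -/
theorem sum_moebius_eq_sum_divisors {e q : ℕ} (he : Squarefree e) (heq : e.Coprime q) (X : ℝ)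
    (F : ℕ → ℝ) :
    ∑ d ∈ coprimeIoc q X, (ArithmeticFunction.moebius d : ℝ) * F d =
      ∑ g ∈ e.divisors, (ArithmeticFunction.moebius g : ℝ) *
        ∑ c ∈ coprimeIoc (e * q) (X / g), (ArithmeticFunction.moebius c : ℝ) * F (g * c) := by
  rw [← Finset.sum_fiberwise_of_maps_to (s := coprimeIoc q X) (t := e.divisors)
    (g := fun d => d.gcd e) (fun d _ => Nat.mem_divisors.2 ⟨Nat.gcd_dvd_right _ _, he.ne_zero⟩)]
  refine Finset.sum_congr rfl fun g hg => ?_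
  have hge := (Nat.mem_divisors.1 hg).1
  have hg0 : 0 < g := Nat.pos_of_dvd_of_pos hge (Nat.pos_of_ne_zero he.ne_zero)
  have hg0' : (0 : ℝ) < g := by exact_mod_cast hg0
  rw [Finset.mul_sum]
  have h1 : ∑ c ∈ coprimeIoc (e * q) (X / g), (ArithmeticFunction.moebius g : ℝ) *
      ((ArithmeticFunction.moebius c : ℝ) * F (g * c)) =
      ∑ d ∈ (coprimeIoc (e * q) (X / g)).image (fun c => g * c),
        (ArithmeticFunction.moebius d : ℝ) * F d := by
    rw [Finset.sum_image (fun a _ b _ h => Nat.eq_of_mul_eq_mul_left hg0 h)]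
    refine Finset.sum_congr rfl fun c hc => ?_
    have hc := (mem_coprimeIoc.1 hc).2
    have : g.Coprime c := ((hc.coprime_mul_right_right).coprime_dvd_right hge).symm
    rw [moebius_mul_real this, mul_assoc]
  rw [h1]
  symm
  refine Finset.sum_subset ?_ ?_
  · intro d hd
    obtain ⟨c, hc, rfl⟩ := Finset.mem_image.1 hd
    obtain ⟨⟨hc0, hcX⟩, hcop⟩ := mem_coprimeIoc.1 hc
    have hce : c.Coprime e := hcop.coprime_mul_right_right
    refine Finset.mem_filter.2 ⟨mem_coprimeIoc.2 ⟨⟨Nat.mul_pos hg0 hc0, ?_⟩, ?_⟩, ?_⟩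
    · rw [le_div_iff₀ hg0'] at hcX
      push_cast; linarith
    · exact Nat.Coprime.mul_left (heq.coprime_dvd_left hge) hcop.coprime_mul_left_right
    · rw [Nat.Coprime.gcd_mul_right_cancel _ hce]
      exact Nat.gcd_eq_left hge
  · intro d hd hd'
    obtain ⟨hd1, hd2⟩ := Finset.mem_filter.1 hd
    obtain ⟨⟨hd0, hdX⟩, hdq⟩ := mem_coprimeIoc.1 hd1
    suffices h : ¬ Squarefree d by
      rw [ArithmeticFunction.moebius_eq_zero_of_not_squarefree h]; simp
    intro hsq
    apply hd'
    have hgd : g ∣ d := hd2 ▸ Nat.gcd_dvd_left d e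
    obtain ⟨c, rfl⟩ := hgd
    have hgc : g.Coprime c := Nat.coprime_of_squarefree_mul hsq
    refine Finset.mem_image.2 ⟨c, mem_coprimeIoc.2 ⟨⟨Nat.pos_of_mul_pos_left hd0, ?_⟩, ?_⟩, rfl⟩
    · rw [le_div_iff₀ hg0']
      push_cast at hdX; linarith
    · refine Nat.Coprime.mul_right ?_ (hdq.coprime_dvd_left (Dvd.intro_left g rfl))
      have h3 : c.gcd e ∣ g := by
        conv_rhs => rw [← hd2]
        exact Nat.dvd_gcd ((Nat.gcd_dvd_left c e).mul_left g) (Nat.gcd_dvd_right c e)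
      exact Nat.eq_one_of_dvd_coprimes hgc h3 (Nat.gcd_dvd_left c e)

theorem sum_moebius_dvd {r q : ℕ} (hr : Squarefree r) (hrq : r.Coprime q) (X : ℝ) (F : ℕ → ℝ) :
    ∑ d ∈ coprimeIoc q X, (ArithmeticFunction.moebius d : ℝ) * (if r ∣ d then F d else 0) =
      (ArithmeticFunction.moebius r : ℝ) *
        ∑ c ∈ coprimeIoc (r * q) (X / r), (ArithmeticFunction.moebius c : ℝ) * F (r * c) := by
  rw [sum_moebius_eq_sum_divisors hr hrq]
  rw [Finset.sum_eq_single_of_mem r (Nat.mem_divisors_self r hr.ne_zero)]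
  · congr 1
    refine Finset.sum_congr rfl fun c _ => ?_
    rw [if_pos (Nat.dvd_mul_right r c)]
  · intro g hg hgr
    rw [Finset.sum_eq_zero, mul_zero]
    intro c hc
    have hc := (mem_coprimeIoc.1 hc).2
    rw [if_neg, mul_zero]
    intro h
    have h2 : r ∣ g := Nat.Coprime.dvd_of_dvd_mul_right (hc.coprime_mul_right_right).symm h
    exact hgr (Nat.dvd_antisymm (Nat.dvd_of_mem_divisors hg) h2)

theorem muLogSum_prime_mul {p q : ℕ} (hp : p.Prime) (hpq : p.Coprime q) (x : ℝ) :
    muLogSum (p * q) x = muLogSum q x + muLogSum (p * q) (x / p) / p := by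
  have h := sum_moebius_eq_sum_divisors (Irreducible.squarefree hp) hpq x
    (fun d => 1 / d * Real.log (x / d))
  rw [hp.divisors, Finset.sum_pair hp.one_lt.ne, ArithmeticFunction.moebius_apply_prime hp] at h
  simp only [muLogSum, Finset.sum_div]
  have hp0 : (p : ℝ) ≠ 0 := by exact_mod_cast hp.ne_zero
  have e1 : ∀ (q : ℕ) (y : ℝ), ∑ c ∈ coprimeIoc q y, (ArithmeticFunction.moebius c : ℝ) / c *
      Real.log (x / c) = ∑ c ∈ coprimeIoc q y, (ArithmeticFunction.moebius c : ℝ) *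
        (1 / c * Real.log (x / c)) := fun q y => Finset.sum_congr rfl fun c _ => by ring
  rw [e1, e1, h]
  simp only [Nat.cast_one, div_one, one_mul, ArithmeticFunction.moebius_apply_one, Int.cast_one,
    Int.cast_neg, neg_mul, Nat.cast_mul]
  rw [← sub_eq_add_neg, sub_add_eq_add_sub, eq_comm, sub_eq_iff_eq_add]
  congr 1
  refine Finset.sum_congr rfl fun c _ => ?_
  rw [div_div, mul_comm (p : ℝ) c]
  field_simp

/-- `q / φ(q)`. -/
def totRatio (q : ℕ) : ℝ := (q : ℝ) / Nat.totient q

theorem totRatio_one : totRatio 1 = 1 := by simp [totRatio]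

theorem totRatio_mul {a b : ℕ} (h : a.Coprime b) :
    totRatio (a * b) = totRatio a * totRatio b := by
  rw [totRatio, totRatio, totRatio, Nat.totient_mul h]
  push_cast
  rw [div_mul_div_comm]

theorem one_le_totRatio {q : ℕ} (hq : q ≠ 0) : 1 ≤ totRatio q := by
  have : (0 : ℝ) < Nat.totient q := by
    exact_mod_cast Nat.totient_pos.2 (Nat.pos_of_ne_zero hq)
  rw [totRatio, one_le_div this]
  exact_mod_cast Nat.totient_le q

theorem totRatio_prime {p : ℕ} (hp : p.Prime) : totRatio p = 1 + totRatio p / p := by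
  have h1 : (1 : ℝ) < p := by exact_mod_cast hp.one_lt
  rw [totRatio, Nat.totient_prime hp, Nat.cast_sub hp.one_lt.le]
  have : (p : ℝ) - (1 : ℕ) ≠ 0 := by push_cast; linarith
  field_simp
  push_cast; ring

/-- `∏_{p ∣ q} (1 - p^{-1/2})⁻¹`. -/
def invSqrtProd (q : ℕ) : ℝ := ∏ p ∈ q.primeFactors, (1 - (p : ℝ) ^ (-(1 / 2) : ℝ))⁻¹

theorem invSqrtProd_one : invSqrtProd 1 = 1 := by simp [invSqrtProd]

theorem invSqrtProd_mul {a b : ℕ} (h : a.Coprime b) :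
    invSqrtProd (a * b) = invSqrtProd a * invSqrtProd b := by
  rw [invSqrtProd, h.primeFactors_mul, Finset.prod_union h.disjoint_primeFactors]
  rfl

theorem invSqrtProd_prime {p : ℕ} (hp : p.Prime) :
    invSqrtProd p = (1 - (p : ℝ) ^ (-(1 / 2) : ℝ))⁻¹ := by
  rw [invSqrtProd, hp.primeFactors, Finset.prod_singleton]

theorem prime_rpow_neg_half_lt_one {p : ℕ} (hp : p.Prime) : (p : ℝ) ^ (-(1 / 2) : ℝ) < 1 :=
  Real.rpow_lt_one_of_one_lt_of_neg (by exact_mod_cast hp.one_lt) (by norm_num)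

theorem invSqrtProd_prime_eq {p : ℕ} (hp : p.Prime) :
    invSqrtProd p = 1 + (p : ℝ) ^ (-(1 / 2) : ℝ) * invSqrtProd p := by
  have := prime_rpow_neg_half_lt_one hp
  rw [invSqrtProd_prime hp]
  have h2 : 1 - (p : ℝ) ^ (-(1 / 2) : ℝ) ≠ 0 := by linarith
  field_simp
  ring

theorem invSqrtProd_pos (q : ℕ) : 0 < invSqrtProd q := by
  refine Finset.prod_pos fun p hp => inv_pos.2 ?_
  have := prime_rpow_neg_half_lt_one (Nat.prime_of_mem_primeFactors hp)
  linarith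

theorem invSqrtProd_prime_le {p : ℕ} (hp : p.Prime) : invSqrtProd p ≤ 4 := by
  rw [invSqrtProd_prime hp]
  have h1 : (p : ℝ) ^ (-(1 / 2) : ℝ) ≤ 3 / 4 := by
    have h2 : (2 : ℝ) ≤ p := by exact_mod_cast hp.two_le
    rw [Real.rpow_neg (by positivity), ← Real.sqrt_eq_rpow]
    have h3 : (4 / 3 : ℝ) ≤ Real.sqrt p := Real.le_sqrt_of_sq_le (by nlinarith)
    calc (Real.sqrt p)⁻¹ ≤ (4 / 3 : ℝ)⁻¹ := inv_anti₀ (by norm_num) h3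
      _ = 3 / 4 := by norm_num
  calc _ ≤ (1 / 4 : ℝ)⁻¹ := inv_anti₀ (by norm_num) (by linarith)
    _ = 4 := by norm_num

theorem totRatio_prime_le_two {p : ℕ} (hp : p.Prime) : totRatio p ≤ 2 := by
  have h1 : (2 : ℝ) ≤ p := by exact_mod_cast hp.two_le
  rw [totRatio, Nat.totient_prime hp, Nat.cast_sub hp.one_lt.le, div_le_iff₀ (by push_cast; linarith)]
  push_cast; linarith

theorem totRatio_le_invSqrtProd {q : ℕ} (hq : Squarefree q) : totRatio q ≤ invSqrtProd q := by
  induction q, hq using squarefree_induction with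
  | h1 => rw [totRatio_one, invSqrtProd_one]
  | hmul p q hp hq hpq hsq ih =>
    rw [totRatio_mul hpq, invSqrtProd_mul hpq]
    have h0 : 0 ≤ totRatio p := zero_le_one.trans (one_le_totRatio hp.ne_zero)
    refine mul_le_mul ?_ ih (zero_le_one.trans (one_le_totRatio hq.ne_zero)) (invSqrtProd_pos p).le
    have h1 : (2 : ℝ) ≤ p := by exact_mod_cast hp.two_le
    have e1 : totRatio p = (1 - (p : ℝ)⁻¹)⁻¹ := by
      rw [totRatio, Nat.totient_prime hp, Nat.cast_sub hp.one_lt.le]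
      have : (p : ℝ) - 1 ≠ 0 := by linarith
      push_cast
      field_simp
    rw [e1, invSqrtProd_prime hp]
    have h2 := prime_rpow_neg_half_lt_one hp
    refine inv_anti₀ (by linarith) ?_
    have h3 : (p : ℝ)⁻¹ ≤ (p : ℝ) ^ (-(1 / 2) : ℝ) := by
      rw [← Real.rpow_neg_one]
      exact Real.rpow_le_rpow_of_exponent_le (by linarith) (by norm_num)
    linarith

/-- Induction along `x ↦ x / p`. -/
theorem div_induction {p : ℕ} (hp : 2 ≤ p) {P : ℝ → Prop} (h1 : ∀ x, 0 < x → x ≤ 1 → P x)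
    (hstep : ∀ x, 0 < x → P (x / p) → P x) (x : ℝ) (hx : 0 < x) : P x := by
  have key : ∀ n : ℕ, ∀ x, 0 < x → x ≤ (p : ℝ) ^ n → P x := by
    intro n
    induction n with
    | zero => intro x hx h; exact h1 x hx (by simpa using h)
    | succ n ih =>
      intro x hx h
      have hp0 : (0 : ℝ) < p := by exact_mod_cast (by omega : 0 < p)
      refine hstep x hx (ih _ (by positivity) ?_)
      rw [div_le_iff₀ hp0, ← pow_succ]; exact h
  obtain ⟨n, hn⟩ := pow_unbounded_of_one_lt x (by exact_mod_cast hp : (1 : ℝ) < p)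
  exact key n x hx hn.le

theorem abs_muLogSum_le_of_one {C : ℝ} (hC : 0 ≤ C) (h : ∀ x, 0 < x → |muLogSum 1 x| ≤ C)
    {q : ℕ} (hq : Squarefree q) : ∀ x, 0 < x → |muLogSum q x| ≤ C * totRatio q := by
  induction q, hq using squarefree_induction with
  | h1 => intro x hx; rw [totRatio_one, mul_one]; exact h x hx
  | hmul p q hp hq hpq hsq ih =>
    have ht := one_le_totRatio hq.ne_zero
    have htp := one_le_totRatio hp.ne_zero
    have hp0 : (0 : ℝ) < p := by exact_mod_cast hp.pos
    refine div_induction hp.two_le (fun x hx hx1 => ?_) (fun x hx hx1 => ?_)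
    · rw [muLogSum_eq_zero_of_le_one _ hx1, abs_zero, totRatio_mul hpq]; positivity
    · rw [muLogSum_prime_mul hp hpq]
      calc _ ≤ |muLogSum q x| + |muLogSum (p * q) (x / p)| / p := by
            refine (abs_add_le _ _).trans (le_of_eq ?_)
            rw [abs_div, abs_of_pos hp0]
        _ ≤ C * totRatio q + C * totRatio (p * q) / p := by
            gcongr; exact ih x hx
        _ = C * totRatio (p * q) := by
            rw [totRatio_mul hpq]
            linear_combination (-(C * totRatio q)) * totRatio_prime hp

theorem abs_muLogSum_sub_totRatio_le {δ A : ℝ} (hδ : 0 ≤ δ) (hA : 1 ≤ A)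
    (h : ∀ x : ℝ, 0 < x → |muLogSum 1 x - 1| ≤ δ + A * x ^ (-(1 / 2) : ℝ))
    {q : ℕ} (hq : Squarefree q) : ∀ x, 0 < x →
      |muLogSum q x - totRatio q| ≤ δ * totRatio q + A * x ^ (-(1 / 2) : ℝ) * invSqrtProd q := by
  induction q, hq using squarefree_induction with
  | h1 => intro x hx; rw [totRatio_one, invSqrtProd_one, mul_one, mul_one]; exact h x hx
  | hmul p q hp hq hpq hsq ih =>
    have ht := one_le_totRatio hq.ne_zero
    have htp := one_le_totRatio hp.ne_zero
    have hp0 : (0 : ℝ) < p := by exact_mod_cast hp.pos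
    refine div_induction hp.two_le (fun x hx hx1 => ?_) (fun x hx hx1 => ?_)
    · have h0 := one_le_totRatio hsq.ne_zero
      rw [muLogSum_eq_zero_of_le_one _ hx1, zero_sub, abs_neg, abs_of_nonneg (by linarith)]
      have h1 : 1 ≤ x ^ (-(1 / 2) : ℝ) :=
        Real.one_le_rpow_of_pos_of_le_one_of_nonpos hx hx1 (by norm_num)
      have h2 := totRatio_le_invSqrtProd hsq
      have h3 : 1 * 1 * invSqrtProd (p * q) ≤ A * x ^ (-(1 / 2) : ℝ) * invSqrtProd (p * q) := by
        have := (invSqrtProd_pos (p * q)).le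
        gcongr
      have : 0 ≤ δ * totRatio (p * q) := by positivity
      linarith
    · rw [muLogSum_prime_mul hp hpq]
      have hxp : (x / p) ^ (-(1 / 2) : ℝ) = x ^ (-(1 / 2) : ℝ) * (p * (p : ℝ) ^ (-(1 / 2) : ℝ)) := by
        rw [Real.div_rpow hx.le hp0.le, div_eq_mul_inv, ← Real.rpow_neg hp0.le]
        congr 1
        nth_rewrite 2 [← Real.rpow_one (p : ℝ)]
        rw [← Real.rpow_add hp0]; norm_num
      calc |muLogSum q x + muLogSum (p * q) (x / p) / p - totRatio (p * q)|
          = |(muLogSum q x - totRatio q) +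
              (muLogSum (p * q) (x / p) - totRatio (p * q)) / p| := by
            congr 1
            rw [totRatio_mul hpq]
            linear_combination (-(totRatio q)) * totRatio_prime hp
        _ ≤ |muLogSum q x - totRatio q| +
            |muLogSum (p * q) (x / p) - totRatio (p * q)| / p := by
            refine (abs_add_le _ _).trans (le_of_eq ?_)
            rw [abs_div, abs_of_pos hp0]
        _ ≤ (δ * totRatio q + A * x ^ (-(1 / 2) : ℝ) * invSqrtProd q) +
            (δ * totRatio (p * q) + A * (x / p) ^ (-(1 / 2) : ℝ) * invSqrtProd (p * q)) / p := by
            gcongr; exact ih x hx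
        _ = _ := by
            rw [totRatio_mul hpq, invSqrtProd_mul hpq, hxp]
            have e1 : A * (x ^ (-(1 / 2) : ℝ) * (p * (p : ℝ) ^ (-(1 / 2) : ℝ))) *
                (invSqrtProd p * invSqrtProd q) / p =
                A * x ^ (-(1 / 2) : ℝ) * ((p : ℝ) ^ (-(1 / 2) : ℝ) * invSqrtProd p) *
                  invSqrtProd q := by
              field_simp
            rw [add_div, e1]
            linear_combination (-(δ * totRatio q)) * totRatio_prime hp -
              A * x ^ (-(1 / 2) : ℝ) * invSqrtProd q * invSqrtProd_prime_eq hp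

/-- `∏_{p ∣ q} (1 - p^{-1/2})⁻¹` grows slower than any power of `q`. -/
theorem exists_invSqrtProd_le (η : ℝ) (hη : 0 < η) :
    ∃ K : ℝ, 1 ≤ K ∧ ∀ q : ℕ, Squarefree q → invSqrtProd q ≤ K * (q : ℝ) ^ η := by
  obtain ⟨b, hb⟩ := Filter.eventually_atTop.1
    ((tendsto_rpow_atTop hη).eventually_ge_atTop (4 : ℝ))
  set B := ⌈b⌉₊
  have hB : ∀ p : ℕ, B ≤ p → (4 : ℝ) ≤ (p : ℝ) ^ η := fun p hp =>
    hb p ((Nat.le_ceil b).trans (by exact_mod_cast hp))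
  refine ⟨4 ^ B, one_le_pow₀ (by norm_num), fun q hq => ?_⟩
  have h1 : invSqrtProd q ≤ 4 ^ (q.primeFactors.filter (· < B)).card * (q : ℝ) ^ η := by
    have e1 : (q : ℝ) ^ η = ∏ p ∈ q.primeFactors, (p : ℝ) ^ η := by
      rw [Real.finsetProd_rpow _ _ (fun i _ => Nat.cast_nonneg i)]
      congr 1
      rw [← Nat.cast_prod, Nat.prod_primeFactors_of_squarefree hq]
    have e2 : (4 : ℝ) ^ (q.primeFactors.filter (· < B)).card =
        ∏ p ∈ q.primeFactors, if p < B then (4 : ℝ) else 1 := by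
      rw [← Finset.prod_filter, Finset.prod_const]
    rw [e1, e2, ← Finset.prod_mul_distrib]
    refine Finset.prod_le_prod (fun p hp => ?_) (fun p hp => ?_)
    · have := prime_rpow_neg_half_lt_one (Nat.prime_of_mem_primeFactors hp)
      exact inv_nonneg.2 (by linarith)
    · have hp' := Nat.prime_of_mem_primeFactors hp
      rw [← invSqrtProd_prime hp']
      have h4 := invSqrtProd_prime_le hp'
      split_ifs with h
      · have : 1 ≤ (p : ℝ) ^ η :=
          Real.one_le_rpow (by exact_mod_cast hp'.one_lt.le) hη.le
        linarith
      · rw [one_mul]; exact h4.trans (hB p (not_lt.1 h))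
  refine h1.trans ?_
  gcongr
  · norm_num
  · calc _ ≤ (Finset.range B).card := Finset.card_le_card fun p hp => by
          simpa using (Finset.mem_filter.1 hp).2
      _ = B := Finset.card_range B

/-- `∑_{c ≤ X, c' ≤ Y} μ(c) μ(c') log (X/c) log (Y/c') / [c, c']` over `c, c'` coprime to `q`. -/
def quadSum (q : ℕ) (X Y : ℝ) : ℝ :=
  ∑ c ∈ coprimeIoc q X, ∑ c' ∈ coprimeIoc q Y,
    (ArithmeticFunction.moebius c : ℝ) * ArithmeticFunction.moebius c' *
      (Real.log (X / c) * Real.log (Y / c')) / (Nat.lcm c c' : ℝ)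

/-- `∑_{r ≤ X, (r, q) = 1} μ(r)² / φ(r)`. -/
def totientSum (q : ℕ) (X : ℝ) : ℝ :=
  ∑ r ∈ coprimeIoc q X, (ArithmeticFunction.moebius r : ℝ) ^ 2 / Nat.totient r

theorem one_div_lcm_eq {q c c' : ℕ} {R : ℝ} (hc : c ∈ coprimeIoc q R) (hc' : 0 < c') :
    (1 : ℝ) / (Nat.lcm c c' : ℝ) = ∑ r ∈ coprimeIoc q R,
      (Nat.totient r : ℝ) * ((if r ∣ c then (1 : ℝ) / c else 0) *
        (if r ∣ c' then (1 : ℝ) / c' else 0)) := by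
  obtain ⟨⟨hc0, hcR⟩, hcq⟩ := mem_coprimeIoc.1 hc
  have h1 : ∀ r : ℕ, (Nat.totient r : ℝ) * ((if r ∣ c then (1 : ℝ) / c else 0) *
        (if r ∣ c' then (1 : ℝ) / c' else 0)) =
      if r ∣ c.gcd c' then (Nat.totient r : ℝ) / (c * c') else 0 := by
    intro r
    by_cases h1 : r ∣ c <;> by_cases h2 : r ∣ c' <;> simp [h1, h2, Nat.dvd_gcd_iff]
    ring
  simp_rw [h1]
  rw [← Finset.sum_filter]
  have h2 : (coprimeIoc q R).filter (fun r => r ∣ c.gcd c') = (c.gcd c').divisors := by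
    ext r
    rw [Finset.mem_filter, Nat.mem_divisors, mem_coprimeIoc]
    constructor
    · rintro ⟨_, h⟩
      exact ⟨h, (Nat.gcd_pos_of_pos_left _ hc0).ne'⟩
    · rintro ⟨h, -⟩
      have hrc := h.trans (Nat.gcd_dvd_left c c')
      refine ⟨⟨⟨Nat.pos_of_dvd_of_pos hrc hc0, ?_⟩, hcq.coprime_dvd_left hrc⟩, h⟩
      exact (Nat.cast_le.2 (Nat.le_of_dvd hc0 hrc)).trans hcR
  rw [h2, ← Finset.sum_div, ← Nat.cast_sum, Nat.sum_totient]
  have h3 : ((c.gcd c' : ℕ) : ℝ) * (c.lcm c' : ℕ) = c * c' := by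
    exact_mod_cast Nat.gcd_mul_lcm c c'
  have h4 : ((c.lcm c' : ℕ) : ℝ) ≠ 0 := by exact_mod_cast (Nat.lcm_pos hc0 hc').ne'
  have h5 : (c : ℝ) * c' ≠ 0 := by positivity
  rw [div_eq_div_iff h4 h5, one_mul, h3]

theorem sum_moebius_dvd_log (q r : ℕ) (hrq : r.Coprime q) (hr : 0 < r) (X : ℝ) :
    ∑ c ∈ coprimeIoc q X, (ArithmeticFunction.moebius c : ℝ) * Real.log (X / c) *
      (if r ∣ c then (1 : ℝ) / c else 0) =
      (ArithmeticFunction.moebius r : ℝ) / r * muLogSum (r * q) (X / r) := by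
  have e : ∀ c : ℕ, (ArithmeticFunction.moebius c : ℝ) * Real.log (X / c) *
      (if r ∣ c then (1 : ℝ) / c else 0) = (ArithmeticFunction.moebius c : ℝ) *
      (if r ∣ c then Real.log (X / c) / c else 0) := by
    intro c; split_ifs <;> ring
  simp_rw [e]
  by_cases hsq : Squarefree r
  · rw [sum_moebius_dvd hsq hrq X (fun c => Real.log (X / c) / c), div_mul_eq_mul_div, mul_div_assoc]
    congr 1
    rw [muLogSum, Finset.sum_div]
    refine Finset.sum_congr rfl fun c hc => ?_
    have hc0 : (c : ℝ) ≠ 0 := by exact_mod_cast (mem_coprimeIoc.1 hc).1.1.ne'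
    have hr0 : (r : ℝ) ≠ 0 := by exact_mod_cast hr.ne'
    rw [div_div X]
    push_cast
    field_simp
  · rw [ArithmeticFunction.moebius_eq_zero_of_not_squarefree hsq]
    rw [Finset.sum_eq_zero]
    · simp
    · intro c _
      split_ifs with h
      · rw [ArithmeticFunction.moebius_eq_zero_of_not_squarefree (fun h' => hsq (h'.squarefree_of_dvd h))]
        simp
      · simp

theorem coprimeIoc_mono {q : ℕ} {X Y : ℝ} (h : X ≤ Y) : coprimeIoc q X ⊆ coprimeIoc q Y := by
  intro c hc
  obtain ⟨⟨h1, h2⟩, h3⟩ := mem_coprimeIoc.1 hc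
  exact mem_coprimeIoc.2 ⟨⟨h1, h2.trans h⟩, h3⟩

/-- Diagonalisation of the quadratic form. -/
theorem quadSum_eq (q : ℕ) {X Y R : ℝ} (hX : X ≤ R) :
    quadSum q X Y = ∑ r ∈ coprimeIoc q R, (ArithmeticFunction.moebius r : ℝ) ^ 2 *
      ((Nat.totient r : ℝ) / (r : ℝ) ^ 2) *
        (muLogSum (r * q) (X / r) * muLogSum (r * q) (Y / r)) := by
  have h1 : quadSum q X Y = ∑ c ∈ coprimeIoc q X, ∑ c' ∈ coprimeIoc q Y, ∑ r ∈ coprimeIoc q R,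
      (Nat.totient r : ℝ) * (((ArithmeticFunction.moebius c : ℝ) * Real.log (X / c) *
        (if r ∣ c then (1 : ℝ) / c else 0)) * ((ArithmeticFunction.moebius c' : ℝ) *
          Real.log (Y / c') * (if r ∣ c' then (1 : ℝ) / c' else 0))) := by
    refine Finset.sum_congr rfl fun c hc => Finset.sum_congr rfl fun c' hc' => ?_
    rw [div_eq_mul_one_div, one_div_lcm_eq (coprimeIoc_mono hX hc) (mem_coprimeIoc.1 hc').1.1,
      Finset.mul_sum]
    refine Finset.sum_congr rfl fun r _ => ?_
    ring
  rw [h1]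
  simp_rw [Finset.sum_comm (s := coprimeIoc q Y) (t := coprimeIoc q R)]
  rw [Finset.sum_comm]
  refine Finset.sum_congr rfl fun r hr => ?_
  obtain ⟨⟨hr0, -⟩, hrq⟩ := mem_coprimeIoc.1 hr
  simp_rw [← Finset.mul_sum]
  rw [← Finset.sum_mul, sum_moebius_dvd_log q r hrq hr0, sum_moebius_dvd_log q r hrq hr0]
  ring

theorem abs_quadSum_le {C : ℝ} (hC : 0 ≤ C)
    (h : ∀ q : ℕ, Squarefree q → ∀ x, 0 < x → |muLogSum q x| ≤ C * totRatio q)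
    {q : ℕ} (hq : Squarefree q) {X Y R : ℝ} (hX0 : 0 < X) (hY0 : 0 < Y) (hX : X ≤ R) :
    |quadSum q X Y| ≤ C ^ 2 * totRatio q ^ 2 * totientSum q R := by
  rw [quadSum_eq q hX, totientSum, Finset.mul_sum]
  refine (Finset.abs_sum_le_sum_abs _ _).trans (Finset.sum_le_sum fun r hr => ?_)
  obtain ⟨⟨hr0, -⟩, hrq⟩ := mem_coprimeIoc.1 hr
  have hr0' : (0 : ℝ) < r := by exact_mod_cast hr0
  have hφ : (0 : ℝ) < Nat.totient r := by exact_mod_cast Nat.totient_pos.2 hr0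
  by_cases hsq : Squarefree r
  · have hrq' : Squarefree (r * q) := (Nat.squarefree_mul hrq).2 ⟨hsq, hq⟩
    rw [abs_mul, abs_mul, abs_mul, abs_of_nonneg (sq_nonneg _), abs_of_nonneg (by positivity)]
    have b1 := h (r * q) hrq' (X / r) (by positivity)
    have b2 := h (r * q) hrq' (Y / r) (by positivity)
    have h0 := one_le_totRatio hrq'.ne_zero
    calc _ ≤ (ArithmeticFunction.moebius r : ℝ) ^ 2 * ((Nat.totient r : ℝ) / (r : ℝ) ^ 2) *
          ((C * totRatio (r * q)) * (C * totRatio (r * q))) := by gcongr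
      _ = _ := by
        rw [totRatio_mul hrq, totRatio]
        field_simp
  · rw [ArithmeticFunction.moebius_eq_zero_of_not_squarefree hsq]
    simp

/-- The part of the quadratic form supported on `e ∣ [d, d']`. -/
def lcmSum (q : ℕ) (R : ℝ) (e : ℕ) : ℝ :=
  ∑ d ∈ coprimeIoc q R, ∑ d' ∈ coprimeIoc q R, if e ∣ Nat.lcm d d' then
    (ArithmeticFunction.moebius d : ℝ) * ArithmeticFunction.moebius d' *
      (Real.log (R / d) * Real.log (R / d')) / (Nat.lcm d d' : ℝ) else 0

theorem lcmSum_one (q : ℕ) (R : ℝ) : lcmSum q R 1 = quadSum q R R := by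
  simp [lcmSum, quadSum]

theorem lcm_mul_mul_of_coprime {e g g' c c' : ℕ} (hg : g ∣ e) (hg' : g' ∣ e) (hc : c.Coprime e)
    (hc' : c'.Coprime e) : (g * c).lcm (g' * c') = g.lcm g' * c.lcm c' := by
  have h1 : g.Coprime c := (hc.coprime_dvd_right hg).symm
  have h2 : g'.Coprime c' := (hc'.coprime_dvd_right hg').symm
  have h3 : (g.lcm g').Coprime (c.lcm c') := by
    refine (Nat.Coprime.coprime_dvd_left (Nat.lcm_dvd hg hg') ?_)
    exact (Nat.Coprime.coprime_dvd_left (Nat.lcm_dvd_mul c c') (Nat.Coprime.mul_left hc hc')).symm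
  rw [← h1.lcm_eq_mul, ← h2.lcm_eq_mul, ← h3.lcm_eq_mul, Nat.lcm_assoc, Nat.lcm_assoc]
  congr 1
  rw [← Nat.lcm_assoc, ← Nat.lcm_assoc, Nat.lcm_comm c g']

theorem lcmSum_eq {q e : ℕ} (he : Squarefree e) (heq : e.Coprime q) (R : ℝ) :
    lcmSum q R e = ∑ g ∈ e.divisors, ∑ g' ∈ e.divisors, if Nat.lcm g g' = e then
      (ArithmeticFunction.moebius g : ℝ) * ArithmeticFunction.moebius g' / e *
        quadSum (e * q) (R / g) (R / g') else 0 := by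
  have h1 : lcmSum q R e = ∑ d ∈ coprimeIoc q R, (ArithmeticFunction.moebius d : ℝ) *
      ∑ d' ∈ coprimeIoc q R, (ArithmeticFunction.moebius d' : ℝ) * if e ∣ Nat.lcm d d' then
        (Real.log (R / d) * Real.log (R / d')) / (Nat.lcm d d' : ℝ) else 0 := by
    refine Finset.sum_congr rfl fun d _ => ?_
    rw [Finset.mul_sum]
    refine Finset.sum_congr rfl fun d' _ => ?_
    split_ifs <;> ring
  rw [h1, sum_moebius_eq_sum_divisors he heq]
  refine Finset.sum_congr rfl fun g hg => ?_
  simp_rw [sum_moebius_eq_sum_divisors he heq R]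
  simp_rw [Finset.mul_sum]
  rw [Finset.sum_comm]
  refine Finset.sum_congr rfl fun g' hg' => ?_
  have hge := Nat.dvd_of_mem_divisors hg
  have hge' := Nat.dvd_of_mem_divisors hg'
  have he0 : (e : ℝ) ≠ 0 := by exact_mod_cast he.ne_zero
  by_cases hl : Nat.lcm g g' = e
  · rw [if_pos hl, quadSum, Finset.mul_sum]
    refine Finset.sum_congr rfl fun c hc => ?_
    rw [Finset.mul_sum]
    refine Finset.sum_congr rfl fun c' hc' => ?_
    have hce := (mem_coprimeIoc.1 hc).2.coprime_mul_right_right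
    have hce' := (mem_coprimeIoc.1 hc').2.coprime_mul_right_right
    rw [lcm_mul_mul_of_coprime hge hge' hce hce', hl, if_pos (Nat.dvd_mul_right _ _), div_div R,
      div_div R]
    push_cast
    have : ((c.lcm c' : ℕ) : ℝ) ≠ 0 := by
      exact_mod_cast (Nat.lcm_pos (mem_coprimeIoc.1 hc).1.1 (mem_coprimeIoc.1 hc').1.1).ne'
    field_simp
  · rw [if_neg hl]
    refine Finset.sum_eq_zero fun c hc => Finset.sum_eq_zero fun c' hc' => ?_
    have hce := (mem_coprimeIoc.1 hc).2.coprime_mul_right_right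
    have hce' := (mem_coprimeIoc.1 hc').2.coprime_mul_right_right
    rw [lcm_mul_mul_of_coprime hge hge' hce hce', if_neg]
    · simp
    · intro h
      apply hl
      have h3 : e.Coprime (c.lcm c') :=
        (Nat.Coprime.coprime_dvd_left (Nat.lcm_dvd_mul c c') (Nat.Coprime.mul_left hce hce')).symm
      exact Nat.dvd_antisymm (Nat.lcm_dvd hge hge') (h3.dvd_of_dvd_mul_right h)

theorem card_divisors_mul_totRatio_le {e : ℕ} (he : Squarefree e) :
    (e.divisors.card : ℝ) * totRatio e ≤ 4 ^ e.primeFactors.card := by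
  induction e, he using squarefree_induction with
  | h1 => simp [totRatio_one]
  | hmul p q hp hq hpq hsq ih =>
    rw [hpq.card_divisors_mul, totRatio_mul hpq, hpq.primeFactors_mul,
      Finset.card_union_of_disjoint hpq.disjoint_primeFactors, pow_add, hp.primeFactors,
      Finset.card_singleton, hp.divisors, Finset.card_pair hp.one_lt.ne]
    have := totRatio_prime_le_two hp
    have h2 := one_le_totRatio hp.ne_zero
    have h3 := one_le_totRatio hq.ne_zero
    push_cast
    calc (2 * (q.divisors.card : ℝ)) * (totRatio p * totRatio q)
        = (2 * totRatio p) * (q.divisors.card * totRatio q) := by ring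
      _ ≤ 4 ^ 1 * 4 ^ q.primeFactors.card := by
        refine mul_le_mul (by linarith) ih (by positivity) (by norm_num)

theorem abs_lcmSum_le {C : ℝ} (hC : 0 ≤ C)
    (h : ∀ q : ℕ, Squarefree q → ∀ x, 0 < x → |muLogSum q x| ≤ C * totRatio q)
    {q e : ℕ} (hq : Squarefree q) (he : Squarefree e) (heq : e.Coprime q) {R : ℝ} (hR : 0 < R) :
    |lcmSum q R e| ≤ C ^ 2 * totRatio q ^ 2 * totientSum q R * (16 ^ e.primeFactors.card / e) := by
  have he0 : (0 : ℝ) < e := by exact_mod_cast Nat.pos_of_ne_zero he.ne_zero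
  have hsum0 : ∀ q : ℕ, 0 ≤ totientSum q R := fun q => Finset.sum_nonneg fun r _ => by positivity
  have hmono : totientSum (e * q) R ≤ totientSum q R := by
    refine Finset.sum_le_sum_of_subset_of_nonneg (fun r hr => ?_) (fun _ _ _ => by positivity)
    obtain ⟨h1, h2⟩ := mem_coprimeIoc.1 hr
    exact mem_coprimeIoc.2 ⟨h1, h2.coprime_mul_left_right⟩
  have heq' : Squarefree (e * q) := (Nat.squarefree_mul heq).2 ⟨he, hq⟩
  set K := C ^ 2 * totRatio (e * q) ^ 2 * totientSum q R with hK
  have hterm : ∀ g ∈ e.divisors, ∀ g' ∈ e.divisors, |if Nat.lcm g g' = e then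
      (ArithmeticFunction.moebius g : ℝ) * ArithmeticFunction.moebius g' / e *
        quadSum (e * q) (R / g) (R / g') else 0| ≤ K / e := by
    intro g hg g' hg'
    have hK0 : 0 ≤ K := by have := hsum0 q; positivity
    split_ifs
    · have hg0 : (1 : ℝ) ≤ g := by
        exact_mod_cast Nat.pos_of_mem_divisors hg
      have hg0' : (1 : ℝ) ≤ g' := by
        exact_mod_cast Nat.pos_of_mem_divisors hg'
      have b := abs_quadSum_le hC h heq' (X := R / g) (Y := R / g') (R := R) (by positivity)
        (by positivity) (div_le_self hR.le hg0)
      have b' : |quadSum (e * q) (R / g) (R / g')| ≤ K := by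
        refine b.trans ?_
        rw [hK]; gcongr
      rw [abs_mul, abs_div, abs_mul, abs_of_pos he0]
      calc _ ≤ 1 * 1 / (e : ℝ) * K := by
            gcongr
            · exact abs_moebius_real_le_one g
            · exact abs_moebius_real_le_one g'
        _ = K / e := by ring
    · rw [abs_zero]; positivity
  rw [lcmSum_eq he heq]
  calc _ ≤ ∑ g ∈ e.divisors, ∑ g' ∈ e.divisors, K / e := by
        refine (Finset.abs_sum_le_sum_abs _ _).trans (Finset.sum_le_sum fun g hg => ?_)
        exact (Finset.abs_sum_le_sum_abs _ _).trans (Finset.sum_le_sum fun g' hg' => hterm g hg g' hg')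
    _ = C ^ 2 * totRatio q ^ 2 * totientSum q R * ((e.divisors.card * totRatio e) ^ 2 / e) := by
        rw [Finset.sum_const, Finset.sum_const, hK, totRatio_mul heq]
        simp only [nsmul_eq_mul]
        ring
    _ ≤ C ^ 2 * totRatio q ^ 2 * totientSum q R * ((4 ^ e.primeFactors.card) ^ 2 / e) := by
        have h1 := card_divisors_mul_totRatio_le he
        have h2 := one_le_totRatio he.ne_zero
        have := hsum0 q
        gcongr
    _ = _ := by
        rw [← pow_mul, mul_comm _ 2, pow_mul]; norm_num

/-- `∑_{n ≤ X, (n, W) = 1} 1 / n`. -/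
def coprimeHarmonic (W : ℕ) (X : ℝ) : ℝ := ∑ n ∈ coprimeIoc W X, (1 : ℝ) / n

theorem coprimeIoc_natCast (q n : ℕ) :
    coprimeIoc q (n : ℝ) = (Finset.Ioc 0 n).filter (fun c => Nat.Coprime c q) := by
  rw [coprimeIoc, Nat.floor_natCast]

theorem card_block (W j : ℕ) :
    ((Finset.Ioc (j * W) ((j + 1) * W)).filter (fun c => Nat.Coprime c W)).card =
      Nat.totient W := by
  rw [← Nat.filter_coprime_Ico_eq_totient W (j * W + 1)]
  congr 1
  ext c
  simp only [Finset.mem_filter, Finset.mem_Ioc, Finset.mem_Ico, Nat.coprime_comm (m := c)]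
  have : (j + 1) * W = j * W + W := by ring
  omega

theorem coprimeHarmonic_succ_mul (W K : ℕ) :
    coprimeHarmonic W ((K + 1) * W : ℕ) = coprimeHarmonic W (K * W : ℕ) +
      ∑ n ∈ (Finset.Ioc (K * W) ((K + 1) * W)).filter (fun c => Nat.Coprime c W), (1 : ℝ) / n := by
  rw [coprimeHarmonic, coprimeHarmonic, coprimeIoc_natCast, coprimeIoc_natCast,
    ← Finset.sum_union]
  · rw [← Finset.filter_union, Finset.Ioc_union_Ioc_eq_Ioc (Nat.zero_le _)
      (Nat.mul_le_mul_right W (Nat.le_succ K))]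
  · refine Finset.disjoint_filter_filter (Finset.disjoint_left.2 fun a ha hb => ?_)
    simp only [Finset.mem_Ioc] at ha hb
    omega

theorem coprimeHarmonic_mono {W : ℕ} {X Y : ℝ} (h : X ≤ Y) :
    coprimeHarmonic W X ≤ coprimeHarmonic W Y :=
  Finset.sum_le_sum_of_subset_of_nonneg (coprimeIoc_mono h) fun _ _ _ => by positivity

theorem le_coprimeHarmonic_mul {W : ℕ} (hW : 0 < W) (K : ℕ) :
    (Nat.totient W : ℝ) / W * (harmonic K : ℝ) ≤ coprimeHarmonic W (K * W : ℕ) := by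
  induction K with
  | zero => simp [coprimeHarmonic, coprimeIoc]
  | succ K ih =>
    rw [coprimeHarmonic_succ_mul, harmonic_succ]
    push_cast at ih ⊢
    rw [mul_add]
    refine add_le_add ih ?_
    have hb : ∀ n ∈ (Finset.Ioc (K * W) ((K + 1) * W)).filter (fun c => Nat.Coprime c W),
        (1 : ℝ) / ((K + 1) * W) ≤ 1 / n := by
      intro n hn
      have hn := Finset.mem_Ioc.1 (Finset.mem_filter.1 hn).1
      have h1 : (0 : ℝ) < n := by exact_mod_cast lt_of_le_of_lt (Nat.zero_le _) hn.1
      refine one_div_le_one_div_of_le h1 ?_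
      exact_mod_cast hn.2
    refine le_trans (le_of_eq ?_) (Finset.card_nsmul_le_sum _ _ _ hb)
    rw [card_block, nsmul_eq_mul]
    have : (W : ℝ) ≠ 0 := by exact_mod_cast hW.ne'
    have : (K : ℝ) + 1 ≠ 0 := by positivity
    field_simp

theorem coprimeHarmonic_mul_le {W : ℕ} (hW : 0 < W) (K : ℕ) :
    coprimeHarmonic W ((K + 1) * W : ℕ) ≤
      1 + Real.log W + (Nat.totient W : ℝ) / W * (harmonic K : ℝ) := by
  induction K with
  | zero =>
    have h1 := harmonic_le_one_add_log W
    rw [zero_add, one_mul, harmonic_zero, Rat.cast_zero, mul_zero, add_zero]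
    refine le_trans ?_ h1
    rw [harmonic_eq_sum_Icc, coprimeHarmonic, coprimeIoc_natCast]
    push_cast
    simp_rw [one_div]
    have : Finset.Ioc 0 W = Finset.Icc 1 W := rfl
    rw [← this]
    exact Finset.sum_le_sum_of_subset_of_nonneg (Finset.filter_subset _ _)
      fun _ _ _ => by positivity
  | succ K ih =>
    rw [coprimeHarmonic_succ_mul, harmonic_succ]
    push_cast at ih ⊢
    rw [mul_add, ← add_assoc]
    refine add_le_add ih ?_
    have hb : ∀ n ∈ (Finset.Ioc ((K + 1) * W) ((K + 1 + 1) * W)).filter (fun c => Nat.Coprime c W),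
        1 / (n : ℝ) ≤ (1 : ℝ) / ((K + 1) * W) := by
      intro n hn
      have hn := Finset.mem_Ioc.1 (Finset.mem_filter.1 hn).1
      have hW' : (0 : ℝ) < W := by exact_mod_cast hW
      refine one_div_le_one_div_of_le (by positivity) ?_
      exact_mod_cast hn.1.le
    refine le_trans (Finset.sum_le_card_nsmul _ _ _ hb) (le_of_eq ?_)
    rw [card_block, nsmul_eq_mul]
    have : (W : ℝ) ≠ 0 := by exact_mod_cast hW.ne'
    have : (K : ℝ) + 1 ≠ 0 := by positivity
    field_simp

theorem le_coprimeHarmonic {W : ℕ} (hW : 0 < W) {X : ℝ} (hX : 0 < X) :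
    (Nat.totient W : ℝ) / W * (Real.log X - Real.log W) ≤ coprimeHarmonic W X := by
  have hW' : (0 : ℝ) < W := by exact_mod_cast hW
  set K := ⌊X / W⌋₊
  have h1 : (K : ℝ) * W ≤ X := by
    rw [← le_div_iff₀ hW']; exact Nat.floor_le (by positivity)
  have h2 : X / W ≤ K + 1 := (Nat.lt_floor_add_one _).le
  have h3 := le_coprimeHarmonic_mul hW K
  have h4 := log_add_one_le_harmonic K
  have h5 : coprimeHarmonic W (K * W : ℕ) ≤ coprimeHarmonic W X :=
    coprimeHarmonic_mono (by exact_mod_cast h1)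
  refine le_trans ?_ (h3.trans h5)
  rw [← Real.log_div hX.ne' hW'.ne']
  gcongr
  refine le_trans ?_ h4
  push_cast
  exact Real.log_le_log (by positivity) h2

theorem coprimeHarmonic_le {W : ℕ} (hW : 0 < W) {X : ℝ} (hX : 1 ≤ X) :
    coprimeHarmonic W X ≤
      (Nat.totient W : ℝ) / W * (1 + Real.log X) + (1 + Real.log W) := by
  have hW' : (1 : ℝ) ≤ W := by exact_mod_cast hW
  set K := ⌊X / W⌋₊
  have h1 : X ≤ ((K + 1) * W : ℕ) := by
    have h2 : X / W ≤ K + 1 := (Nat.lt_floor_add_one _).le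
    rw [div_le_iff₀ (by linarith)] at h2
    push_cast; exact h2
  have h3 := coprimeHarmonic_mul_le hW K
  have h4 : (harmonic K : ℝ) ≤ 1 + Real.log X := by
    rcases Nat.eq_zero_or_pos K with h | h
    · rw [h]; simp; linarith [Real.log_nonneg hX]
    · refine (harmonic_le_one_add_log K).trans ?_
      have : (K : ℝ) ≤ X := (Nat.floor_le (by positivity)).trans (div_le_self (by linarith) hW')
      have := Real.log_le_log (by exact_mod_cast h) this
      linarith
  have h5 := mul_le_mul_of_nonneg_left h4 (by positivity : (0 : ℝ) ≤ (Nat.totient W : ℝ) / W)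
  linarith [coprimeHarmonic_mono (W := W) h1]

/-- `W` is divisible by all primes up to `w`. -/
def PrimesDvd (w W : ℕ) : Prop := ∀ p : ℕ, p.Prime → p ≤ w → p ∣ W

theorem PrimesDvd.lt_of_coprime {w W n : ℕ} (h : PrimesDvd w W) (hn : n.Coprime W) (hn1 : 1 < n) :
    w < n := by
  by_contra hcon
  have hp := Nat.minFac_prime hn1.ne'
  have h1 := h _ hp ((Nat.minFac_le (by omega)).trans (not_lt.1 hcon))
  have := Nat.Coprime.eq_one_of_dvd (hn.coprime_dvd_left (Nat.minFac_dvd n)) h1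
  exact hp.one_lt.ne' this

theorem sum_Ioc_one_div_sq_le {w : ℕ} (hw : 0 < w) (n : ℕ) :
    ∑ b ∈ Finset.Ioc w n, 1 / (b : ℝ) ^ 2 ≤ 1 / (w : ℝ) := by
  rcases le_total w n with h | h
  · have := sum_Ioc_inv_sq_le_sub (α := ℝ) hw.ne' h
    simp_rw [one_div]
    have h2 : (0 : ℝ) ≤ (n : ℝ)⁻¹ := by positivity
    linarith
  · rw [Finset.Ioc_eq_empty (by omega)]; simp

theorem sum_coprimeIoc_one_div_sq_le {w W : ℕ} (hw : 0 < w) (h : PrimesDvd w W) (X : ℝ) :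
    ∑ b ∈ coprimeIoc W X, 1 / (b : ℝ) ^ 2 ≤ 1 + 1 / (w : ℝ) := by
  have hsub : coprimeIoc W X ⊆ insert 1 (Finset.Ioc w ⌊X⌋₊) := by
    intro b hb
    obtain ⟨h1, h3⟩ := Finset.mem_filter.1 hb
    rw [Finset.mem_Ioc] at h1
    rcases eq_or_ne b 1 with rfl | hb1
    · simp
    · exact Finset.mem_insert_of_mem (Finset.mem_Ioc.2 ⟨h.lt_of_coprime h3 (by omega), h1.2⟩)
  refine (Finset.sum_le_sum_of_subset_of_nonneg hsub fun _ _ _ => by positivity).trans ?_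
  rw [Finset.sum_insert (by simp; omega)]
  have := sum_Ioc_one_div_sq_le hw ⌊X⌋₊
  simpa using this

theorem sum_le_sum_of_injOn' {α β : Type*} (s : Finset α) (t : Finset β) (i : α → β)
    (hi : ∀ a ∈ s, i a ∈ t) (hinj : Set.InjOn i s) (F : β → ℝ) (hF : ∀ b ∈ t, 0 ≤ F b) :
    ∑ a ∈ s, F (i a) ≤ ∑ b ∈ t, F b := by
  rw [← Finset.sum_image hinj]
  exact Finset.sum_le_sum_of_subset_of_nonneg (Finset.image_subset_iff.2 hi) fun b hb _ => hF b hb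

theorem coprimeHarmonic_le_totientSum {w W : ℕ} (hw : 0 < w) (h : PrimesDvd w W) (X : ℝ) :
    coprimeHarmonic W X ≤ (1 + 1 / (w : ℝ)) * totientSum W X := by
  choose a b hab hsq using Nat.sq_mul_squarefree
  have key := sum_le_sum_of_injOn' (coprimeIoc W X) (coprimeIoc W X ×ˢ coprimeIoc W X)
    (fun n => (b n, a n)) (fun n hn => ?_) (fun n hn m hm hnm => ?_)
    (fun x => (1 / (x.1 : ℝ) ^ 2) * ((ArithmeticFunction.moebius x.2 : ℝ) ^ 2 / Nat.totient x.2))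
    (fun _ _ => by positivity)
  · rw [Finset.sum_product] at key
    simp only at key
    simp_rw [← Finset.mul_sum] at key
    rw [← Finset.sum_mul] at key
    refine le_trans (Finset.sum_le_sum fun n hn => ?_) (key.trans ?_)
    · have hn0 := (mem_coprimeIoc.1 hn).1.1
      have ha0 : 0 < a n := Nat.pos_of_ne_zero (hsq n).ne_zero
      have hb0 : 0 < b n := by
        rcases Nat.eq_zero_or_pos (b n) with h0 | h0
        · have := hab n; rw [h0] at this; simp at this; omega
        · exact h0
      have hφ : 0 < Nat.totient (a n) := Nat.totient_pos.2 ha0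
      rw [← Int.cast_pow, ArithmeticFunction.moebius_sq_eq_one_of_squarefree (hsq n), Int.cast_one]
      have h2 : ((b n : ℕ) : ℝ) ^ 2 * (a n : ℝ) = n := by exact_mod_cast hab n
      rw [div_mul_div_comm, one_mul]
      have hb0' : (0 : ℝ) < b n := by exact_mod_cast hb0
      have hφ' : (0 : ℝ) < Nat.totient (a n) := by exact_mod_cast hφ
      refine one_div_le_one_div_of_le (by positivity) ?_
      rw [← h2]
      gcongr
      exact_mod_cast Nat.totient_le _
    · have := sum_coprimeIoc_one_div_sq_le hw h X
      have h0 : 0 ≤ totientSum W X := Finset.sum_nonneg fun _ _ => by positivity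
      exact mul_le_mul_of_nonneg_right this h0
  · obtain ⟨⟨h1, h2⟩, h3⟩ := mem_coprimeIoc.1 hn
    have hda : a n ∣ n := by
      conv_rhs => rw [← hab n]
      exact Nat.dvd_mul_left _ _
    have hdb : b n ∣ n := by
      conv_rhs => rw [← hab n]
      exact (Dvd.intro_left _ (by rw [sq])).mul_right _
    have hmem : ∀ d, d ∣ n → d ∈ coprimeIoc W X := fun d hd =>
      mem_coprimeIoc.2 ⟨⟨Nat.pos_of_dvd_of_pos hd h1,
        (Nat.cast_le.2 (Nat.le_of_dvd h1 hd)).trans h2⟩, h3.coprime_dvd_left hd⟩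
    exact Finset.mem_product.2 ⟨hmem _ hdb, hmem _ hda⟩
  · simp only [Prod.mk.injEq] at hnm
    rw [← hab n, ← hab m, hnm.1, hnm.2]

theorem totRatio_eq_prod {r : ℕ} (hr : Squarefree r) :
    totRatio r = ∏ p ∈ r.primeFactors, (1 + 1 / ((p : ℝ) - 1)) := by
  induction r, hr using squarefree_induction with
  | h1 => simp [totRatio_one]
  | hmul p q hp hq hpq hsq ih =>
    rw [totRatio_mul hpq, hpq.primeFactors_mul, Finset.prod_union hpq.disjoint_primeFactors, ih,
      hp.primeFactors, Finset.prod_singleton]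
    congr 1
    have h1 : (1 : ℝ) < p := by exact_mod_cast hp.one_lt
    have h2 : (p : ℝ) - 1 ≠ 0 := by linarith
    rw [totRatio, Nat.totient_prime hp, Nat.cast_sub hp.one_lt.le]
    push_cast
    field_simp
    ring

theorem prod_one_add_le_exp {w : ℕ} (hw : 0 < w) (n : ℕ) (s : Finset ℕ) (hs : s ⊆ Finset.Ioc w n)
    (K : ℝ) (hK : 0 ≤ K) : ∏ p ∈ s, (1 + K / (p : ℝ) ^ 2) ≤ Real.exp (K / w) := by
  calc _ ≤ ∏ p ∈ s, Real.exp (K / (p : ℝ) ^ 2) := by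
        refine Finset.prod_le_prod (fun _ _ => by positivity) fun p _ => ?_
        rw [add_comm]; exact Real.add_one_le_exp _
    _ = Real.exp (∑ p ∈ s, K * (1 / (p : ℝ) ^ 2)) := by
        rw [Real.exp_sum]; simp_rw [mul_one_div]
    _ ≤ Real.exp (K / w) := by
        rw [Real.exp_le_exp, ← Finset.mul_sum, ← mul_one_div]
        refine mul_le_mul_of_nonneg_left ?_ hK
        exact (Finset.sum_le_sum_of_subset_of_nonneg hs fun _ _ _ => by positivity).trans
          (sum_Ioc_one_div_sq_le hw n)

theorem totientSum_le_coprimeHarmonic {w W : ℕ} (hw : 0 < w) (h : PrimesDvd w W) (X : ℝ) :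
    totientSum W X ≤ Real.exp (2 / w) * coprimeHarmonic W X := by
  set P := (Finset.Ioc w ⌊X⌋₊).filter Nat.Prime with hP
  set A := (coprimeIoc W X).filter Squarefree with hA
  have h1 : totientSum W X = ∑ x ∈ A.sigma (fun r => r.primeFactors.powerset),
      (1 / (x.1 : ℝ)) * ∏ p ∈ x.2, 1 / ((p : ℝ) - 1) := by
    rw [Finset.sum_sigma, totientSum, hA, Finset.sum_filter]
    refine Finset.sum_congr rfl fun r hr => ?_
    have hr0 : (r : ℝ) ≠ 0 := by exact_mod_cast (mem_coprimeIoc.1 hr).1.1.ne'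
    split_ifs with hsq
    · simp only
      rw [← Finset.mul_sum, ← Finset.prod_one_add, ← totRatio_eq_prod hsq, ← Int.cast_pow,
        ArithmeticFunction.moebius_sq_eq_one_of_squarefree hsq, totRatio]
      have : (Nat.totient r : ℝ) ≠ 0 := by
        exact_mod_cast (Nat.totient_pos.2 (mem_coprimeIoc.1 hr).1.1).ne'
      push_cast
      field_simp
    · rw [ArithmeticFunction.moebius_eq_zero_of_not_squarefree hsq]; simp
  have hx : ∀ x ∈ A.sigma (fun r => r.primeFactors.powerset), ((0 < x.1 ∧ (x.1 : ℝ) ≤ X) ∧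
      x.1.Coprime W) ∧ Squarefree x.1 ∧ x.2 ⊆ x.1.primeFactors ∧ ∏ p ∈ x.2, p ∣ x.1 := by
    intro x hx
    rw [Finset.mem_sigma, hA, Finset.mem_filter, mem_coprimeIoc, Finset.mem_powerset] at hx
    refine ⟨hx.1.1, hx.1.2, hx.2, ?_⟩
    exact (Finset.prod_dvd_prod_of_subset _ _ _ hx.2).trans (Nat.prod_primeFactors_dvd _)
  have hsub1 : ∀ p ∈ P, (1 : ℝ) < p ∧ 0 < (p : ℝ) - 1 := by
    intro p hp
    have : (1 : ℝ) < p := by exact_mod_cast (Finset.mem_filter.1 hp).2.one_lt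
    exact ⟨this, by linarith⟩
  have hx2 : ∀ x ∈ A.sigma (fun r => r.primeFactors.powerset), x.2 ⊆ P := by
    intro x hx' p hp
    obtain ⟨⟨⟨g1, g2⟩, g3⟩, g4, g5, g6⟩ := hx x hx'
    have hp' := Nat.mem_primeFactors.1 (g5 hp)
    refine Finset.mem_filter.2 ⟨Finset.mem_Ioc.2 ⟨?_, ?_⟩, hp'.1⟩
    · exact h.lt_of_coprime (g3.coprime_dvd_left hp'.2.1) hp'.1.one_lt
    · exact (Nat.le_of_dvd g1 hp'.2.1).trans (Nat.le_floor g2)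
  have key := sum_le_sum_of_injOn' (A.sigma (fun r => r.primeFactors.powerset))
    (coprimeIoc W X ×ˢ P.powerset) (fun x => (x.1 / ∏ p ∈ x.2, p, x.2))
    (fun x hx' => ?_) (fun x hx' y hy' hxy => ?_)
    (fun x => (1 / (x.1 : ℝ)) * ∏ p ∈ x.2, 1 / ((p : ℝ) * ((p : ℝ) - 1))) (fun x hx' => ?_)
  · rw [Finset.sum_product] at key
    simp only at key
    simp_rw [← Finset.mul_sum] at key
    rw [← Finset.sum_mul, ← Finset.prod_one_add] at key
    rw [h1, mul_comm]
    refine le_trans (le_of_eq (Finset.sum_congr rfl fun x hx' => ?_)) (key.trans ?_)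
    · obtain ⟨⟨⟨g1, g2⟩, g3⟩, g4, g5, g6⟩ := hx x hx'
      have hne : ((∏ p ∈ x.2, p : ℕ) : ℝ) ≠ 0 := by
        exact_mod_cast (Nat.pos_of_dvd_of_pos g6 g1).ne'
      rw [Nat.cast_div g6 hne]
      have e1 : ∏ p ∈ x.2, 1 / ((p : ℝ) * ((p : ℝ) - 1)) =
          (1 / ((∏ p ∈ x.2, p : ℕ) : ℝ)) * ∏ p ∈ x.2, 1 / ((p : ℝ) - 1) := by
        rw [Nat.cast_prod, one_div, ← Finset.prod_inv_distrib, ← Finset.prod_mul_distrib]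
        refine Finset.prod_congr rfl fun p _ => ?_
        rw [one_div, one_div, mul_inv]
      rw [e1, ← mul_assoc]
      congr 1
      have : (x.1 : ℝ) ≠ 0 := by exact_mod_cast g1.ne'
      field_simp
    · refine mul_le_mul_of_nonneg_left ?_ (Finset.sum_nonneg fun _ _ => by positivity)
      refine le_trans (Finset.prod_le_prod (fun p hp => ?_) fun p hp => ?_)
        (prod_one_add_le_exp hw ⌊X⌋₊ P (Finset.filter_subset _ _) 2 (by norm_num))
      · obtain ⟨h1, h2⟩ := hsub1 p hp
        positivity
      · obtain ⟨h1, h2⟩ := hsub1 p hp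
        have h3 : (2 : ℝ) ≤ p := by exact_mod_cast (Finset.mem_filter.1 hp).2.two_le
        have : 1 / ((p : ℝ) * ((p : ℝ) - 1)) ≤ 2 / (p : ℝ) ^ 2 := by
          rw [div_le_div_iff₀ (by positivity) (by positivity)]
          nlinarith
        linarith
  · obtain ⟨⟨⟨g1, g2⟩, g3⟩, g4, g5, g6⟩ := hx x hx'
    have hd : x.1 / ∏ p ∈ x.2, p ∣ x.1 := Nat.div_dvd_of_dvd g6
    refine Finset.mem_product.2 ⟨mem_coprimeIoc.2 ⟨⟨Nat.pos_of_dvd_of_pos hd g1, ?_⟩,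
      g3.coprime_dvd_left hd⟩, Finset.mem_powerset.2 (hx2 x hx')⟩
    exact (Nat.cast_le.2 (Nat.le_of_dvd g1 hd)).trans g2
  · obtain ⟨⟨⟨g1, g2⟩, g3⟩, g4, g5, g6⟩ := hx x hx'
    obtain ⟨⟨⟨k1, k2⟩, k3⟩, k4, k5, k6⟩ := hx y hy'
    obtain ⟨x1, x2⟩ := x
    obtain ⟨y1, y2⟩ := y
    simp only [Prod.mk.injEq] at hxy
    obtain ⟨h2, rfl⟩ := hxy
    simp only at g6 k6
    have : x1 = y1 := by
      rw [← Nat.div_mul_cancel g6, h2, Nat.div_mul_cancel k6]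
    rw [this]
  · obtain ⟨h1, h2⟩ := Finset.mem_product.1 hx'
    refine mul_nonneg (by positivity) (Finset.prod_nonneg fun p hp => ?_)
    obtain ⟨h1, h2⟩ := hsub1 p (Finset.mem_powerset.1 h2 hp)
    positivity

theorem exists_abs_muLogSum_one_le :
    ∃ C : ℝ, 0 ≤ C ∧ ∀ x : ℝ, 0 < x → |muLogSum 1 x| ≤ C := by
  obtain ⟨A, hA, h⟩ := exists_abs_muLogSum_one_sub_one_le 1 one_pos
  refine ⟨2 + A, by linarith, fun x hx => ?_⟩
  rcases le_total x 1 with h1 | h1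
  · rw [muLogSum_eq_zero_of_le_one _ h1, abs_zero]; linarith
  · have h2 := h x hx
    have h3 : x ^ (-(1 / 2) : ℝ) ≤ 1 := Real.rpow_le_one_of_one_le_of_nonpos h1 (by norm_num)
    have h4 : A * x ^ (-(1 / 2) : ℝ) ≤ A := mul_le_of_le_one_right (by linarith) h3
    have h5 := abs_sub_abs_le_abs_sub (muLogSum 1 x) 1
    rw [abs_one] at h5
    linarith

theorem totRatio_pos {q : ℕ} (hq : q ≠ 0) : 0 < totRatio q :=
  one_pos.trans_le (one_le_totRatio hq)

theorem totRatio_le_self (q : ℕ) (hq : q ≠ 0) : totRatio q ≤ q := by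
  have : (1 : ℝ) ≤ Nat.totient q := by exact_mod_cast Nat.totient_pos.2 (Nat.pos_of_ne_zero hq)
  exact div_le_self (by positivity) this

theorem totientSum_bounds {w W : ℕ} (hw : 0 < w) (h : PrimesDvd w W) (hW : 0 < W) {X E : ℝ}
    (hX : 1 ≤ X) (hE : (W : ℝ) * (1 + Real.log W) ≤ E) :
    Real.log X - E ≤ (1 + 1 / (w : ℝ)) * (totRatio W * totientSum W X) ∧
      totRatio W * totientSum W X ≤ Real.exp (2 / w) * (Real.log X + 2 * E) := by
  have hQ := totRatio_pos hW.ne'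
  have hQW := totRatio_le_self W hW.ne'
  have hW1 : (1 : ℝ) ≤ W := by exact_mod_cast hW
  have hl : 0 ≤ Real.log W := Real.log_nonneg hW1
  have hinv : totRatio W * ((Nat.totient W : ℝ) / W) = 1 := by
    have : (Nat.totient W : ℝ) ≠ 0 := by exact_mod_cast (Nat.totient_pos.2 hW).ne'
    rw [totRatio]; field_simp
  have h1 := mul_le_mul_of_nonneg_left (le_coprimeHarmonic hW (by linarith : 0 < X)) hQ.le
  have h2 := mul_le_mul_of_nonneg_left (coprimeHarmonic_le hW hX) hQ.le
  have h3 := mul_le_mul_of_nonneg_left (coprimeHarmonic_le_totientSum hw h X) hQ.le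
  have h4 := mul_le_mul_of_nonneg_left (totientSum_le_coprimeHarmonic hw h X) hQ.le
  rw [← mul_assoc, hinv, one_mul] at h1
  rw [mul_add, ← mul_assoc, hinv, one_mul] at h2
  have h5 : totRatio W * (1 + Real.log W) ≤ W * (1 + Real.log W) := by gcongr
  constructor
  · have : Real.log W ≤ W * (1 + Real.log W) := by nlinarith
    calc _ ≤ _ := h1.trans' (by linarith)
      _ ≤ _ := h3
      _ = _ := by ring
  · calc _ ≤ _ := h4
      _ = Real.exp (2 / w) * (totRatio W * coprimeHarmonic W X) := by ring
      _ ≤ _ := by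
        gcongr
        have : 1 ≤ (W : ℝ) * (1 + Real.log W) := by nlinarith
        linarith

theorem totientSum_nonneg (q : ℕ) (X : ℝ) : 0 ≤ totientSum q X :=
  Finset.sum_nonneg fun _ _ => by positivity

theorem abs_quadSum_sub_le {W : ℕ} (hW : Squarefree W) {C δ : ℝ} (hC : 0 ≤ C) (hδ : 0 ≤ δ)
    {R Y : ℝ} (hYR : Y ≤ R)
    (h1 : ∀ q, Squarefree q → ∀ x : ℝ, 0 < x → |muLogSum q x| ≤ C * totRatio q)
    (hR : 0 < R)
    (h2 : ∀ r, Squarefree (r * W) → (r : ℝ) ≤ Y →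
      |muLogSum (r * W) (R / r) - totRatio (r * W)| ≤ δ * totRatio (r * W)) :
    |quadSum W R R - totRatio W ^ 2 * totientSum W R| ≤
      totRatio W ^ 2 * (δ * (C + 1) * totientSum W R +
        (C ^ 2 + 1) * (totientSum W R - totientSum W Y)) := by
  have hW0 := hW.ne_zero
  have e1 : totRatio W ^ 2 * totientSum W R = ∑ r ∈ coprimeIoc W R,
      (ArithmeticFunction.moebius r : ℝ) ^ 2 * ((Nat.totient r : ℝ) / r ^ 2) *
        totRatio (r * W) ^ 2 := by
    rw [totientSum, Finset.mul_sum]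
    refine Finset.sum_congr rfl fun r hr => ?_
    obtain ⟨⟨g1, -⟩, g2⟩ := mem_coprimeIoc.1 hr
    rw [totRatio_mul g2, totRatio, totRatio]
    have : (Nat.totient r : ℝ) ≠ 0 := by exact_mod_cast (Nat.totient_pos.2 g1).ne'
    have : (r : ℝ) ≠ 0 := by exact_mod_cast g1.ne'
    field_simp
  have hsplit : ∑ r ∈ (coprimeIoc W R).filter (fun r : ℕ => ¬ (r : ℝ) ≤ Y),
      (ArithmeticFunction.moebius r : ℝ) ^ 2 / Nat.totient r =
      totientSum W R - totientSum W Y := by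
    have : (coprimeIoc W R).filter (fun r : ℕ => (r : ℝ) ≤ Y) = coprimeIoc W Y := by
      ext r
      simp only [Finset.mem_filter, mem_coprimeIoc]
      constructor
      · rintro ⟨⟨⟨a, b⟩, c⟩, d⟩; exact ⟨⟨a, d⟩, c⟩
      · rintro ⟨⟨a, b⟩, c⟩; exact ⟨⟨⟨a, b.trans hYR⟩, c⟩, b⟩
    rw [totientSum, totientSum, ← this, eq_sub_iff_add_eq, add_comm,
      Finset.sum_filter_add_sum_filter_not]
  rw [quadSum_eq W le_rfl, e1, ← Finset.sum_sub_distrib, ← hsplit, Finset.sum_filter, totientSum,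
    Finset.mul_sum, Finset.mul_sum, ← Finset.sum_add_distrib, Finset.mul_sum]
  refine (Finset.abs_sum_le_sum_abs _ _).trans (Finset.sum_le_sum fun r hr => ?_)
  obtain ⟨⟨g1, g3⟩, g2⟩ := mem_coprimeIoc.1 hr
  have hr0 : (0 : ℝ) < r := by exact_mod_cast g1
  by_cases hsq : Squarefree r
  swap
  · rw [ArithmeticFunction.moebius_eq_zero_of_not_squarefree hsq]
    simp
  have hrW : Squarefree (r * W) := (Nat.squarefree_mul g2).2 ⟨hsq, hW⟩
  have hμ : (ArithmeticFunction.moebius r : ℝ) ^ 2 = 1 := by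
    exact_mod_cast ArithmeticFunction.moebius_sq_eq_one_of_squarefree hsq
  set q := totRatio (r * W) with hq
  set H := muLogSum (r * W) (R / r)
  have hq0 : 0 < q := totRatio_pos hrW.ne_zero
  have hφ : (0 : ℝ) < Nat.totient r := by exact_mod_cast Nat.totient_pos.2 g1
  have hH : |H| ≤ C * q := h1 _ hrW _ (by positivity)
  have e2 : totRatio W ^ 2 * (1 / (Nat.totient r : ℝ)) = (Nat.totient r : ℝ) / r ^ 2 * q ^ 2 := by
    rw [hq, totRatio_mul g2, totRatio, totRatio]
    field_simp
  have key : |H * H - q ^ 2| ≤ q ^ 2 * (δ * (C + 1) + if ¬ (r : ℝ) ≤ Y then C ^ 2 + 1 else 0) := by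
    split_ifs with hrY
    · have h3 := h2 r hrW hrY
      rw [show H * H - q ^ 2 = (H - q) * (H + q) by ring, abs_mul, add_zero]
      have h4 : |H + q| ≤ (C + 1) * q := (abs_add_le _ _).trans (by rw [abs_of_pos hq0]; linarith)
      calc _ ≤ (δ * q) * ((C + 1) * q) := by gcongr
        _ = _ := by ring
    · have h3 : H * H ≤ (C * q) ^ 2 := by
        rw [← sq, ← sq_abs]; gcongr
      rw [abs_le]
      have : 0 ≤ q ^ 2 * (δ * (C + 1)) := by positivity
      have : 0 ≤ q ^ 2 * C ^ 2 := by positivity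
      constructor <;> nlinarith [mul_self_nonneg H]
  rw [hμ, one_mul, ← mul_sub, abs_mul, abs_of_nonneg (by positivity : (0 : ℝ) ≤ Nat.totient r / r ^ 2)]
  calc _ ≤ (Nat.totient r : ℝ) / r ^ 2 *
        (q ^ 2 * (δ * (C + 1) + if ¬ (r : ℝ) ≤ Y then C ^ 2 + 1 else 0)) := by gcongr
    _ = totRatio W ^ 2 * (1 / (Nat.totient r : ℝ)) *
        (δ * (C + 1) + if ¬ (r : ℝ) ≤ Y then C ^ 2 + 1 else 0) := by rw [e2]; ring
    _ = _ := by split_ifs <;> ring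

theorem abs_sub_le_of_totientSum_bounds {τ L Q gR gY a e C S : ℝ} (hτ0 : 0 < τ) (hτ4 : τ ≤ 1 / 4)
    (hL0 : 0 < L) (hQ : 0 < Q) (hgR0 : 0 ≤ gR) (hgY0 : 0 ≤ gY) (ha : a ≤ τ)
    (he : e ≤ 1 + τ) (hC : 0 ≤ C) (hg1 : L - τ * L ≤ (1 + a) * gR)
    (hg2 : gR ≤ e * (L + 2 * (τ * L))) (hy1 : (1 - τ) * L - τ * L ≤ (1 + a) * gY)
    (hmain : |S - Q * gR| ≤ Q * (2 * τ * (C + 1) * gR + (C ^ 2 + 1) * (gR - gY))) :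
    |S - Q * L| ≤ (4 + 4 * (C + 1) + 7 * (C ^ 2 + 1)) * τ * (Q * L) ∧ gR ≤ 2 * L := by
  have hτL := mul_pos hτ0 hL0
  have hτ2L : τ * (τ * L) ≤ 1 / 4 * (τ * L) := by gcongr
  have b1 : gR ≤ (1 + 4 * τ) * L := by
    have : e * (L + 2 * (τ * L)) ≤ (1 + τ) * (L + 2 * (τ * L)) := by gcongr
    linarith
  have low : ∀ g, 0 ≤ g → (1 - 2 * τ) * L ≤ (1 + a) * g → (1 - 3 * τ) * L ≤ g := by
    intro g hg h
    have h6 : (1 + a) * g ≤ (1 + τ) * g := by gcongr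
    by_contra hcon
    rw [not_le] at hcon
    have : (1 + τ) * g < (1 + τ) * ((1 - 3 * τ) * L) := by gcongr
    have : 0 ≤ τ * (τ * L) := by positivity
    linarith
  have b2 := low gR hgR0 (by linarith)
  have b3 := low gY hgY0 (by linarith)
  have i1 : gR ≤ 2 * L := by
    have : 4 * τ * L ≤ 4 * (1 / 4) * L := by gcongr
    linarith
  refine ⟨?_, i1⟩
  have h7 : |Q * gR - Q * L| ≤ Q * (4 * τ * L) := by
    rw [← mul_sub, abs_mul, abs_of_pos hQ]
    refine mul_le_mul_of_nonneg_left ?_ hQ.le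
    rw [abs_le]
    constructor <;> linarith
  have h8 : 2 * τ * (C + 1) * gR + (C ^ 2 + 1) * (gR - gY) ≤
      (4 * (C + 1) + 7 * (C ^ 2 + 1)) * τ * L := by
    have i2 : gR - gY ≤ 7 * τ * L := by linarith
    calc _ ≤ 2 * τ * (C + 1) * (2 * L) + (C ^ 2 + 1) * (7 * τ * L) := by gcongr
      _ = _ := by ring
  calc _ ≤ |S - Q * gR| + |Q * gR - Q * L| := abs_sub_le _ _ _
    _ ≤ Q * ((4 * (C + 1) + 7 * (C ^ 2 + 1)) * τ * L) + Q * (4 * τ * L) :=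
        add_le_add (hmain.trans (mul_le_mul_of_nonneg_left h8 hQ.le)) h7
    _ = _ := by ring

set_option maxHeartbeats 400000 in
theorem exists_quadSum_asymp (δ : ℝ) (hδ : 0 < δ) :
    ∃ w₀ : ℕ, 0 < w₀ ∧ ∃ η : ℝ, 0 < η ∧ ∀ (W w : ℕ) (R : ℝ), Squarefree W → PrimesDvd w W →
      w₀ ≤ w → 1 < R → (W : ℝ) * (1 + Real.log W) ≤ η * Real.log R →
      |quadSum W R R - totRatio W * Real.log R| ≤ δ * (totRatio W * Real.log R) ∧
        totRatio W * totientSum W R ≤ 2 * Real.log R := by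
  obtain ⟨C, hC, hC1⟩ := exists_abs_muLogSum_one_le
  have hCq : ∀ q, Squarefree q → ∀ x : ℝ, 0 < x → |muLogSum q x| ≤ C * totRatio q :=
    fun q hq => abs_muLogSum_le_of_one hC hC1 hq
  set D := 4 + 4 * (C + 1) + 7 * (C ^ 2 + 1) with hD
  have hDpos : 0 < D := by positivity
  set τ := min (1 / 4) (δ / D) with hτ
  have hτ0 : 0 < τ := lt_min (by norm_num) (by positivity)
  have hτ4 : τ ≤ 1 / 4 := min_le_left _ _
  have hτD : D * τ ≤ δ := by
    have : τ ≤ δ / D := min_le_right _ _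
    rwa [le_div_iff₀' hDpos] at this
  obtain ⟨A, hA, hA1⟩ := exists_abs_muLogSum_one_sub_one_le τ hτ0
  obtain ⟨K, hK, hK1⟩ := exists_invSqrtProd_le (τ / 8) (by positivity)
  refine ⟨⌈4 / τ⌉₊, Nat.ceil_pos.2 (by positivity), min τ (τ ^ 2 / (4 * A * K)),
    lt_min hτ0 (by positivity), fun W w R hW hP hw hR hWR => ?_⟩
  have hw0 : 0 < w := (Nat.ceil_pos.2 (by positivity : 0 < 4 / τ)).trans_le hw
  have hw' : 4 / τ ≤ w := Nat.ceil_le.1 hw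
  have hwr : (0 : ℝ) < w := by exact_mod_cast hw0
  have hw2 : 1 / (w : ℝ) ≤ τ / 4 := by
    rw [div_le_iff₀ hτ0] at hw'
    rw [div_le_div_iff₀ hwr (by norm_num)]; linarith
  have hexp : Real.exp (2 / w) ≤ 1 + τ := by
    have h1 : 2 / (w : ℝ) ≤ τ / 2 := by rw [← mul_one_div]; linarith
    have h2 := Real.add_one_le_exp (-(τ / 2))
    have h3 : Real.exp (τ / 2) * Real.exp (-(τ / 2)) = 1 := by rw [← Real.exp_add]; simp
    have h4 := Real.exp_pos (τ / 2)
    have h5 : Real.exp (τ / 2) * (1 - τ / 2) ≤ 1 := by nlinarith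
    have h6 : Real.exp (τ / 2) ≤ 1 + τ := by
      by_contra hcon
      rw [not_le] at hcon
      nlinarith
    exact (Real.exp_le_exp.2 h1).trans h6
  set L := Real.log R with hL
  have hL0 : 0 < L := Real.log_pos hR
  have hW0 : 0 < W := Nat.pos_of_ne_zero hW.ne_zero
  have hW1 : (1 : ℝ) ≤ W := by exact_mod_cast hW0
  have hlW : 0 ≤ Real.log W := Real.log_nonneg hW1
  have hWR1 : (W : ℝ) * (1 + Real.log W) ≤ τ * L :=
    hWR.trans (mul_le_mul_of_nonneg_right (min_le_left _ _) hL0.le)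
  have hR0 : 0 < R := by linarith
  set Y := R ^ (1 - τ) with hY
  have hYR : Y ≤ R := by
    calc Y ≤ R ^ (1 : ℝ) := Real.rpow_le_rpow_of_exponent_le hR.le (by linarith)
      _ = R := Real.rpow_one R
  have hY1 : 1 ≤ Y := Real.one_le_rpow hR.le (by linarith)
  have hlY : Real.log Y = (1 - τ) * L := Real.log_rpow hR0 _
  have hWleR : (W : ℝ) ≤ R := by
    rw [← Real.log_le_log_iff (by linarith) hR0]
    nlinarith
  have hsmall : A * K * R ^ (-(τ / 4)) ≤ τ := by
    have h1 : 1 ≤ τ ^ 2 / (4 * A * K) * L := by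
      refine le_trans ?_ (hWR.trans (mul_le_mul_of_nonneg_right (min_le_right _ _) hL0.le))
      nlinarith
    rw [Real.rpow_def_of_pos hR0, ← hL]
    have h2 := Real.add_one_le_exp (L * (τ / 4))
    have h3 : Real.exp (L * (τ / 4)) * Real.exp (L * -(τ / 4)) = 1 := by
      rw [← Real.exp_add]; simp
    have h4 := Real.exp_pos (L * -(τ / 4))
    have h5 : L * (τ / 4) * Real.exp (L * -(τ / 4)) ≤ 1 := by nlinarith
    have h6 : A * K ≤ τ * (L * (τ / 4)) := by
      rw [div_mul_eq_mul_div, le_div_iff₀ (by positivity)] at h1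
      nlinarith
    calc _ ≤ τ * (L * (τ / 4)) * Real.exp (L * -(τ / 4)) := by gcongr
      _ = τ * (L * (τ / 4) * Real.exp (L * -(τ / 4))) := by ring
      _ ≤ τ * 1 := by gcongr
      _ = τ := mul_one _
  have hclose : ∀ r, Squarefree (r * W) → (r : ℝ) ≤ Y →
      |muLogSum (r * W) (R / r) - totRatio (r * W)| ≤ 2 * τ * totRatio (r * W) := by
    intro r hsq hrY
    have hr : 0 < r := Nat.pos_of_ne_zero (left_ne_zero_of_mul hsq.ne_zero)
    have hr0 : (0 : ℝ) < r := by exact_mod_cast hr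
    have h1 := abs_muLogSum_sub_totRatio_le hτ0.le hA hA1 hsq (R / r) (by positivity)
    have h2 : (R / r) ^ (-(1 / 2) : ℝ) ≤ R ^ (-(τ / 2)) := by
      have : R ^ τ ≤ R / r := by
        rw [le_div_iff₀ hr0]
        calc R ^ τ * r ≤ R ^ τ * Y := by gcongr
          _ = R := by rw [hY, ← Real.rpow_add hR0]; simp
      calc (R / r) ^ (-(1 / 2) : ℝ) ≤ (R ^ τ) ^ (-(1 / 2) : ℝ) :=
            Real.rpow_le_rpow_of_nonpos (by positivity) this (by norm_num)
        _ = _ := by rw [← Real.rpow_mul hR0.le]; congr 1; ring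
    have h3 : invSqrtProd (r * W) ≤ K * R ^ (τ / 4) := by
      refine (hK1 _ hsq).trans ?_
      have : ((r * W : ℕ) : ℝ) ≤ R ^ (2 : ℝ) := by
        push_cast
        rw [Real.rpow_two, sq]
        exact mul_le_mul (hrY.trans hYR) hWleR (by positivity) hR0.le
      calc _ ≤ K * (R ^ (2 : ℝ)) ^ (τ / 8) := by gcongr
        _ = _ := by rw [← Real.rpow_mul hR0.le]; congr 2; ring
    have h4 : A * (R / r) ^ (-(1 / 2) : ℝ) * invSqrtProd (r * W) ≤ τ := by
      have h0 : 0 ≤ invSqrtProd (r * W) := (invSqrtProd_pos _).le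
      calc _ ≤ A * R ^ (-(τ / 2)) * (K * R ^ (τ / 4)) := by
            gcongr
        _ = A * K * (R ^ (-(τ / 2)) * R ^ (τ / 4)) := by ring
        _ = A * K * R ^ (-(τ / 4)) := by
            rw [← Real.rpow_add hR0]; congr 2; ring
        _ ≤ τ := hsmall
    have h5 := one_le_totRatio hsq.ne_zero
    have : τ * 1 ≤ τ * totRatio (r * W) := by gcongr
    linarith
  have hQ := totRatio_pos hW0.ne'
  obtain ⟨hg1, hg2⟩ := totientSum_bounds hw0 hP hW0 hR.le hWR1
  obtain ⟨hy1, hy2⟩ := totientSum_bounds hw0 hP hW0 hY1 hWR1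
  have hmain := abs_quadSum_sub_le hW hC (by positivity : 0 ≤ 2 * τ) hYR hCq hR0 hclose
  rw [hlY] at hy1
  rw [← hL] at hg1 hg2
  have hGR := totientSum_nonneg W R
  have hGY := totientSum_nonneg W Y
  set Q := totRatio W with hQdef
  set gR := Q * totientSum W R with hgR
  set gY := Q * totientSum W Y with hgY
  have hgR0 : 0 ≤ gR := by positivity
  have hgY0 : 0 ≤ gY := by positivity
  have e1 : Q ^ 2 * totientSum W R = Q * gR := by rw [hgR]; ring
  have e2 : Q ^ 2 * (2 * τ * (C + 1) * totientSum W R +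
      (C ^ 2 + 1) * (totientSum W R - totientSum W Y)) =
      Q * (2 * τ * (C + 1) * gR + (C ^ 2 + 1) * (gR - gY)) := by rw [hgR, hgY]; ring
  rw [e1, e2] at hmain
  obtain ⟨f1, f2⟩ := abs_sub_le_of_totientSum_bounds hτ0 hτ4 hL0 hQ hgR0 hgY0
    (by linarith : 1 / (w : ℝ) ≤ τ) hexp hC hg1 hg2 hy1 hmain
  exact ⟨f1.trans (mul_le_mul_of_nonneg_right hτD (by positivity)), f2⟩

theorem abs_card_range_zmod_sub_le (B : ℕ) {D : ℕ} [NeZero D] (r : ZMod D) :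
    |((#{x ∈ Finset.range B | ((x : ℕ) : ZMod D) = r} : ℕ) : ℝ) - B / D| ≤ 1 := by
  have hD : 0 < D := Nat.pos_of_ne_zero (NeZero.ne D)
  have hD' : (0 : ℝ) < D := by exact_mod_cast hD
  have h1 : #{x ∈ Finset.range B | ((x : ℕ) : ZMod D) = r} =
      B.count (· ≡ r.val [MOD D]) := by
    rw [Nat.count_eq_card_filter_range]
    congr 1
    ext x
    rw [Finset.mem_filter, Finset.mem_filter, ← ZMod.natCast_eq_natCast_iff, ZMod.natCast_zmod_val]
  rw [h1, Nat.count_modEq_card B hD]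
  have h2 : (B : ℝ) / D - 1 ≤ (B / D : ℕ) := by
    have := Nat.lt_div_mul_add (a := B) hD
    rw [sub_le_iff_le_add, div_le_iff₀ hD']
    have h3 : (B : ℝ) < (B / D : ℕ) * D + D := by exact_mod_cast this
    nlinarith
  have h3 : ((B / D : ℕ) : ℝ) ≤ (B : ℝ) / D := Nat.cast_div_le
  rw [abs_le]
  split_ifs with h4
  · push_cast
    constructor <;> linarith
  · push_cast
    constructor <;> linarith

theorem abs_prod_sub_pow_le {t : ℕ} (n : Fin t → ℝ) {x : ℝ} (hn : ∀ j, 0 ≤ n j) (hx : 0 ≤ x)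
    (h : ∀ j, |n j - x| ≤ 1) : |∏ j, n j - x ^ t| ≤ (x + 1) ^ t - x ^ t := by
  induction t with
  | zero => simp
  | succ t ih =>
    rw [Fin.prod_univ_succ]
    have ih' := ih (fun j => n j.succ) (fun j => hn _) fun j => h _
    have h0 := h 0
    have h1 : n 0 ≤ x + 1 := by linarith [(abs_le.1 h0).2]
    have hP : |∏ j : Fin t, n j.succ - x ^ t| ≤ (x + 1) ^ t - x ^ t := ih'
    calc _ = |n 0 * (∏ j : Fin t, n j.succ - x ^ t) + (n 0 - x) * x ^ t| := by ring_nf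
      _ ≤ n 0 * |∏ j : Fin t, n j.succ - x ^ t| + |n 0 - x| * x ^ t := by
          refine (abs_add_le _ _).trans (le_of_eq ?_)
          rw [abs_mul, abs_mul, abs_of_nonneg (hn 0), abs_of_nonneg (pow_nonneg hx t)]
      _ ≤ (x + 1) * ((x + 1) ^ t - x ^ t) + 1 * x ^ t := by
          have : 0 ≤ (x + 1) ^ t - x ^ t := (abs_nonneg _).trans hP
          gcongr
      _ = _ := by ring

/-- The discrete box `[0, B)^t`. -/
def natBox (t B : ℕ) : Finset (Fin t → ℕ) := Fintype.piFinset fun _ => Finset.range B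

theorem card_natBox (t B : ℕ) : #(natBox t B) = B ^ t := by
  rw [natBox, Fintype.card_piFinset]; simp

theorem abs_card_natBox_residue_sub_le {ι : Type*} [Fintype ι] (a : ι → ℕ) [∀ p, NeZero (a p)]
    (hco : Pairwise (Function.onFun Nat.Coprime a)) {t : ℕ} (B : ℕ)
    (z : ∀ p, Fin t → ZMod (a p)) :
    |((#{y ∈ natBox t B | ∀ p j, ((y j : ℕ) : ZMod (a p)) = z p j} : ℕ) : ℝ) -
        ((B : ℝ) / (∏ p, a p : ℕ)) ^ t| ≤
      ((B : ℝ) / (∏ p, a p : ℕ) + 1) ^ t - ((B : ℝ) / (∏ p, a p : ℕ)) ^ t := by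
  have : NeZero (∏ p, a p) := ⟨Finset.prod_ne_zero_iff.2 fun p _ => NeZero.ne _⟩
  have h1 : {y ∈ natBox t B | ∀ p j, ((y j : ℕ) : ZMod (a p)) = z p j} =
      Fintype.piFinset fun j => {x ∈ Finset.range B | ((x : ℕ) : ZMod (∏ p, a p)) =
        (ZMod.prodEquivPi a hco).symm fun p => z p j} := by
    ext y
    simp only [natBox, Finset.mem_filter, Fintype.mem_piFinset, Finset.mem_range]
    rw [forall_and, forall_comm]
    refine and_congr_right fun _ => forall_congr' fun j => ?_
    rw [RingEquiv.eq_symm_apply, map_natCast, funext_iff]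
    rfl
  rw [h1, Fintype.card_piFinset, Nat.cast_prod]
  exact abs_prod_sub_pow_le _ (fun _ => by positivity) (by positivity)
    fun j => abs_card_range_zmod_sub_le B _

/-- Equidistribution of a box modulo coprime moduli. -/
theorem abs_card_natBox_sub_le {ι : Type*} [Fintype ι] (a : ι → ℕ) [∀ p, NeZero (a p)]
    (hco : Pairwise (Function.onFun Nat.Coprime a)) {t B : ℕ} (hB : 0 < B)
    (hD : ∏ p, a p ≤ B) (Ω : ∀ p, Finset (Fin t → ZMod (a p))) :
    |((#{y ∈ natBox t B | ∀ p, (fun j => ((y j : ℕ) : ZMod (a p))) ∈ Ω p} : ℕ) : ℝ) / (B : ℝ) ^ t -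
        ∏ p, ((#(Ω p) : ℕ) : ℝ) / (a p : ℝ) ^ t| ≤ 2 ^ t * ((∏ p, a p : ℕ) / B) := by
  set D := ∏ p, a p with hDdef
  have hB' : (0 : ℝ) < B := by exact_mod_cast hB
  have hD0 : 0 < D := Finset.prod_pos fun p _ => Nat.pos_of_ne_zero (NeZero.ne _)
  have hD' : (0 : ℝ) < D := by exact_mod_cast hD0
  have hDB : (D : ℝ) ≤ B := by exact_mod_cast hD
  have hcard : #{y ∈ natBox t B | ∀ p, (fun j => ((y j : ℕ) : ZMod (a p))) ∈ Ω p} =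
      ∑ z ∈ Fintype.piFinset Ω, #{y ∈ natBox t B | ∀ p j, ((y j : ℕ) : ZMod (a p)) = z p j} := by
    rw [← Finset.card_biUnion]
    · congr 1
      ext y
      simp only [Finset.mem_filter, Finset.mem_biUnion, Fintype.mem_piFinset]
      constructor
      · rintro ⟨h1, h2⟩
        exact ⟨fun p j => ((y j : ℕ) : ZMod (a p)), h2, h1, fun p j => rfl⟩
      · rintro ⟨z, hz, h1, h2⟩
        refine ⟨h1, fun p => ?_⟩
        have : (fun j => ((y j : ℕ) : ZMod (a p))) = z p := funext (h2 p)
        rw [this]; exact hz p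
    · intro z _ z' _ hne
      refine Finset.disjoint_left.2 fun y h1 h2 => hne ?_
      have h1 := (Finset.mem_filter.1 h1).2
      have h2 := (Finset.mem_filter.1 h2).2
      funext p j
      rw [← h1, ← h2]
  have hprod : ∏ p, ((#(Ω p) : ℕ) : ℝ) / (a p : ℝ) ^ t =
      (#(Fintype.piFinset Ω) : ℝ) * (1 / (D : ℝ)) ^ t := by
    rw [Fintype.card_piFinset, Finset.prod_div_distrib, Finset.prod_pow, hDdef]
    push_cast
    rw [one_div, inv_pow, div_eq_mul_inv]
  have hcardle : (#(Fintype.piFinset Ω) : ℝ) ≤ (D : ℝ) ^ t := by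
    rw [Fintype.card_piFinset, hDdef]
    push_cast
    rw [← Finset.prod_pow]
    refine Finset.prod_le_prod (fun _ _ => by positivity) fun p _ => ?_
    have := Finset.card_le_univ (Ω p)
    rw [Fintype.card_pi] at this
    simp only [ZMod.card, Finset.prod_const, Finset.card_univ, Fintype.card_fin] at this
    exact_mod_cast this
  have hmain : |((#{y ∈ natBox t B | ∀ p, (fun j => ((y j : ℕ) : ZMod (a p))) ∈ Ω p} : ℕ) : ℝ) -
      (#(Fintype.piFinset Ω) : ℝ) * ((B : ℝ) / D) ^ t| ≤
      (#(Fintype.piFinset Ω) : ℝ) * (((B : ℝ) / D + 1) ^ t - ((B : ℝ) / D) ^ t) := by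
    rw [hcard, Nat.cast_sum, ← nsmul_eq_mul, ← nsmul_eq_mul, ← Finset.sum_const, ← Finset.sum_const,
      ← Finset.sum_sub_distrib]
    exact (Finset.abs_sum_le_sum_abs _ _).trans (Finset.sum_le_sum fun z _ =>
      abs_card_natBox_residue_sub_le a hco B z)
  have hx : ((D : ℝ) / B + 1) ^ t - 1 ≤ 2 ^ t * (D / B) := by
    have hx0 : 0 ≤ (D : ℝ) / B := by positivity
    have hx1 : (D : ℝ) / B ≤ 1 := by rw [div_le_one hB']; exact hDB
    have hgen : ∀ t : ℕ, ((D : ℝ) / B + 1) ^ t ≤ 1 + (2 ^ t - 1) * (D / B) := by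
      intro t
      induction t with
      | zero => simp
      | succ t ih =>
        have h2 : (1 : ℝ) ≤ 2 ^ t := one_le_pow₀ (by norm_num)
        rw [pow_succ, pow_succ]
        have h3 : ((2 : ℝ) ^ t - 1) * (D / B) * (D / B) ≤ (2 ^ t - 1) * (D / B) * 1 := by
          have : 0 ≤ (2 : ℝ) ^ t - 1 := by linarith
          gcongr
        calc _ ≤ (1 + (2 ^ t - 1) * ((D : ℝ) / B)) * (D / B + 1) := by gcongr
          _ ≤ _ := by nlinarith
    linarith [hgen t]
  have e1 : ∀ c : ℝ, c * ((B : ℝ) / D) ^ t / (B : ℝ) ^ t = c * (1 / (D : ℝ)) ^ t := by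
    intro c
    rw [mul_div_assoc, ← div_pow]
    congr 2
    field_simp
  rw [hprod, ← e1, ← sub_div, abs_div, abs_of_pos (pow_pos hB' t), div_le_iff₀ (pow_pos hB' t)]
  refine hmain.trans ?_
  have e2 : (((B : ℝ) / D + 1) ^ t - ((B : ℝ) / D) ^ t) =
      ((B : ℝ) / D) ^ t * (((D : ℝ) / B + 1) ^ t - 1) := by
    rw [mul_sub, ← mul_pow, mul_one]
    congr 2
    field_simp
    ring
  have h3 : 0 ≤ ((D : ℝ) / B + 1) ^ t - 1 := sub_nonneg.2 (one_le_pow₀ (by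
    have : 0 ≤ (D : ℝ) / B := by positivity
    linarith))
  rw [e2]
  calc _ ≤ (D : ℝ) ^ t * (((B : ℝ) / D) ^ t * (((D : ℝ) / B + 1) ^ t - 1)) := by gcongr
    _ = (B : ℝ) ^ t * (((D : ℝ) / B + 1) ^ t - 1) := by
        rw [← mul_assoc, ← mul_pow]
        congr 2
        field_simp
    _ ≤ (B : ℝ) ^ t * (2 ^ t * (D / B)) := by gcongr
    _ = _ := by ring

/-- Möbius inversion on the lattice of finite subsets. -/
def mobiusSum {ι : Type*} (h : Finset ι → ℝ) (U : Finset ι) : ℝ :=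
  ∑ V ∈ U.powerset, (-1) ^ (#U + #V) * h V

theorem mobiusSum_empty {ι : Type*} (h : Finset ι → ℝ) : mobiusSum h ∅ = h ∅ := by
  simp [mobiusSum]

theorem mobiusSum_insert {ι : Type*} (h : Finset ι → ℝ) {a : ι} {U : Finset ι} (ha : a ∉ U) :
    mobiusSum h (insert a U) = mobiusSum (fun V => h (insert a V)) U - mobiusSum h U := by
  rw [mobiusSum, Finset.sum_powerset_insert ha, Finset.card_insert_of_notMem ha, mobiusSum,
    mobiusSum, ← Finset.sum_sub_distrib, ← Finset.sum_add_distrib]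
  refine Finset.sum_congr rfl fun V hV => ?_
  have hV' : a ∉ V := fun h' => ha (Finset.mem_powerset.1 hV h')
  rw [Finset.card_insert_of_notMem hV']
  ring

theorem sum_mobiusSum {ι : Type*} (h : Finset ι → ℝ) (T : Finset ι) :
    ∑ U ∈ T.powerset, mobiusSum h U = h T := by
  induction T using Finset.induction_on generalizing h with
  | empty => simp [mobiusSum_empty]
  | insert a T ha ih =>
    rw [Finset.sum_powerset_insert ha, ih,
      Finset.sum_congr rfl fun U hU => mobiusSum_insert h fun h' => ha (Finset.mem_powerset.1 hU h'),
      Finset.sum_sub_distrib, ih, ih]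
    ring

theorem mobiusSum_singleton {ι : Type*} (h : Finset ι → ℝ) (i : ι) :
    mobiusSum h {i} = h {i} - h ∅ := by
  have := sum_mobiusSum h {i}
  rw [show ({i} : Finset ι) = insert i ∅ from rfl,
    Finset.sum_powerset_insert (Finset.notMem_empty i)] at this
  simp [mobiusSum_empty] at this
  linarith

theorem abs_mobiusSum_le {ι : Type*} {h : Finset ι → ℝ} {p : ℝ} (hp : 1 ≤ p) (h0 : h ∅ = 1)
    (h1 : ∀ i, h {i} = 1) (h2 : ∀ T, 2 ≤ #T → |h T| * p ^ 2 ≤ p ^ #T) {U : Finset ι}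
    (hU : 2 ≤ #U) : |mobiusSum h U| * p ^ 2 ≤ 2 ^ #U * p ^ #U := by
  rw [mobiusSum]
  refine (mul_le_mul_of_nonneg_right (Finset.abs_sum_le_sum_abs _ _) (by positivity)).trans ?_
  rw [Finset.sum_mul]
  refine (Finset.sum_le_card_nsmul _ _ (p ^ #U) fun V hV => ?_).trans
    (le_of_eq (by rw [Finset.card_powerset, nsmul_eq_mul]; push_cast; rfl))
  rw [abs_mul, abs_pow, abs_neg, abs_one, one_pow, one_mul]
  have hle : p ^ 2 ≤ p ^ #U := pow_le_pow_right₀ hp hU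
  rcases lt_or_ge (#V) 2 with hc | hc
  · have : |h V| = 1 := by
      have : #V = 0 ∨ #V = 1 := by omega
      rcases this with hc | hc
      · rw [Finset.card_eq_zero.1 hc, h0, abs_one]
      · obtain ⟨i, rfl⟩ := Finset.card_eq_one.1 hc
        rw [h1, abs_one]
    rw [this, one_mul]; exact hle
  · exact (h2 V hc).trans (pow_le_pow_right₀ hp (Finset.card_le_card (Finset.mem_powerset.1 hV)))

theorem sum_abs_mobiusSum_le {m : ℕ} {h : Finset (Fin m) → ℝ} {p : ℝ} (hp : 1 ≤ p) (h0 : h ∅ = 1)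
    (h1 : ∀ i, h {i} = 1) (h2 : ∀ T, 2 ≤ #T → |h T| * p ^ 2 ≤ p ^ #T) :
    ∑ U : Finset (Fin m), |mobiusSum h U| * (16 / p) ^ #U ≤ 1 + 64 ^ m / p ^ 2 := by
  have hp0 : 0 < p := by linarith
  rw [← Finset.add_sum_erase _ _ (Finset.mem_univ ∅), mobiusSum_empty, h0]
  simp only [abs_one, Finset.card_empty, pow_zero, mul_one]
  gcongr
  refine (Finset.sum_le_card_nsmul _ _ (32 ^ m / p ^ 2) fun U hU => ?_).trans ?_
  · have hUe := Finset.ne_of_mem_erase hU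
    have hUc := Finset.card_pos.2 (Finset.nonempty_iff_ne_empty.2 hUe)
    rcases eq_or_lt_of_le (Nat.succ_le_of_lt hUc) with hc | hc
    · obtain ⟨i, rfl⟩ := Finset.card_eq_one.1 hc.symm
      rw [mobiusSum_singleton, h0, h1]; simp; positivity
    · have h3 := abs_mobiusSum_le hp h0 h1 h2 hc
      rw [le_div_iff₀ (by positivity), div_pow]
      calc _ = |mobiusSum h U| * p ^ 2 * (16 ^ #U / p ^ #U) := by ring
        _ ≤ 2 ^ #U * p ^ #U * (16 ^ #U / p ^ #U) := by gcongr
        _ = 32 ^ #U := by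
            rw [show (32 : ℝ) = 2 * 16 by norm_num, mul_pow]; field_simp
        _ ≤ 32 ^ m := by
            refine pow_le_pow_right₀ (by norm_num) ?_
            simpa using Finset.card_le_univ U
  · rw [nsmul_eq_mul, mul_div_assoc', show (64 : ℝ) = 2 * 32 by norm_num, mul_pow]
    gcongr
    have := Finset.card_le_card (Finset.erase_subset ∅ (Finset.univ : Finset (Finset (Fin m))))
    rw [Finset.card_univ, Fintype.card_finset, Fintype.card_fin] at this
    exact_mod_cast this

theorem card_affine_mul_le {F : Type*} [Field F] [Fintype F] {t : ℕ} (A : Fin t → F) (c : F)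
    (hA : A ≠ 0) :
    #{y : Fin t → F | ∑ j, A j * y j = c} * Fintype.card F ≤ Fintype.card F ^ t := by
  obtain ⟨j, hj⟩ := Function.ne_iff.1 hA
  have hcard : Fintype.card F ^ t = Fintype.card (Fin t → F) := by simp
  rw [hcard, ← Finset.card_univ (α := F), ← Finset.card_product, ← Finset.card_univ]
  refine Finset.card_le_card_of_injOn (fun x => Function.update x.1 j x.2)
    (fun _ _ => Finset.mem_coe.2 (Finset.mem_univ _)) ?_
  rintro ⟨y, d⟩ hy ⟨y', d'⟩ hy' h
  simp only [Finset.coe_product, Set.mem_prod, Finset.mem_coe, Finset.mem_filter,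
    Finset.mem_univ, true_and, and_true] at hy hy' h
  have hd : d = d' := by have := congrFun h j; simpa using this
  have hoff : ∀ i, i ≠ j → y i = y' i := fun i hi => by
    have := congrFun h i; simpa [hi] using this
  have h1 : ∑ i, A i * (y i - y' i) = 0 := by
    simp_rw [mul_sub]; rw [Finset.sum_sub_distrib, hy, hy', sub_self]
  rw [Finset.sum_eq_single j (fun i _ hi => by rw [hoff i hi, sub_self, mul_zero])
    (fun h => absurd (Finset.mem_univ _) h)] at h1
  have h2 : y j = y' j := sub_eq_zero.1 ((mul_eq_zero.1 h1).resolve_left hj)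
  have h3 : y = y' := funext fun i => by
    by_cases hi : i = j
    · rw [hi, h2]
    · exact hoff i hi
  rw [h3, hd]

theorem card_affine_mul_eq {F : Type*} [Field F] [Fintype F] {t : ℕ} (A : Fin t → F) (c : F)
    (hA : A ≠ 0) :
    #{y : Fin t → F | ∑ j, A j * y j = c} * Fintype.card F = Fintype.card F ^ t := by
  refine le_antisymm (card_affine_mul_le A c hA) ?_
  by_contra hcon
  rw [not_le] at hcon
  have h1 : ∑ c : F, #{y : Fin t → F | ∑ j, A j * y j = c} * Fintype.card F <
      ∑ _c : F, Fintype.card F ^ t :=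
    Finset.sum_lt_sum (fun d _ => card_affine_mul_le A d hA) ⟨c, Finset.mem_univ _, hcon⟩
  rw [← Finset.sum_mul, ← Finset.card_eq_sum_card_fiberwise
    (f := fun y : Fin t → F => ∑ j, A j * y j) (s := Finset.univ) (t := Finset.univ)
    (fun _ _ => Finset.mem_coe.2 (Finset.mem_univ _))] at h1
  simp [mul_comm] at h1

theorem card_affine_pair_mul_le {F : Type*} [Field F] [Fintype F] {t : ℕ} (A A' : Fin t → F)
    (c c' : F) {j l : Fin t} (hdet : A j * A' l - A l * A' j ≠ 0) :
    #{y : Fin t → F | ∑ i, A i * y i = c ∧ ∑ i, A' i * y i = c'} * Fintype.card F ^ 2 ≤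
      Fintype.card F ^ t := by
  have hjl : j ≠ l := by rintro rfl; exact hdet (by ring)
  have hcard : Fintype.card F ^ t = Fintype.card (Fin t → F) := by simp
  rw [hcard, sq, ← Finset.card_univ (α := F), ← Finset.card_product, ← Finset.card_product,
    ← Finset.card_univ]
  refine Finset.card_le_card_of_injOn
    (fun x => Function.update (Function.update x.1 j x.2.1) l x.2.2)
    (fun _ _ => Finset.mem_coe.2 (Finset.mem_univ _)) ?_
  rintro ⟨y, d, e⟩ hy ⟨y', d', e'⟩ hy' h
  simp only [Finset.coe_product, Set.mem_prod, Finset.mem_coe, Finset.mem_filter,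
    Finset.mem_univ, true_and, and_true] at hy hy' h
  have he : e = e' := by have := congrFun h l; simpa using this
  have hd : d = d' := by have := congrFun h j; simpa [hjl] using this
  have hoff : ∀ i, i ≠ j → i ≠ l → y i = y' i := fun i hi hi' => by
    have := congrFun h i; simpa [hi, hi'] using this
  have hlin : ∀ A : Fin t → F, ∑ i, A i * (y i - y' i) = 0 →
      A j * (y j - y' j) + A l * (y l - y' l) = 0 := by
    intro A hA
    rw [← hA, ← Finset.sum_pair (f := fun i => A i * (y i - y' i)) hjl]
    refine Finset.sum_subset (Finset.subset_univ _) fun i _ hi => ?_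
    simp only [Finset.mem_insert, Finset.mem_singleton, not_or] at hi
    rw [hoff i hi.1 hi.2, sub_self, mul_zero]
  have h1 := hlin A (by simp_rw [mul_sub]; rw [Finset.sum_sub_distrib, hy.1, hy'.1, sub_self])
  have h2 := hlin A' (by simp_rw [mul_sub]; rw [Finset.sum_sub_distrib, hy.2, hy'.2, sub_self])
  have h3 : (A j * A' l - A l * A' j) * (y j - y' j) = 0 := by
    linear_combination A' l * h1 - A l * h2
  have h4 : (A j * A' l - A l * A' j) * (y l - y' l) = 0 := by
    linear_combination A j * h2 - A' j * h1
  have h5 : y j = y' j := sub_eq_zero.1 ((mul_eq_zero.1 h3).resolve_left hdet)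
  have h6 : y l = y' l := sub_eq_zero.1 ((mul_eq_zero.1 h4).resolve_left hdet)
  have h7 : y = y' := funext fun i => by
    by_cases hi : i = j
    · rw [hi, h5]
    · by_cases hi' : i = l
      · rw [hi', h6]
      · exact hoff i hi hi'
  rw [h7, hd, he]

/-- The common zeros of the affine forms `∑ j, A i j * y j + b i`, `i ∈ T`. -/
def zeroLocus {F : Type*} [Field F] [Fintype F] {m t : ℕ} (A : Fin m → Fin t → F) (b : Fin m → F)
    (T : Finset (Fin m)) : Finset (Fin t → F) :=
  {y | ∀ i ∈ T, ∑ j, A i j * y j + b i = 0}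

/-- The normalised density of `zeroLocus`. -/
def zeroDensity {F : Type*} [Field F] [Fintype F] {m t : ℕ} (A : Fin m → Fin t → F) (b : Fin m → F)
    (T : Finset (Fin m)) : ℝ :=
  (Fintype.card F : ℝ) ^ #T * (#(zeroLocus A b T) / (Fintype.card F : ℝ) ^ t)

section zeroDensity

variable {F : Type*} [Field F] [Fintype F] {m t : ℕ} (A : Fin m → Fin t → F) (b : Fin m → F)

theorem zeroDensity_empty : zeroDensity A b ∅ = 1 := by
  have : (Fintype.card F : ℝ) ≠ 0 := by exact_mod_cast Fintype.card_ne_zero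
  simp [zeroDensity, zeroLocus, this]

theorem zeroDensity_singleton {i : Fin m} (hi : A i ≠ 0) : zeroDensity A b {i} = 1 := by
  have h0 : (Fintype.card F : ℝ) ≠ 0 := by exact_mod_cast Fintype.card_ne_zero
  have h1 := card_affine_mul_eq (A i) (-b i) hi
  have h2 : (#(zeroLocus A b {i}) : ℝ) * Fintype.card F = (Fintype.card F : ℝ) ^ t := by
    rw [← Nat.cast_pow, ← h1, zeroLocus]
    simp [← eq_neg_iff_add_eq_zero]
  rw [zeroDensity, ← h2, Finset.card_singleton, pow_one]
  have h3 : (#(zeroLocus A b {i}) : ℝ) ≠ 0 := fun h => by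
    rw [h, zero_mul] at h2
    exact pow_ne_zero t h0 h2.symm
  field_simp

theorem zeroDensity_mul_sq_le
    (hdet : ∀ i i', i ≠ i' → ∃ j l, A i j * A i' l - A i l * A i' j ≠ 0)
    (T : Finset (Fin m)) (hT : 2 ≤ #T) :
    |zeroDensity A b T| * (Fintype.card F : ℝ) ^ 2 ≤ (Fintype.card F : ℝ) ^ #T := by
  have h0 : (0 : ℝ) < Fintype.card F := by exact_mod_cast Fintype.card_pos
  obtain ⟨i, hi, i', hi', hne⟩ := Finset.one_lt_card.1 hT
  obtain ⟨j, l, hjl⟩ := hdet i i' hne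
  have h1 := card_affine_pair_mul_le (A i) (A i') (-b i) (-b i') hjl
  have h2 : #(zeroLocus A b T) ≤
      #{y : Fin t → F | ∑ r, A i r * y r = -b i ∧ ∑ r, A i' r * y r = -b i'} := by
    refine Finset.card_le_card fun y hy => ?_
    simp only [zeroLocus, Finset.mem_filter, Finset.mem_univ, true_and] at hy ⊢
    exact ⟨eq_neg_of_add_eq_zero_left (hy i hi), eq_neg_of_add_eq_zero_left (hy i' hi')⟩
  have h3 : (#(zeroLocus A b T) : ℝ) * (Fintype.card F : ℝ) ^ 2 ≤ (Fintype.card F : ℝ) ^ t := by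
    exact_mod_cast (Nat.mul_le_mul_right _ h2).trans h1
  rw [zeroDensity, abs_of_nonneg (by positivity), mul_assoc]
  refine mul_le_of_le_one_right (by positivity) ?_
  rw [div_mul_eq_mul_div, div_le_one (by positivity)]
  exact h3

end zeroDensity

/-- `zeroDensity` modulo the prime `p`. -/
def localDensity {m t : ℕ} (A : Fin m → Fin t → ℤ) (b : Fin m → ℤ) (p : ℕ) (T : Finset (Fin m)) :
    ℝ :=
  if h : p.Prime then
    have := Fact.mk h
    zeroDensity (F := ZMod p) (fun i j => (A i j : ZMod p)) (fun i => (b i : ZMod p)) T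
  else 1

theorem localDensity_empty {m t : ℕ} (A : Fin m → Fin t → ℤ) (b : Fin m → ℤ) (p : ℕ) :
    localDensity A b p ∅ = 1 := by
  rw [localDensity]
  split_ifs with h
  · have := Fact.mk h
    exact zeroDensity_empty _ _
  · rfl

theorem abs_card_dvd_sub_le {m t B : ℕ} (A : Fin m → Fin t → ℤ) (b : Fin m → ℤ) (D : Fin m → ℕ)
    (hD : ∀ i, Squarefree (D i)) (S : Finset ℕ) (hS : ∀ p ∈ S, p.Prime)
    (hDS : ∀ i, (D i).primeFactors ⊆ S) (hB : 0 < B) (hSB : ∏ p ∈ S, p ≤ B) :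
    |(#{y ∈ natBox t B | ∀ i, (D i : ℤ) ∣ ∑ j, A i j * y j + b i} : ℝ) / (B : ℝ) ^ t -
        ∏ p ∈ S, localDensity A b p {i | p ∣ D i} / (p : ℝ) ^ #{i | p ∣ D i}| ≤
      2 ^ t * ((∏ p ∈ S, p : ℕ) / B) := by
  have hfact : ∀ p : S, Fact (p : ℕ).Prime := fun p => ⟨hS _ p.2⟩
  have hne : ∀ p : S, NeZero (p : ℕ) := fun p => ⟨(hS _ p.2).ne_zero⟩
  have hco : Pairwise (Function.onFun Nat.Coprime (fun p : S => (p : ℕ))) := fun p q hpq =>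
    (Nat.coprime_primes (hS _ p.2) (hS _ q.2)).2 fun h => hpq (Subtype.ext h)
  have hprodS : ∏ p : S, (p : ℕ) = ∏ p ∈ S, p := Finset.prod_coe_sort S fun p => p
  have key := abs_card_natBox_sub_le (fun p : S => (p : ℕ)) hco (t := t) hB
    (by rw [hprodS]; exact hSB)
    (fun p => zeroLocus (F := ZMod p) (fun i j => (A i j : ZMod p)) (fun i => (b i : ZMod p))
      {i | (p : ℕ) ∣ D i})
  rw [hprodS] at key
  have e1 : ∏ p : S, ((#(zeroLocus (F := ZMod p) (fun i j => (A i j : ZMod p))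
      (fun i => (b i : ZMod p)) {i | (p : ℕ) ∣ D i}) : ℕ) : ℝ) / ((p : ℕ) : ℝ) ^ t =
      ∏ p ∈ S, localDensity A b p {i | p ∣ D i} / (p : ℝ) ^ #{i | p ∣ D i} := by
    rw [← Finset.prod_coe_sort S]
    refine Finset.prod_congr rfl fun p _ => ?_
    have hp0 : ((p : ℕ) : ℝ) ≠ 0 := by exact_mod_cast (hS _ p.2).ne_zero
    rw [localDensity, dif_pos (hS _ p.2), zeroDensity, ZMod.card,
      mul_div_cancel_left₀ _ (pow_ne_zero _ hp0)]
  have e2 : {y ∈ natBox t B | ∀ p : S, (fun j => ((y j : ℕ) : ZMod p)) ∈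
      zeroLocus (F := ZMod p) (fun i j => (A i j : ZMod p)) (fun i => (b i : ZMod p))
      {i | (p : ℕ) ∣ D i}} = {y ∈ natBox t B | ∀ i, (D i : ℤ) ∣ ∑ j, A i j * y j + b i} := by
    refine Finset.filter_congr fun y _ => ?_
    have hz : ∀ (p : S) i, (∑ j, (A i j : ZMod p) * ((y j : ℕ) : ZMod p) + (b i : ZMod p) = 0) ↔
        ((p : ℕ) : ℤ) ∣ ∑ j, A i j * y j + b i := by
      intro p i
      rw [← ZMod.intCast_zmod_eq_zero_iff_dvd]
      push_cast
      rfl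
    simp only [zeroLocus, Finset.mem_filter, Finset.mem_univ, true_and, hz]
    constructor
    · intro h i
      rw [← Nat.prod_primeFactors_of_squarefree (hD i), Int.natCast_dvd]
      refine Finset.prod_primes_dvd _
        (fun p hp => (Nat.prime_of_mem_primeFactors hp).prime) fun p hp => ?_
      rw [← Int.natCast_dvd]
      exact h ⟨p, hDS i hp⟩ i (Nat.dvd_of_mem_primeFactors hp)
    · intro h p i hpi
      exact (Int.natCast_dvd_natCast.2 hpi).trans (h i)
  rw [e1, e2] at key
  exact key

theorem prod_pow_card_dvd {m : ℕ} (D : Fin m → ℕ) (hD : ∀ i, Squarefree (D i)) (P : Finset ℕ)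
    (hP : ∀ p ∈ P, p.Prime) (hDP : ∀ i, (D i).primeFactors ⊆ P) :
    ∏ p ∈ P, p ^ #{i | p ∣ D i} = ∏ i, D i := by
  have h1 : ∀ p ∈ P, p ^ #{i | p ∣ D i} = ∏ i, if p ∣ D i then p else 1 := fun p _ => by
    rw [Finset.prod_ite, Finset.prod_const, Finset.prod_const_one, mul_one]
  rw [Finset.prod_congr rfl h1, Finset.prod_comm]
  refine Finset.prod_congr rfl fun i _ => ?_
  rw [← Finset.prod_filter]
  conv_rhs => rw [← Nat.prod_primeFactors_of_squarefree (hD i)]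
  congr 1
  ext p
  rw [Finset.mem_filter]
  exact ⟨fun h => Nat.mem_primeFactors.2 ⟨hP p h.1, h.2, (hD i).ne_zero⟩,
    fun h => ⟨hDP i h, Nat.dvd_of_mem_primeFactors h⟩⟩

theorem abs_card_dvd_sub_prod_le {m t B : ℕ} (A : Fin m → Fin t → ℤ) (b : Fin m → ℤ)
    (D : Fin m → ℕ) (hD : ∀ i, Squarefree (D i)) (P : Finset ℕ) (hP : ∀ p ∈ P, p.Prime)
    (hDP : ∀ i, (D i).primeFactors ⊆ P) (hB : 0 < B) (hDB : ∏ i, D i ≤ B) :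
    |(#{y ∈ natBox t B | ∀ i, (D i : ℤ) ∣ ∑ j, A i j * y j + b i} : ℝ) / (B : ℝ) ^ t -
        (∏ i, (1 / (D i : ℝ))) * ∏ p ∈ P, localDensity A b p {i | p ∣ D i}| ≤
      2 ^ t * ((∏ i, D i : ℕ) / B) := by
  set S := Finset.univ.biUnion fun i => (D i).primeFactors with hSdef
  have hDS : ∀ i, (D i).primeFactors ⊆ S := fun i =>
    Finset.subset_biUnion_of_mem (fun i => (D i).primeFactors) (Finset.mem_univ i)
  have hSP : S ⊆ P := Finset.biUnion_subset.2 fun i _ => hDP i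
  have hS : ∀ p ∈ S, p.Prime := fun p hp => hP p (hSP hp)
  have hSD : ∏ p ∈ S, p ≤ ∏ i, D i := by
    rw [← prod_pow_card_dvd D hD S hS hDS]
    refine Finset.prod_le_prod (fun _ _ => Nat.zero_le _) fun p hp => ?_
    obtain ⟨i, -, hi⟩ := Finset.mem_biUnion.1 hp
    refine Nat.le_self_pow (Finset.card_pos.2 ⟨i, ?_⟩).ne' p
    exact Finset.mem_filter.2 ⟨Finset.mem_univ _, Nat.dvd_of_mem_primeFactors hi⟩
  refine le_trans (le_of_eq ?_) ((abs_card_dvd_sub_le A b D hD S hS hDS hB (hSD.trans hDB)).trans ?_)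
  · congr 2
    have h2 : ∏ p ∈ S, localDensity A b p {i | p ∣ D i} =
        ∏ p ∈ P, localDensity A b p {i | p ∣ D i} := by
      refine Finset.prod_subset hSP fun p hp hpS => ?_
      rw [show ({i | p ∣ D i} : Finset (Fin m)) = ∅ from ?_, localDensity_empty]
      refine Finset.filter_eq_empty_iff.2 fun i _ hi => hpS (hDS i ?_)
      exact Nat.mem_primeFactors.2 ⟨hP p hp, hi, (hD i).ne_zero⟩
    have h3 := prod_pow_card_dvd D hD S hS hDS
    have h4 : ∏ p ∈ S, (p : ℝ) ^ #{i | p ∣ D i} = ∏ i, (D i : ℝ) := by exact_mod_cast h3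
    conv_rhs => rw [Finset.prod_div_distrib, h2, h4, div_eq_inv_mul, ← Finset.prod_inv_distrib]
    simp_rw [one_div]
  · have : ((∏ p ∈ S, p : ℕ) : ℝ) ≤ (∏ i, D i : ℕ) := by exact_mod_cast hSD
    gcongr

theorem localDensity_singleton {m t : ℕ} (A : Fin m → Fin t → ℤ) (b : Fin m → ℤ) {p : ℕ}
    {i : Fin m} {j : Fin t} (h : ¬ (p : ℤ) ∣ A i j) : localDensity A b p {i} = 1 := by
  rw [localDensity]
  split_ifs with hp
  · have := Fact.mk hp
    refine zeroDensity_singleton _ _ fun h0 => h ?_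
    rw [← ZMod.intCast_zmod_eq_zero_iff_dvd]
    exact congrFun h0 j
  · rfl

theorem localDensity_mul_sq_le {m t : ℕ} (A : Fin m → Fin t → ℤ) (b : Fin m → ℤ) {p : ℕ}
    (hp : p.Prime)
    (h : ∀ i i', i ≠ i' → ∃ j l, ¬ (p : ℤ) ∣ A i j * A i' l - A i l * A i' j)
    (T : Finset (Fin m)) (hT : 2 ≤ #T) : |localDensity A b p T| * (p : ℝ) ^ 2 ≤ (p : ℝ) ^ #T := by
  rw [localDensity, dif_pos hp]
  have := Fact.mk hp
  have key := zeroDensity_mul_sq_le (F := ZMod p) (fun i j => (A i j : ZMod p))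
    (fun i => (b i : ZMod p)) (fun i i' hii => ?_) T hT
  · rwa [ZMod.card] at key
  · obtain ⟨j, l, hjl⟩ := h i i' hii
    refine ⟨j, l, fun h0 => hjl ?_⟩
    rw [← ZMod.intCast_zmod_eq_zero_iff_dvd]
    push_cast
    exact h0

/-- The weight of a pair of divisors in the square of the truncated divisor sum. -/
def pairWeight (R : ℝ) (x : ℕ × ℕ) : ℝ :=
  (ArithmeticFunction.moebius x.1 : ℝ) * ArithmeticFunction.moebius x.2 *
    (Real.log (R / x.1) * Real.log (R / x.2))

theorem lcmSum_eq_sum_product (q : ℕ) (R : ℝ) (e : ℕ) :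
    lcmSum q R e = ∑ x ∈ coprimeIoc q R ×ˢ coprimeIoc q R,
      if e ∣ Nat.lcm x.1 x.2 then pairWeight R x / (Nat.lcm x.1 x.2 : ℝ) else 0 := by
  rw [Finset.sum_product]; rfl

/-- The product of the primes `p` with `i ∈ U p`. -/
def primeProd {m : ℕ} {P : Finset ℕ} (U : P → Finset (Fin m)) (i : Fin m) : ℕ :=
  ∏ p ∈ ({p : P | i ∈ U p} : Finset P), (p : ℕ)

theorem primeProd_eq_prod_map {m : ℕ} {P : Finset ℕ} (U : P → Finset (Fin m)) (i : Fin m) :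
    primeProd U i = ∏ p ∈ ({p : P | i ∈ U p} : Finset P).map (Function.Embedding.subtype _), p := by
  rw [Finset.prod_map]; rfl

theorem prime_of_mem_map {m : ℕ} {P : Finset ℕ} (hP : ∀ p ∈ P, p.Prime)
    {U : P → Finset (Fin m)} {i : Fin m} {p : ℕ}
    (hp : p ∈ ({p : P | i ∈ U p} : Finset P).map (Function.Embedding.subtype _)) : p.Prime := by
  obtain ⟨q, -, rfl⟩ := Finset.mem_map.1 hp
  exact hP _ q.2

theorem primeFactors_primeProd {m : ℕ} {P : Finset ℕ} (hP : ∀ p ∈ P, p.Prime)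
    (U : P → Finset (Fin m)) (i : Fin m) : (primeProd U i).primeFactors =
    ({p : P | i ∈ U p} : Finset P).map (Function.Embedding.subtype _) := by
  rw [primeProd_eq_prod_map]
  exact Nat.primeFactors_prod fun p hp => prime_of_mem_map hP hp

theorem squarefree_primeProd {m : ℕ} {P : Finset ℕ} (hP : ∀ p ∈ P, p.Prime)
    (U : P → Finset (Fin m)) (i : Fin m) : Squarefree (primeProd U i) := by
  rw [primeProd_eq_prod_map]
  refine Finset.squarefree_prod_of_pairwise_isCoprime (fun p hp q hq hpq => ?_)
    fun p hp => (prime_of_mem_map hP hp).prime.squarefree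
  exact Nat.coprime_iff_isRelPrime.1
    ((Nat.coprime_primes (prime_of_mem_map hP hp) (prime_of_mem_map hP hq)).2 hpq)

theorem primeProd_dvd_iff {m : ℕ} {P : Finset ℕ} (hP : ∀ p ∈ P, p.Prime)
    (U : P → Finset (Fin m)) (i : Fin m) (n : ℕ) :
    primeProd U i ∣ n ↔ ∀ p : P, i ∈ U p → (p : ℕ) ∣ n := by
  constructor
  · intro h p hp
    have h1 : (p : ℕ) ∣ primeProd U i := Finset.dvd_prod_of_mem (fun p : P => (p : ℕ))
      (Finset.mem_filter.2 ⟨Finset.mem_univ _, hp⟩)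
    exact h1.trans h
  · intro h
    rw [primeProd_eq_prod_map]
    refine Finset.prod_primes_dvd _ (fun p hp => (prime_of_mem_map hP hp).prime) fun p hp => ?_
    obtain ⟨q, hq, rfl⟩ := Finset.mem_map.1 hp
    exact h q (Finset.mem_filter.1 hq).2

theorem pow_card_div_primeProd {m : ℕ} {P : Finset ℕ} (hP : ∀ p ∈ P, p.Prime)
    (U : P → Finset (Fin m)) (i : Fin m) (c : ℝ) :
    c ^ (primeProd U i).primeFactors.card / primeProd U i =
      ∏ p : P, if i ∈ U p then c / ((p : ℕ) : ℝ) else 1 := by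
  rw [primeFactors_primeProd hP, Finset.card_map, primeProd, Nat.cast_prod, ← Finset.prod_const,
    ← Finset.prod_div_distrib, Finset.prod_filter]

theorem sum_prod_eq_sum_lcmSum {m : ℕ} {P : Finset ℕ} (hP : ∀ p ∈ P, p.Prime) (W : ℕ) (R : ℝ)
    (h : ℕ → Finset (Fin m) → ℝ) :
    ∑ f ∈ Fintype.piFinset fun _ : Fin m => coprimeIoc W R ×ˢ coprimeIoc W R,
      (∏ i, pairWeight R (f i) / (Nat.lcm (f i).1 (f i).2 : ℝ)) *
        ∏ p ∈ P, h p {i | p ∣ Nat.lcm (f i).1 (f i).2} =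
    ∑ U : P → Finset (Fin m), (∏ p : P, mobiusSum (h p) (U p)) *
      ∏ i, lcmSum W R (primeProd U i) := by
  have h1 : ∀ f : Fin m → ℕ × ℕ, ∏ p ∈ P, h p {i | p ∣ Nat.lcm (f i).1 (f i).2} =
      ∑ U : P → Finset (Fin m), (∏ p : P, mobiusSum (h p) (U p)) *
        if ∀ i, primeProd U i ∣ Nat.lcm (f i).1 (f i).2 then 1 else 0 := by
    intro f
    have h2 : ∀ p : P, h p {i | (p : ℕ) ∣ Nat.lcm (f i).1 (f i).2} =
        ∑ V : Finset (Fin m), if V ⊆ ({i | (p : ℕ) ∣ Nat.lcm (f i).1 (f i).2} : Finset (Fin m))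
          then mobiusSum (h p) V else 0 := by
      intro p
      rw [← Finset.sum_filter, ← sum_mobiusSum (h p)]
      congr 1
      ext V
      simp
    rw [← Finset.prod_coe_sort P, Finset.prod_congr rfl fun p _ => h2 p, Finset.prod_univ_sum,
      Fintype.piFinset_univ]
    refine Finset.sum_congr rfl fun U _ => ?_
    rw [Fintype.prod_ite_zero, mul_ite, mul_one, mul_zero]
    refine if_congr ?_ rfl rfl
    simp only [primeProd_dvd_iff hP]
    constructor
    · intro h i p hi
      exact (Finset.mem_filter.1 (h p hi)).2
    · intro h p i hi
      exact Finset.mem_filter.2 ⟨Finset.mem_univ _, h i p hi⟩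
  simp_rw [h1, Finset.mul_sum]
  rw [Finset.sum_comm]
  refine Finset.sum_congr rfl fun U _ => ?_
  simp_rw [lcmSum_eq_sum_product]
  rw [Finset.prod_univ_sum, Finset.mul_sum]
  refine Finset.sum_congr rfl fun f _ => ?_
  rw [Fintype.prod_ite_zero]
  split_ifs
  · ring
  · ring

theorem abs_sum_lcmSum_sub_le {m : ℕ} {P : Finset ℕ} (hP : ∀ p ∈ P, p.Prime) {W : ℕ} {R : ℝ}
    (hPW : ∀ p ∈ P, p.Coprime W) (h : ℕ → Finset (Fin m) → ℝ)
    (h0 : ∀ p ∈ P, h p ∅ = 1) (h1 : ∀ p ∈ P, ∀ i, h p {i} = 1)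
    (h2 : ∀ p ∈ P, ∀ T, 2 ≤ #T → |h p T| * (p : ℝ) ^ 2 ≤ (p : ℝ) ^ #T) {K : ℝ} (hK : 0 ≤ K)
    (hl : ∀ e, Squarefree e → e.Coprime W →
      |lcmSum W R e| ≤ K * (16 ^ e.primeFactors.card / e)) :
    |∑ U : P → Finset (Fin m), (∏ p : P, mobiusSum (h p) (U p)) *
      ∏ i, lcmSum W R (primeProd U i) - lcmSum W R 1 ^ m| ≤
      K ^ m * (∏ p ∈ P, (1 + 64 ^ m / (p : ℝ) ^ 2) - 1) := by
  have hterm : ∀ U : P → Finset (Fin m), |(∏ p : P, mobiusSum (h p) (U p)) *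
      ∏ i, lcmSum W R (primeProd U i)| ≤
      K ^ m * ∏ p : P, (|mobiusSum (h p) (U p)| * (16 / ((p : ℕ) : ℝ)) ^ #(U p)) := by
    intro U
    rw [abs_mul, Finset.abs_prod, Finset.abs_prod, Finset.prod_mul_distrib, mul_left_comm]
    refine mul_le_mul_of_nonneg_left ?_ (Finset.prod_nonneg fun _ _ => abs_nonneg _)
    refine (Finset.prod_le_prod (fun _ _ => abs_nonneg _) fun i _ =>
      hl _ (squarefree_primeProd hP U i) ?_).trans (le_of_eq ?_)
    · exact Nat.Coprime.prod_left fun p _ => hPW _ p.2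
    · rw [Finset.prod_mul_distrib, Finset.prod_const, Finset.card_univ, Fintype.card_fin]
      congr 1
      simp_rw [pow_card_div_primeProd hP]
      rw [Finset.prod_comm]
      refine Finset.prod_congr rfl fun p _ => ?_
      rw [← Finset.prod_filter, Finset.prod_const]
      congr 2
      ext i
      simp
  have htot : ∑ U : P → Finset (Fin m), ∏ p : P,
      (|mobiusSum (h p) (U p)| * (16 / ((p : ℕ) : ℝ)) ^ #(U p)) ≤
      ∏ p ∈ P, (1 + 64 ^ m / (p : ℝ) ^ 2) := by
    rw [← Fintype.piFinset_univ, ← Finset.prod_univ_sum (fun _ => Finset.univ)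
      (fun (p : P) V => |mobiusSum (h p) V| * (16 / ((p : ℕ) : ℝ)) ^ #V), ← Finset.prod_coe_sort P]
    refine Finset.prod_le_prod (fun p _ => Finset.sum_nonneg fun _ _ => by positivity) fun p _ => ?_
    exact sum_abs_mobiusSum_le (by exact_mod_cast (hP _ p.2).one_lt.le) (h0 _ p.2) (h1 _ p.2)
      (h2 _ p.2)
  have hone : (∏ p : P, mobiusSum (h p) ((fun _ => ∅ : P → Finset (Fin m)) p)) *
      ∏ i, lcmSum W R (primeProd (fun _ => ∅ : P → Finset (Fin m)) i) = lcmSum W R 1 ^ m := by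
    rw [Finset.prod_eq_one fun p _ => by rw [mobiusSum_empty, h0 _ p.2], one_mul]
    simp [primeProd]
  have hone' : ∏ p : P, (|mobiusSum (h p) ((fun _ => ∅ : P → Finset (Fin m)) p)| *
      (16 / ((p : ℕ) : ℝ)) ^ #((fun _ => ∅ : P → Finset (Fin m)) p)) = 1 :=
    Finset.prod_eq_one fun p _ => by rw [mobiusSum_empty, h0 _ p.2]; simp
  rw [← Finset.add_sum_erase _ _ (Finset.mem_univ (fun _ => ∅ : P → Finset (Fin m))), hone,
    add_sub_cancel_left]
  rw [← Finset.add_sum_erase _ _ (Finset.mem_univ (fun _ => ∅ : P → Finset (Fin m))), hone'] at htot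
  refine (Finset.abs_sum_le_sum_abs _ _).trans ((Finset.sum_le_sum fun U _ => hterm U).trans ?_)
  rw [← Finset.mul_sum]
  gcongr
  linarith

theorem LambdaR_eq_sum {W n : ℕ} (hn : n ≠ 0) (hW : n.Coprime W) (R : ℝ) :
    LambdaR R n = ∑ d ∈ coprimeIoc W R,
      if d ∣ n then (ArithmeticFunction.moebius d : ℝ) * Real.log (R / d) else 0 := by
  rw [LambdaR, ← Finset.sum_filter]
  refine Finset.sum_congr ?_ fun _ _ => rfl
  ext d
  rw [Finset.mem_filter, Finset.mem_filter, mem_coprimeIoc, Nat.mem_divisors]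
  constructor
  · rintro ⟨⟨h1, -⟩, h2⟩
    exact ⟨⟨⟨Nat.pos_of_dvd_of_pos h1 (Nat.pos_of_ne_zero hn), h2⟩, hW.coprime_dvd_left h1⟩, h1⟩
  · rintro ⟨⟨⟨-, h2⟩, -⟩, h1⟩
    exact ⟨⟨h1, hn⟩, h2⟩

theorem LambdaR_sq_eq_sum {W n : ℕ} (hn : n ≠ 0) (hW : n.Coprime W) (R : ℝ) :
    LambdaR R n ^ 2 = ∑ x ∈ coprimeIoc W R ×ˢ coprimeIoc W R,
      if Nat.lcm x.1 x.2 ∣ n then pairWeight R x else 0 := by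
  rw [sq, LambdaR_eq_sum hn hW, Finset.sum_mul_sum, ← Finset.sum_product']
  refine Finset.sum_congr rfl fun x _ => ?_
  rw [ite_mul, zero_mul, mul_ite, mul_zero, ← ite_and]
  refine if_congr Nat.lcm_dvd_iff.symm ?_ rfl
  rw [pairWeight]
  ring

theorem sum_prod_LambdaR_sq {m W : ℕ} {ι : Type*} (S : Finset ι) (n : Fin m → ι → ℕ)
    (hn : ∀ i, ∀ y ∈ S, n i y ≠ 0) (hW : ∀ i, ∀ y ∈ S, (n i y).Coprime W) (R : ℝ) :
    ∑ y ∈ S, ∏ i, LambdaR R (n i y) ^ 2 =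
      ∑ f ∈ Fintype.piFinset fun _ : Fin m => coprimeIoc W R ×ˢ coprimeIoc W R,
        (∏ i, pairWeight R (f i)) * #{y ∈ S | ∀ i, Nat.lcm (f i).1 (f i).2 ∣ n i y} := by
  have h1 : ∀ y ∈ S, ∏ i, LambdaR R (n i y) ^ 2 =
      ∑ f ∈ Fintype.piFinset fun _ : Fin m => coprimeIoc W R ×ˢ coprimeIoc W R,
        (∏ i, pairWeight R (f i)) * if ∀ i, Nat.lcm (f i).1 (f i).2 ∣ n i y then 1 else 0 := by
    intro y hy
    rw [Finset.prod_congr rfl fun i _ => LambdaR_sq_eq_sum (hn i y hy) (hW i y hy) R,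
      Finset.prod_univ_sum]
    refine Finset.sum_congr rfl fun f _ => ?_
    rw [Fintype.prod_ite_zero, mul_ite, mul_one, mul_zero]
    split_ifs <;> rfl
  rw [Finset.sum_congr rfl h1, Finset.sum_comm]
  refine Finset.sum_congr rfl fun f _ => ?_
  rw [← Finset.mul_sum, Finset.sum_boole]

theorem card_coprimeIoc_le (W : ℕ) {R : ℝ} (hR : 0 ≤ R) : (#(coprimeIoc W R) : ℝ) ≤ R := by
  refine le_trans ?_ (Nat.floor_le hR)
  have := Finset.card_filter_le (Finset.Ioc 0 ⌊R⌋₊) (fun c => Nat.Coprime c W)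
  rw [Nat.card_Ioc, Nat.sub_zero] at this
  exact_mod_cast this

theorem abs_pairWeight_le {W : ℕ} {R : ℝ} {x : ℕ × ℕ}
    (hx : x ∈ coprimeIoc W R ×ˢ coprimeIoc W R) : |pairWeight R x| ≤ Real.log R ^ 2 := by
  have key : ∀ d ∈ coprimeIoc W R, |Real.log (R / d)| ≤ Real.log R := by
    intro d hd
    obtain ⟨⟨h0, h1⟩, -⟩ := mem_coprimeIoc.1 hd
    have h0' : (1 : ℝ) ≤ d := by exact_mod_cast h0
    have h2 : 1 ≤ R / d := (one_le_div (by linarith)).2 h1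
    rw [abs_of_nonneg (Real.log_nonneg h2)]
    exact Real.log_le_log (by linarith) (div_le_self (by linarith) h0')
  obtain ⟨h1, h2⟩ := Finset.mem_product.1 hx
  have h3 := key _ h1
  have h4 := key _ h2
  have h5 := abs_moebius_real_le_one x.1
  have h6 := abs_moebius_real_le_one x.2
  rw [pairWeight, abs_mul, abs_mul, abs_mul, sq]
  calc _ ≤ 1 * 1 * (Real.log R * Real.log R) := by gcongr; exact (abs_nonneg _).trans h3
    _ = _ := by ring

theorem lcm_le_sq {W : ℕ} {R : ℝ} {x : ℕ × ℕ}
    (hx : x ∈ coprimeIoc W R ×ˢ coprimeIoc W R) : (Nat.lcm x.1 x.2 : ℝ) ≤ R ^ 2 := by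
  obtain ⟨h1, h2⟩ := Finset.mem_product.1 hx
  obtain ⟨⟨h0, h1⟩, -⟩ := mem_coprimeIoc.1 h1
  obtain ⟨⟨h0', h1'⟩, -⟩ := mem_coprimeIoc.1 h2
  have h3 : Nat.lcm x.1 x.2 ≤ x.1 * x.2 := Nat.lcm_le_mul h0 h0'
  have h4 : (Nat.lcm x.1 x.2 : ℝ) ≤ x.1 * x.2 := by exact_mod_cast h3
  have h5 : (0 : ℝ) ≤ x.1 := by positivity
  refine h4.trans ?_
  rw [sq]
  gcongr
  linarith

theorem squarefree_lcm_of_pairWeight_ne_zero {R : ℝ} {x : ℕ × ℕ} (h : pairWeight R x ≠ 0) :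
    Squarefree (Nat.lcm x.1 x.2) := by
  have h1 : Squarefree x.1 := by
    by_contra hs
    exact h (by rw [pairWeight, ArithmeticFunction.moebius_eq_zero_of_not_squarefree hs]; simp)
  have h2 : Squarefree x.2 := by
    by_contra hs
    exact h (by rw [pairWeight, ArithmeticFunction.moebius_eq_zero_of_not_squarefree hs]; simp)
  rw [Nat.squarefree_iff_factorization_le_one (Nat.lcm_ne_zero h1.ne_zero h2.ne_zero)]
  intro p
  rw [Nat.factorization_lcm h1.ne_zero h2.ne_zero]
  exact max_le (h1.natFactorization_le_one p) (h2.natFactorization_le_one p)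

/-- The primes up to `R` that are coprime to `W`. -/
def coprimePrimes (W : ℕ) (R : ℝ) : Finset ℕ := (coprimeIoc W R).filter Nat.Prime

theorem primeFactors_lcm_subset {W : ℕ} {R : ℝ} {x : ℕ × ℕ}
    (hx : x ∈ coprimeIoc W R ×ˢ coprimeIoc W R) :
    (Nat.lcm x.1 x.2).primeFactors ⊆ coprimePrimes W R := by
  have key : ∀ d ∈ coprimeIoc W R, ∀ p, p.Prime → p ∣ d → p ∈ coprimePrimes W R := by
    intro d hd p hp hpd
    obtain ⟨⟨h0, h1⟩, h2⟩ := mem_coprimeIoc.1 hd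
    refine Finset.mem_filter.2 ⟨mem_coprimeIoc.2 ⟨⟨hp.pos, le_trans ?_ h1⟩,
      h2.coprime_dvd_left hpd⟩, hp⟩
    exact_mod_cast Nat.le_of_dvd h0 hpd
  intro p hp
  obtain ⟨h1, h2⟩ := Finset.mem_product.1 hx
  have hp' := Nat.prime_of_mem_primeFactors hp
  have hd := (Nat.dvd_of_mem_primeFactors hp).trans (Nat.lcm_dvd_mul _ _)
  rcases hp'.dvd_mul.1 hd with h | h
  · exact key _ h1 p hp' h
  · exact key _ h2 p hp' h

theorem abs_sum_prod_LambdaR_sq_sub_le {m t B W : ℕ} {R : ℝ} (hR : 1 ≤ R)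
    (A : Fin m → Fin t → ℤ) (b : Fin m → ℤ) (n : Fin m → (Fin t → ℕ) → ℕ)
    (hn : ∀ i, ∀ y ∈ natBox t B, n i y ≠ 0) (hW : ∀ i, ∀ y ∈ natBox t B, (n i y).Coprime W)
    (hnA : ∀ i, ∀ y ∈ natBox t B, (n i y : ℤ) = ∑ j, A i j * y j + b i)
    (hB : R ^ (2 * m) ≤ B) :
    |(∑ y ∈ natBox t B, ∏ i, LambdaR R (n i y) ^ 2) / (B : ℝ) ^ t -
      ∑ f ∈ Fintype.piFinset fun _ : Fin m => coprimeIoc W R ×ˢ coprimeIoc W R,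
        (∏ i, pairWeight R (f i) / (Nat.lcm (f i).1 (f i).2 : ℝ)) *
          ∏ p ∈ coprimePrimes W R, localDensity A b p {i | p ∣ Nat.lcm (f i).1 (f i).2}| ≤
      R ^ (2 * m) * (Real.log R ^ (2 * m) * (2 ^ t * (R ^ (2 * m) / B))) := by
  have hB0 : (0 : ℝ) < B := lt_of_lt_of_le (by positivity) hB
  have hL : 0 ≤ Real.log R := Real.log_nonneg hR
  rw [sum_prod_LambdaR_sq _ n hn hW R, Finset.sum_div, ← Finset.sum_sub_distrib]
  refine (Finset.abs_sum_le_sum_abs _ _).trans ((Finset.sum_le_card_nsmul _ _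
    (Real.log R ^ (2 * m) * (2 ^ t * (R ^ (2 * m) / B))) fun f hf => ?_).trans ?_)
  · have hf' := Fintype.mem_piFinset.1 hf
    rw [Finset.prod_div_distrib, mul_div_assoc, div_eq_mul_inv (∏ i, pairWeight R (f i)), mul_assoc,
      ← mul_sub, abs_mul, Finset.abs_prod]
    have hw : ∏ i, |pairWeight R (f i)| ≤ Real.log R ^ (2 * m) := by
      refine (Finset.prod_le_prod (fun _ _ => abs_nonneg _) fun i _ =>
        abs_pairWeight_le (hf' i)).trans (le_of_eq ?_)
      rw [Finset.prod_const, Finset.card_univ, Fintype.card_fin, pow_mul]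
    by_cases hz : ∃ i, pairWeight R (f i) = 0
    · obtain ⟨i, hi⟩ := hz
      rw [Finset.prod_eq_zero (Finset.mem_univ i) (by rw [hi, abs_zero]), zero_mul]
      positivity
    push Not at hz
    have hD : ∏ i, (Nat.lcm (f i).1 (f i).2 : ℝ) ≤ R ^ (2 * m) := by
      refine (Finset.prod_le_prod (fun _ _ => by positivity) fun i _ =>
        lcm_le_sq (hf' i)).trans (le_of_eq ?_)
      rw [Finset.prod_const, Finset.card_univ, Fintype.card_fin, pow_mul]
    have hDB : ∏ i, Nat.lcm (f i).1 (f i).2 ≤ B := by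
      have := hD.trans hB
      exact_mod_cast this
    have key := abs_card_dvd_sub_prod_le A b (fun i => Nat.lcm (f i).1 (f i).2)
      (fun i => squarefree_lcm_of_pairWeight_ne_zero (hz i)) (coprimePrimes W R)
      (fun p hp => (Finset.mem_filter.1 hp).2) (fun i => primeFactors_lcm_subset (hf' i))
      (by exact_mod_cast hB0) hDB
    have hcard : #{y ∈ natBox t B | ∀ i, Nat.lcm (f i).1 (f i).2 ∣ n i y} =
        #{y ∈ natBox t B | ∀ i, (Nat.lcm (f i).1 (f i).2 : ℤ) ∣ ∑ j, A i j * y j + b i} := by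
      congr 1
      refine Finset.filter_congr fun y hy => forall_congr' fun i => ?_
      rw [← hnA i y hy, Int.natCast_dvd_natCast]
    rw [hcard]
    have hinv : (∏ i, (Nat.lcm (f i).1 (f i).2 : ℝ))⁻¹ = ∏ i, (1 / (Nat.lcm (f i).1 (f i).2 : ℝ)) := by
      rw [← Finset.prod_inv_distrib]
      simp_rw [one_div]
    rw [hinv]
    refine mul_le_mul hw (key.trans ?_) (abs_nonneg _) (by positivity)
    have hD' : ((∏ i, Nat.lcm (f i).1 (f i).2 : ℕ) : ℝ) ≤ R ^ (2 * m) := by exact_mod_cast hD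
    gcongr
  · rw [nsmul_eq_mul]
    refine mul_le_mul_of_nonneg_right ?_ (by positivity)
    rw [Fintype.card_piFinset, Finset.prod_const, Finset.card_univ, Fintype.card_fin,
      Finset.card_product, pow_mul]
    have := card_coprimeIoc_le W (zero_le_one.trans hR)
    push_cast
    rw [← sq]
    gcongr

theorem not_dvd_of_natAbs_lt {p : ℕ} {c : ℤ} (hc : c ≠ 0) (hp : c.natAbs < p) : ¬ (p : ℤ) ∣ c :=
  fun h => hc (Int.eq_zero_of_dvd_of_natAbs_lt_natAbs h (by simpa using hp))

theorem exists_natAbs_le {m t : ℕ} (c : Fin m → Fin t → ℤ) : ∃ H : ℕ, ∀ i i' j l,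
    (c i j).natAbs ≤ H ∧ (c i j * c i' l - c i l * c i' j).natAbs ≤ H := by
  set H := Finset.univ.sup fun x : Fin m × Fin t => (c x.1 x.2).natAbs with hH
  have h : ∀ i j, (c i j).natAbs ≤ H := fun i j =>
    Finset.le_sup (f := fun x : Fin m × Fin t => (c x.1 x.2).natAbs) (Finset.mem_univ (i, j))
  refine ⟨H + 2 * (H * H), fun i i' j l => ⟨(h i j).trans (Nat.le_add_right _ _), ?_⟩⟩
  have h1 := Int.natAbs_sub_le (c i j * c i' l) (c i l * c i' j)
  rw [Int.natAbs_mul, Int.natAbs_mul] at h1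
  have h2 := Nat.mul_le_mul (h i j) (h i' l)
  have h3 := Nat.mul_le_mul (h i l) (h i' j)
  omega

/-- The normalising factor `φ(W) / (W log R)`. -/
def sieveNorm (W : ℕ) (R : ℝ) : ℝ := (Nat.totient W : ℝ) / W / Real.log R

theorem sieveNorm_mul {W : ℕ} (hW : W ≠ 0) {R : ℝ} (hR : 1 < R) :
    sieveNorm W R * (totRatio W * Real.log R) = 1 := by
  have h1 : (0 : ℝ) < W := by exact_mod_cast Nat.pos_of_ne_zero hW
  have h2 : (0 : ℝ) < Nat.totient W := by exact_mod_cast Nat.totient_pos.2 (Nat.pos_of_ne_zero hW)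
  have h3 := Real.log_pos hR
  rw [sieveNorm, totRatio]
  field_simp

theorem sieveNorm_nonneg (W : ℕ) {R : ℝ} (hR : 1 < R) : 0 ≤ sieveNorm W R :=
  div_nonneg (by positivity) (Real.log_pos hR).le

theorem sieveNorm_mul_log_le (W : ℕ) {R : ℝ} (hR : 1 < R) : sieveNorm W R * Real.log R ≤ 1 := by
  rw [sieveNorm, div_mul_cancel₀ _ (Real.log_pos hR).ne']
  refine div_le_one_of_le₀ ?_ (by positivity)
  exact_mod_cast Nat.totient_le W

theorem box_error_le {m t W B : ℕ} {R : ℝ} (hR : 1 < R) (hB : R ^ (6 * m + 1) ≤ B) :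
    sieveNorm W R ^ m * (R ^ (2 * m) * (Real.log R ^ (2 * m) * (2 ^ t * (R ^ (2 * m) / B)))) ≤
      2 ^ t / Real.log R := by
  have hL := Real.log_pos hR
  have hR0 : 0 < R := by linarith
  have hB0 : (0 : ℝ) < B := lt_of_lt_of_le (by positivity) hB
  have hLR : Real.log R ≤ R := (Real.log_le_sub_one_of_pos hR0).trans (by linarith)
  have h1 : (sieveNorm W R * Real.log R) ^ m ≤ 1 :=
    pow_le_one₀ (mul_nonneg (sieveNorm_nonneg W hR) hL.le) (sieveNorm_mul_log_le W hR)
  have h2 : Real.log R ^ m ≤ R ^ m := by gcongr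
  calc _ = (sieveNorm W R * Real.log R) ^ m * (Real.log R ^ m * (R ^ (4 * m) * (2 ^ t / B))) := by
        rw [mul_pow]; ring
    _ ≤ 1 * (R ^ m * (R ^ (4 * m) * (2 ^ t / R ^ (6 * m + 1)))) := by gcongr
    _ = 2 ^ t / (R * R ^ m) := by
        rw [show R ^ (6 * m + 1) = R ^ m * R ^ (4 * m) * (R * R ^ m) by ring]
        field_simp
    _ ≤ 2 ^ t / Real.log R := by
        gcongr
        exact hLR.trans (le_mul_of_one_le_right hR0.le (one_le_pow₀ hR.le))

theorem exists_abs_pow_sub_one_le (m : ℕ) {δ : ℝ} (hδ : 0 < δ) :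
    ∃ τ : ℝ, 0 < τ ∧ ∀ x : ℝ, |x - 1| ≤ τ → |x ^ m - 1| ≤ δ := by
  have h : ContinuousAt (fun x : ℝ => x ^ m) 1 := (continuous_pow m).continuousAt
  obtain ⟨τ, hτ, h1⟩ := Metric.continuousAt_iff.1 h δ hδ
  refine ⟨τ / 2, by positivity, fun x hx => ?_⟩
  have h2 := h1 (x := x) (by rw [Real.dist_eq]; linarith)
  rw [Real.dist_eq, one_pow] at h2
  exact h2.le

theorem exists_exp_div_sub_one_le {K D δ : ℝ} (hδ : 0 < δ) :
    ∃ w₀ : ℕ, ∀ w : ℕ, w₀ ≤ w → D * (Real.exp (K / w) - 1) ≤ δ := by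
  have h1 : Tendsto (fun w : ℕ => D * (Real.exp (K / w) - 1)) atTop (nhds (D * (Real.exp 0 - 1))) :=
    (((Real.continuous_exp.tendsto 0).comp (tendsto_const_div_atTop_nhds_zero_nat K)).sub_const
      1).const_mul D
  rw [Real.exp_zero, sub_self, mul_zero] at h1
  exact eventually_atTop.1 ((h1.eventually_lt_const hδ).mono fun _ h => h.le)

theorem coprimePrimes_subset_Ioc {w W : ℕ} (h : PrimesDvd w W) (R : ℝ) :
    coprimePrimes W R ⊆ Finset.Ioc w ⌊R⌋₊ := by
  intro p hp
  obtain ⟨h1, h2⟩ := Finset.mem_filter.1 hp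
  obtain ⟨h3, h4⟩ := Finset.mem_filter.1 h1
  exact Finset.mem_Ioc.2 ⟨h.lt_of_coprime h4 h2.one_lt, (Finset.mem_Ioc.1 h3).2⟩

theorem exists_avg_prod_LambdaR_sq {m t : ℕ} (c : Fin m → Fin t → ℤ)
    (hc : ∀ i, ∃ j, c i j ≠ 0)
    (hcc : ∀ i i', i ≠ i' → ∃ j l, c i j * c i' l - c i l * c i' j ≠ 0) {δ : ℝ} (hδ : 0 < δ) :
    ∃ w₀ : ℕ, ∃ η : ℝ, 0 < η ∧ ∀ (W w B : ℕ) (R : ℝ), Squarefree W → PrimesDvd w W → w₀ ≤ w →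
      1 < R → (W : ℝ) * (1 + Real.log W) ≤ η * Real.log R → R ^ (6 * m + 1) ≤ B →
      ∀ (a : Fin m → ℤ) (n : Fin m → (Fin t → ℕ) → ℕ),
        (∀ i, ∀ y ∈ natBox t B, (n i y : ℤ) = ∑ j, c i j * y j + a i) →
        |(∑ y ∈ natBox t B, ∏ i, sieveNorm W R * LambdaR R (W * n i y + 1) ^ 2) / (B : ℝ) ^ t - 1|
          ≤ δ := by
  obtain ⟨C, hC, hC1⟩ := exists_abs_muLogSum_one_le
  obtain ⟨τ, hτ, hpow⟩ := exists_abs_pow_sub_one_le m (div_pos hδ three_pos)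
  obtain ⟨w₁, hw₁, η₁, hη₁, hq⟩ := exists_quadSum_asymp τ hτ
  obtain ⟨w₂, hw₂⟩ := exists_exp_div_sub_one_le (K := 64 ^ m) (D := (2 * C ^ 2) ^ m)
    (div_pos hδ three_pos)
  obtain ⟨H, hH⟩ := exists_natAbs_le c
  refine ⟨w₁ + w₂ + H, min η₁ (δ / (3 * 2 ^ t)), lt_min hη₁ (by positivity), ?_⟩
  intro W w B R hW hwW hw hR hη hB a n hn
  have hL := Real.log_pos hR
  have hR0 : 0 < R := by linarith
  have hW0 : W ≠ 0 := hW.ne_zero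
  have hW1 : (1 : ℝ) ≤ W := by exact_mod_cast Nat.pos_of_ne_zero hW0
  have hB0 : (0 : ℝ) < B := lt_of_lt_of_le (by positivity) hB
  have hκ := sieveNorm_nonneg W hR
  set κ := sieveNorm W R with hκdef
  obtain ⟨hq1, hq2⟩ := hq W w R hW hwW (by omega) hR
    (hη.trans (mul_le_mul_of_nonneg_right (min_le_left _ _) hL.le))
  have hκQ := sieveNorm_mul hW0 hR
  rw [← hκdef] at hκQ
  have hQ := totRatio_pos hW0
  set K := C ^ 2 * totRatio W ^ 2 * totientSum W R with hKdef
  have hK : 0 ≤ K := mul_nonneg (by positivity) (totientSum_nonneg _ _)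
  have hκK : κ * K ≤ 2 * C ^ 2 := by
    calc κ * K = C ^ 2 * (κ * totRatio W) * (totRatio W * totientSum W R) := by rw [hKdef]; ring
      _ ≤ C ^ 2 * (κ * totRatio W) * (2 * Real.log R) := by gcongr
      _ = 2 * C ^ 2 * (κ * (totRatio W * Real.log R)) := by ring
      _ = 2 * C ^ 2 := by rw [hκQ, mul_one]
  set A : Fin m → Fin t → ℤ := fun i j => W * c i j with hA
  set b : Fin m → ℤ := fun i => W * a i + 1 with hb
  have hbox := abs_sum_prod_LambdaR_sq_sub_le (W := W) hR.le A b (fun i y => W * n i y + 1)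
    (fun _ _ _ => Nat.succ_ne_zero _) (fun i y _ => by simp) (fun i y hy => by
      push_cast
      rw [hn i y hy, hA, hb, mul_add, Finset.mul_sum, add_assoc]
      simp only [mul_assoc])
    (le_trans (pow_le_pow_right₀ hR.le (by omega)) hB)
  have hPc : ∀ p ∈ coprimePrimes W R, p.Prime ∧ p.Coprime W := fun p hp =>
    ⟨(Finset.mem_filter.1 hp).2, (Finset.mem_filter.1 (Finset.mem_filter.1 hp).1).2⟩
  rw [sum_prod_eq_sum_lcmSum fun p hp => (hPc p hp).1] at hbox
  have hPw : ∀ p ∈ coprimePrimes W R, w < p := fun p hp =>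
    (Finset.mem_Ioc.1 (coprimePrimes_subset_Ioc hwW R hp)).1
  have hnd : ∀ p ∈ coprimePrimes W R, ∀ x : ℤ, x ≠ 0 → x.natAbs ≤ H →
      ¬ (p : ℤ) ∣ (W : ℤ) * x := by
    intro p hp x hx hxH hd
    have h1 := hPw p hp
    rcases (Nat.prime_iff_prime_int.1 (hPc p hp).1).dvd_or_dvd hd with h | h
    · have h2 := Int.natCast_dvd_natCast.1 h
      exact (hPc p hp).1.one_lt.ne' (Nat.eq_one_of_dvd_coprimes (hPc p hp).2 dvd_rfl h2)
    · exact not_dvd_of_natAbs_lt hx (by omega) h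
  have hmain := abs_sum_lcmSum_sub_le (m := m) (fun p hp => (hPc p hp).1) (W := W) (R := R)
    (fun p hp => (hPc p hp).2) (localDensity A b) (fun p _ => localDensity_empty A b p)
    (fun p hp i => by
      obtain ⟨j, hj⟩ := hc i
      exact localDensity_singleton A b (j := j) (hnd p hp _ hj (hH i i j j).1))
    (fun p hp T hT => by
      refine localDensity_mul_sq_le A b (hPc p hp).1 (fun i i' hii => ?_) T hT
      obtain ⟨j, l, hjl⟩ := hcc i i' hii
      refine ⟨j, l, fun hd => ?_⟩
      rw [show A i j * A i' l - A i l * A i' j =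
        W * (W * (c i j * c i' l - c i l * c i' j)) by rw [hA]; ring] at hd
      rcases (Nat.prime_iff_prime_int.1 (hPc p hp).1).dvd_or_dvd hd with h | h
      · exact hnd p hp 1 one_ne_zero
          ((Nat.one_le_iff_ne_zero.2 (by simpa using hjl)).trans (hH i i' j l).2)
          (h.trans (dvd_mul_right _ _))
      · exact hnd p hp _ hjl (hH i i' j l).2 h)
    hK (fun e he heW => abs_lcmSum_le hC
      (fun q hq => abs_muLogSum_le_of_one hC hC1 hq) hW he heW hR0)
  have hE : ∏ p ∈ coprimePrimes W R, (1 + 64 ^ m / (p : ℝ) ^ 2) - 1 ≤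
      Real.exp (64 ^ m / w) - 1 := by
    have := prod_one_add_le_exp (w := w) (by omega) ⌊R⌋₊ _ (coprimePrimes_subset_Ioc hwW R) (64 ^ m)
      (by positivity)
    linarith
  have hE0 : 0 ≤ Real.exp (64 ^ m / (w : ℝ)) - 1 := by
    have := Real.one_le_exp (x := 64 ^ m / (w : ℝ)) (by positivity)
    linarith
  have e1 : κ ^ m * (K ^ m * (∏ p ∈ coprimePrimes W R, (1 + 64 ^ m / (p : ℝ) ^ 2) - 1)) ≤ δ / 3 := by
    calc _ ≤ κ ^ m * (K ^ m * (Real.exp (64 ^ m / w) - 1)) := by gcongr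
      _ = (κ * K) ^ m * (Real.exp (64 ^ m / w) - 1) := by rw [mul_pow]; ring
      _ ≤ (2 * C ^ 2) ^ m * (Real.exp (64 ^ m / w) - 1) := by gcongr
      _ ≤ δ / 3 := hw₂ w (by omega)
  have e2 : |(κ * lcmSum W R 1) ^ m - 1| ≤ δ / 3 := by
    refine hpow _ ?_
    rw [lcmSum_one]
    calc |κ * quadSum W R R - 1| = |κ * (quadSum W R R - totRatio W * Real.log R)| := by
          rw [mul_sub, hκQ]
      _ = κ * |quadSum W R R - totRatio W * Real.log R| := by rw [abs_mul, abs_of_nonneg hκ]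
      _ ≤ κ * (τ * (totRatio W * Real.log R)) := by gcongr
      _ = τ := by rw [mul_left_comm, hκQ, mul_one]
  have e3 : 2 ^ t / Real.log R ≤ δ / 3 := by
    have h1 : (1 : ℝ) ≤ δ / (3 * 2 ^ t) * Real.log R := by
      have h2 : (1 : ℝ) ≤ W * (1 + Real.log W) :=
        one_le_mul_of_one_le_of_one_le hW1 (by linarith [Real.log_nonneg hW1])
      exact h2.trans (hη.trans (mul_le_mul_of_nonneg_right (min_le_right _ _) hL.le))
    rw [div_le_iff₀ hL]
    have h2 : (0 : ℝ) < 2 ^ t := by positivity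
    calc (2 : ℝ) ^ t = 2 ^ t * 1 := by ring
      _ ≤ 2 ^ t * (δ / (3 * 2 ^ t) * Real.log R) := by gcongr
      _ = δ / 3 * Real.log R := by field_simp
  have hsum : (∑ y ∈ natBox t B, ∏ i, κ * LambdaR R (W * n i y + 1) ^ 2) / (B : ℝ) ^ t =
      κ ^ m * ((∑ y ∈ natBox t B, ∏ i, LambdaR R (W * n i y + 1) ^ 2) / (B : ℝ) ^ t) := by
    simp_rw [Finset.prod_mul_distrib, Finset.prod_const, Finset.card_univ, Fintype.card_fin]
    rw [← Finset.mul_sum, mul_div_assoc]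
  rw [hsum]
  have f1 := mul_le_mul_of_nonneg_left hbox (pow_nonneg hκ m)
  have f2 := mul_le_mul_of_nonneg_left hmain (pow_nonneg hκ m)
  rw [← abs_of_nonneg (pow_nonneg hκ m), ← abs_mul, abs_of_nonneg (pow_nonneg hκ m), mul_sub] at f1 f2
  rw [← mul_pow] at f2
  have f1' := f1.trans ((box_error_le (t := t) (W := W) hR hB).trans e3)
  have f2' := f2.trans e1
  rw [abs_le] at f1' f2' e2 ⊢
  constructor <;> linarith [f1'.1, f1'.2, f2'.1, f2'.2, e2.1, e2.2]

theorem exists_avg_prod_LambdaR_sq_subset {m t : ℕ} (c : Fin m → Fin t → ℤ)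
    (hc : ∀ i, ∃ j, c i j ≠ 0)
    (hcc : ∀ i i', i ≠ i' → ∃ j l, c i j * c i' l - c i l * c i' j ≠ 0) {δ : ℝ} (hδ : 0 < δ) :
    ∃ w₀ : ℕ, ∃ η : ℝ, 0 < η ∧ ∀ (W w B : ℕ) (R : ℝ), Squarefree W → PrimesDvd w W → w₀ ≤ w →
      1 < R → (W : ℝ) * (1 + Real.log W) ≤ η * Real.log R → R ^ (6 * m + 1) ≤ B →
      ∀ (s : Finset (Fin m)) (a : Fin m → ℤ) (n : Fin m → (Fin t → ℕ) → ℕ),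
        (∀ i, ∀ y ∈ natBox t B, (n i y : ℤ) = ∑ j, c i j * y j + a i) →
        |(∑ y ∈ natBox t B, ∏ i ∈ s, sieveNorm W R * LambdaR R (W * n i y + 1) ^ 2) / (B : ℝ) ^ t
          - 1| ≤ δ := by
  have h := fun s : Finset (Fin m) => exists_avg_prod_LambdaR_sq
    (fun i : Fin #s => c (s.equivFin.symm i : Fin m)) (fun i => hc _)
    (fun i i' hii => hcc _ _ fun h => hii (s.equivFin.symm.injective (Subtype.ext h))) hδ
  choose w₀ η hη H using h
  refine ⟨Finset.univ.sup w₀, Finset.univ.inf' ⟨∅, Finset.mem_univ _⟩ η,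
    (Finset.lt_inf'_iff _).2 fun s _ => hη s, ?_⟩
  intro W w B R hW hwW hw hR hWR hB s a n hn
  have key := H s W w B R hW hwW ((Finset.le_sup (Finset.mem_univ s)).trans hw) hR
    (hWR.trans (mul_le_mul_of_nonneg_right (Finset.inf'_le _ (Finset.mem_univ s))
      (Real.log_pos hR).le))
    ((pow_le_pow_right₀ hR.le (by
      have := Finset.card_le_univ s
      rw [Fintype.card_fin] at this
      omega)).trans hB)
    (fun i => a (s.equivFin.symm i : Fin m)) (fun i => n (s.equivFin.symm i : Fin m))
    (fun i => hn _)
  refine le_trans (le_of_eq ?_) key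
  congr 3
  refine Finset.sum_congr rfl fun y _ => ?_
  rw [← Finset.prod_coe_sort s]
  exact (s.equivFin.symm.prod_comp fun i : s =>
    sieveNorm W R * LambdaR R (W * n i y + 1) ^ 2).symm

theorem abs_LambdaR_le {R : ℝ} (hR : 1 ≤ R) (n : ℕ) : |LambdaR R n| ≤ R * Real.log R := by
  have hL := Real.log_nonneg hR
  have hd : ∀ d ∈ n.divisors.filter (fun d : ℕ => (d : ℝ) ≤ R), 0 < d ∧ (d : ℝ) ≤ R := fun d hd =>
    ⟨Nat.pos_of_mem_divisors (Finset.mem_filter.1 hd).1, (Finset.mem_filter.1 hd).2⟩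
  rw [LambdaR]
  refine (Finset.abs_sum_le_sum_abs _ _).trans ((Finset.sum_le_card_nsmul _ _ (Real.log R)
    fun d hdm => ?_).trans ?_)
  · obtain ⟨h0, h1⟩ := hd d hdm
    have h0' : (1 : ℝ) ≤ d := by exact_mod_cast h0
    have h2 : 1 ≤ R / d := (one_le_div (by linarith)).2 h1
    have h3 : |Real.log (R / d)| ≤ Real.log R := by
      rw [abs_of_nonneg (Real.log_nonneg h2)]
      exact Real.log_le_log (by linarith) (div_le_self (by linarith) h0')
    rw [abs_mul]
    exact (mul_le_mul (abs_moebius_real_le_one d) h3 (abs_nonneg _) zero_le_one).trans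
      (one_mul _).le
  · rw [nsmul_eq_mul]
    refine mul_le_mul_of_nonneg_right (le_trans ?_ (Nat.floor_le (zero_le_one.trans hR))) hL
    have : n.divisors.filter (fun d : ℕ => (d : ℝ) ≤ R) ⊆ Finset.Ioc 0 ⌊R⌋₊ := fun d hdm =>
      Finset.mem_Ioc.2 ⟨(hd d hdm).1, Nat.le_floor (hd d hdm).2⟩
    have := Finset.card_le_card this
    rw [Nat.card_Ioc, Nat.sub_zero] at this
    exact_mod_cast this

theorem sieveNorm_mul_sq_le (W : ℕ) {R : ℝ} (hR : 1 < R) (n : ℕ) :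
    sieveNorm W R * LambdaR R n ^ 2 ≤ R ^ 3 := by
  have hL := Real.log_pos hR
  have hLR : Real.log R ≤ R := (Real.log_le_sub_one_of_pos (by linarith)).trans (by linarith)
  have h1 : LambdaR R n ^ 2 ≤ (R * Real.log R) ^ 2 := by
    rw [← sq_abs]
    have := abs_LambdaR_le hR.le n
    gcongr
  have h2 := sieveNorm_nonneg W hR
  calc _ ≤ sieveNorm W R * (R * Real.log R) ^ 2 := by gcongr
    _ = (sieveNorm W R * Real.log R) * (R ^ 2 * Real.log R) := by ring
    _ ≤ 1 * (R ^ 2 * R) := by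
      gcongr
      exact sieveNorm_mul_log_le W hR
    _ = R ^ 3 := by ring

theorem nuGT_of_inWindow {k N W M : ℕ} {n : ZMod M} (h : inWindow k N n) :
    nuGT k N W n = sieveNorm W (Rpar k M) * LambdaR (Rpar k M) (W * reprN N n + 1) ^ 2 := by
  rw [nuGT, if_pos h, sieveNorm]
  ring

theorem nuGT_of_not_inWindow {k N W M : ℕ} {n : ZMod M} (h : ¬ inWindow k N n) :
    nuGT k N W n = 1 := by
  rw [nuGT, if_neg h]

theorem nuGT_nonneg {k N W M : ℕ} (hR : 1 < Rpar k M) (n : ZMod M) : 0 ≤ nuGT k N W n := by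
  by_cases h : inWindow k N n
  · rw [nuGT_of_inWindow h]
    exact mul_nonneg (sieveNorm_nonneg _ hR) (sq_nonneg _)
  · rw [nuGT_of_not_inWindow h]
    exact zero_le_one

theorem nuGT_le {k N W M : ℕ} (hR : 1 < Rpar k M) (n : ZMod M) :
    nuGT k N W n ≤ Rpar k M ^ 3 := by
  by_cases h : inWindow k N n
  · rw [nuGT_of_inWindow h]
    exact sieveNorm_mul_sq_le _ hR _
  · rw [nuGT_of_not_inWindow h]
    exact one_le_pow₀ hR.le

theorem abs_avg_sub_one_le_of_shift {X ι : Type*} [Fintype X] [Nonempty X] [AddGroup X]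
    (G : X → ℝ) {K : ℝ} (hK : 1 ≤ K) (hG0 : ∀ x, 0 ≤ G x) (hGK : ∀ x, G x ≤ K)
    (S : Finset ι) (hS : S.Nonempty) (σ : ι → X) (bad : Finset X) {δ : ℝ} (hδ : 0 ≤ δ)
    (h : ∀ x ∉ bad, |(∑ y ∈ S, G (x + σ y)) / #S - 1| ≤ δ) :
    |(∑ x, G x) / Fintype.card X - 1| ≤ δ + #bad * K / Fintype.card X := by
  have hS0 : (0 : ℝ) < #S := by exact_mod_cast hS.card_pos
  have hX0 : (0 : ℝ) < Fintype.card X := by exact_mod_cast Fintype.card_pos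
  set avg : X → ℝ := fun x => (∑ y ∈ S, G (x + σ y)) / #S with havg
  have hshift : ∑ x, avg x = ∑ x, G x := by
    rw [havg, ← Finset.sum_div, Finset.sum_comm,
      Finset.sum_congr rfl fun y _ =>
        Fintype.sum_equiv (Equiv.addRight (σ y)) (fun x => G (x + σ y)) G fun _ => rfl, Finset.sum_const,
      nsmul_eq_mul, mul_div_cancel_left₀ _ hS0.ne']
  have hall : ∀ x, |avg x - 1| ≤ δ + if x ∈ bad then K else 0 := by
    intro x
    split_ifs with hx
    · have h1 : 0 ≤ avg x := div_nonneg (Finset.sum_nonneg fun y _ => hG0 _) hS0.le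
      have h2 : avg x ≤ K := by
        refine (div_le_iff₀ hS0).2 ((Finset.sum_le_card_nsmul _ _ K fun y _ => hGK _).trans ?_)
        rw [nsmul_eq_mul, mul_comm]
      rw [abs_le]
      constructor <;> linarith
    · rw [add_zero]
      exact h x hx
  have h1 : (∑ x, G x) / Fintype.card X - 1 = (∑ x, (avg x - 1)) / Fintype.card X := by
    rw [Finset.sum_sub_distrib, hshift, Finset.sum_const, Finset.card_univ, nsmul_eq_mul, mul_one,
      sub_div, div_self hX0.ne']
  rw [h1, abs_div, abs_of_pos hX0, div_le_iff₀ hX0, add_mul, div_mul_cancel₀ _ hX0.ne']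
  refine (Finset.abs_sum_le_sum_abs _ _).trans ((Finset.sum_le_sum fun x _ => hall x).trans ?_)
  rw [Finset.sum_add_distrib, Finset.sum_const, Finset.card_univ, nsmul_eq_mul, mul_comm,
    Finset.sum_ite_mem, Finset.univ_inter, Finset.sum_const, nsmul_eq_mul]

theorem zmod_val_add_intCast {M : ℕ} [NeZero M] (z : ZMod M) (s : ℤ) (h0 : 0 ≤ (z.val : ℤ) + s)
    (h1 : (z.val : ℤ) + s < M) : ((z + s).val : ℤ) = z.val + s := by
  obtain ⟨n, hn⟩ := Int.eq_ofNat_of_zero_le h0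
  have h2 : z + s = ((n : ℕ) : ZMod M) := by
    have h3 : (((z.val : ℤ) + s : ℤ) : ZMod M) = ((n : ℤ) : ZMod M) := by rw [hn]
    push_cast at h3
    rwa [ZMod.natCast_zmod_val] at h3
  rw [h2, hn, ZMod.val_natCast_of_lt]
  omega

theorem card_val_mem_mul_le {M t : ℕ} [Fact M.Prime] (A : Fin t → ZMod M) (hA : A ≠ 0)
    (b : ZMod M) (S : Finset ℕ) :
    #{x : Fin t → ZMod M | (∑ j, A j * x j + b).val ∈ S} * M ≤ #S * M ^ t := by
  have h1 : ({x : Fin t → ZMod M | (∑ j, A j * x j + b).val ∈ S} : Finset _) ⊆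
      S.biUnion fun v => {x : Fin t → ZMod M | ∑ j, A j * x j = v - b} := by
    intro x hx
    refine Finset.mem_biUnion.2 ⟨_, (Finset.mem_filter.1 hx).2, Finset.mem_filter.2
      ⟨Finset.mem_univ _, ?_⟩⟩
    rw [ZMod.natCast_zmod_val, add_sub_cancel_right]
  have h2 := (Finset.card_le_card h1).trans Finset.card_biUnion_le
  refine (Nat.mul_le_mul_right M h2).trans ?_
  rw [Finset.sum_mul, ← smul_eq_mul, ← Finset.sum_const]
  refine Finset.sum_le_sum fun v _ => le_of_eq ?_
  have h3 := card_affine_mul_eq A ((v : ZMod M) - b) hA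
  rw [ZMod.card] at h3
  convert! h3

theorem card_abs_sub_le (n E : ℕ) {a : ℝ} (ha : 0 ≤ a) :
    #((Finset.range n).filter fun v : ℕ => |(v : ℝ) - a| ≤ E) ≤ 2 * E + 1 := by
  have h : (Finset.range n).filter (fun v : ℕ => |(v : ℝ) - a| ≤ E) ⊆
      Finset.Icc (⌈a⌉₊ - E) (⌊a⌋₊ + E) := by
    intro v hv
    have h1 := abs_le.1 (Finset.mem_filter.1 hv).2
    refine Finset.mem_Icc.2 ⟨?_, ?_⟩
    · rw [← Nat.ceil_sub_natCast]
      exact Nat.ceil_le.2 (by linarith)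
    · rw [← Nat.floor_add_natCast ha]
      exact Nat.le_floor (by linarith)
  have h1 := Finset.card_le_card h
  rw [Nat.card_Icc] at h1
  have h2 := Nat.floor_le_ceil a
  omega

/-- The residues within `E` of the boundary of the fundamental domain or of the window. -/
def boundaryVals (k M E : ℕ) : Finset ℕ :=
  (Finset.range M).filter fun v => v < E ∨ M ≤ v + E ∨ |(v : ℝ) - epsk k * M| ≤ E ∨
    |(v : ℝ) - 2 * epsk k * M| ≤ E

theorem epsk_pos (k : ℕ) : 0 < epsk k := by
  rw [epsk]
  positivity

theorem card_boundaryVals_le (k M E : ℕ) : #(boundaryVals k M E) ≤ 6 * E + 2 := by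
  have he := epsk_pos k
  have h1 := card_abs_sub_le M E (a := epsk k * M) (by positivity)
  have h2 := card_abs_sub_le M E (a := 2 * epsk k * M) (by positivity)
  have h3 : #((Finset.range M).filter fun v => v < E) ≤ E := by
    refine (Finset.card_le_card fun v hv => ?_).trans (Finset.card_range E).le
    exact Finset.mem_range.2 (Finset.mem_filter.1 hv).2
  have h4 : #((Finset.range M).filter fun v => M ≤ v + E) ≤ E := by
    refine (Finset.card_le_card (t := Finset.Ico (M - E) M) fun v hv => ?_).trans ?_
    · obtain ⟨h5, h6⟩ := Finset.mem_filter.1 hv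
      have := Finset.mem_range.1 h5
      exact Finset.mem_Ico.2 ⟨by omega, this⟩
    · rw [Nat.card_Ico]
      omega
  rw [boundaryVals]
  simp only [Finset.filter_or]
  have h5 := Finset.card_union_le ((Finset.range M).filter fun v : ℕ => |(v : ℝ) - epsk k * M| ≤ E)
    ((Finset.range M).filter fun v : ℕ => |(v : ℝ) - 2 * epsk k * M| ≤ E)
  refine (Finset.card_union_le _ _).trans ?_
  have h6 := Finset.card_union_le ((Finset.range M).filter fun v : ℕ => M ≤ v + E)
    ((Finset.range M).filter (fun v : ℕ => |(v : ℝ) - epsk k * M| ≤ E) ∪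
    (Finset.range M).filter fun v : ℕ => |(v : ℝ) - 2 * epsk k * M| ≤ E)
  omega

theorem val_add_and_inWindow_iff {k N M E : ℕ} [NeZero M] {u : ZMod M}
    (hu : (u - (N : ZMod M)).val ∉ boundaryVals k M E) {s : ℤ} (hs : s.natAbs ≤ E) :
    ((u + (s : ZMod M) - (N : ZMod M)).val : ℤ) = (u - (N : ZMod M)).val + s ∧
      (inWindow k N (u + (s : ZMod M)) ↔ inWindow k N u) := by
  set v := (u - (N : ZMod M)).val with hv
  have hvM : v < M := ZMod.val_lt _
  rw [boundaryVals, Finset.mem_filter, not_and] at hu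
  have hu' := hu (Finset.mem_range.2 hvM)
  push Not at hu'
  obtain ⟨h1, h2, h3, h4⟩ := hu'
  have hval : ((u + (s : ZMod M) - (N : ZMod M)).val : ℤ) = v + s := by
    rw [add_sub_right_comm]
    exact zmod_val_add_intCast _ s (by omega) (by omega)
  refine ⟨hval, ?_⟩
  have hval' : ((u + (s : ZMod M) - (N : ZMod M)).val : ℝ) = v + s := by exact_mod_cast hval
  have hs' : |(s : ℝ)| ≤ E := by
    rw [← Int.cast_abs, Int.abs_eq_natAbs]
    exact_mod_cast hs
  rw [inWindow, inWindow, hval', ← hv]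
  obtain ⟨hs1, hs2⟩ := abs_le.1 hs'
  have key : ∀ a : ℝ, (E : ℝ) < |(v : ℝ) - a| → (a ≤ (v : ℝ) + s ↔ a ≤ v) ∧
      ((v : ℝ) + s ≤ a ↔ (v : ℝ) ≤ a) := by
    intro a ha
    rcases lt_abs.1 ha with h | h
    · exact ⟨⟨fun _ => by linarith, fun _ => by linarith⟩,
        ⟨fun _ => by linarith, fun _ => by linarith⟩⟩
    · exact ⟨⟨fun _ => by linarith, fun _ => by linarith⟩,
        ⟨fun _ => by linarith, fun _ => by linarith⟩⟩
  rw [(key _ h3).1, (key _ h4).2]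

theorem abs_avg_nuGT_sub_one_le {m t k N W B H M : ℕ} [Fact M.Prime] (c : Fin m → Fin t → ℤ)
    (hcM : ∀ i, (fun j => (c i j : ZMod M)) ≠ 0) (hH : ∀ i j, (c i j).natAbs ≤ H) (hB : 0 < B)
    (hR : 1 < Rpar k M) {δ : ℝ} (hδ : 0 ≤ δ)
    (hcore : ∀ (s : Finset (Fin m)) (a : Fin m → ℤ) (n : Fin m → (Fin t → ℕ) → ℕ),
      (∀ i, ∀ y ∈ natBox t B, (n i y : ℤ) = ∑ j, c i j * y j + a i) →
      |(∑ y ∈ natBox t B, ∏ i ∈ s, sieveNorm W (Rpar k M) * LambdaR (Rpar k M) (W * n i y + 1) ^ 2) /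
        (B : ℝ) ^ t - 1| ≤ δ)
    (b : Fin m → ZMod M) :
    |(∑ x : Fin t → ZMod M, ∏ i, nuGT k N W (∑ j, (c i j : ZMod M) * x j + b i)) / (M : ℝ) ^ t - 1| ≤
      δ + m * (6 * (t * H * B) + 2) * (Rpar k M ^ (3 * m) / M) := by
  set R := Rpar k M with hRdef
  set E := t * H * B with hE
  have hM0 : (0 : ℝ) < M := by exact_mod_cast (Fact.out : M.Prime).pos
  set ψ : Fin m → (Fin t → ZMod M) → ZMod M := fun i x => ∑ j, (c i j : ZMod M) * x j + b i with hψ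
  set bad : Finset (Fin t → ZMod M) := Finset.univ.biUnion fun i =>
    {x | (∑ j, (c i j : ZMod M) * x j + (b i - (N : ZMod M))).val ∈ boundaryVals k M E} with hbad
  have hbadcard : (#bad : ℝ) * M ≤ m * (6 * E + 2) * M ^ t := by
    have h1 : #bad * M ≤ m * ((6 * E + 2) * M ^ t) := by
      refine (Nat.mul_le_mul_right M Finset.card_biUnion_le).trans ?_
      rw [Finset.sum_mul]
      refine (Finset.sum_le_card_nsmul _ _ ((6 * E + 2) * M ^ t) fun i _ => ?_).trans ?_
      · exact (card_val_mem_mul_le _ (hcM i) _ _).trans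
          (Nat.mul_le_mul_right _ (card_boundaryVals_le k M E))
      · rw [Finset.card_univ, Fintype.card_fin, smul_eq_mul]
    rw [mul_assoc]
    exact_mod_cast h1
  have key := abs_avg_sub_one_le_of_shift
    (fun x : Fin t → ZMod M => ∏ i, nuGT k N W (ψ i x)) (K := R ^ (3 * m)) (one_le_pow₀ hR.le)
    (fun x => Finset.prod_nonneg fun i _ => nuGT_nonneg hR _)
    (fun x => (Finset.prod_le_prod (fun i _ => nuGT_nonneg hR _) fun i _ => nuGT_le hR _).trans
      (by rw [Finset.prod_const, Finset.card_univ, Fintype.card_fin, pow_mul]))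
    (natBox t B) (Finset.card_pos.1 (by rw [card_natBox]; positivity))
    (fun y j => ((y j : ℕ) : ZMod M)) bad hδ ?_
  · rw [Fintype.card_fun, ZMod.card, Fintype.card_fin] at key
    push_cast at key
    refine key.trans ?_
    gcongr δ + ?_
    have hMt : (0 : ℝ) < (M : ℝ) ^ t := by positivity
    have h2 : (#bad : ℝ) / (M : ℝ) ^ t ≤ m * (6 * E + 2) / M := by
      rw [div_le_div_iff₀ hMt hM0]
      exact hbadcard
    have h3 : (E : ℝ) = t * H * B := by rw [hE]; push_cast; ring
    calc (#bad : ℝ) * R ^ (3 * m) / (M : ℝ) ^ t = #bad / (M : ℝ) ^ t * R ^ (3 * m) := by ring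
      _ ≤ m * (6 * E + 2) / M * R ^ (3 * m) := by gcongr
      _ = _ := by rw [h3]; ring
  · intro x hx
    have hgood : ∀ i, (ψ i x - (N : ZMod M)).val ∉ boundaryVals k M E := by
      intro i hi
      refine hx (Finset.mem_biUnion.2 ⟨i, Finset.mem_univ _, Finset.mem_filter.2
        ⟨Finset.mem_univ _, ?_⟩⟩)
      rwa [← add_sub_assoc]
    have hψadd : ∀ i (y : Fin t → ℕ), ψ i (x + fun j => ((y j : ℕ) : ZMod M)) =
        ψ i x + ((∑ j, c i j * y j : ℤ) : ZMod M) := by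
      intro i y
      rw [hψ]
      simp only [Pi.add_apply, mul_add, Finset.sum_add_distrib]
      push_cast
      ring
    have hs : ∀ i, ∀ y ∈ natBox t B, (∑ j, c i j * (y j : ℤ)).natAbs ≤ E := by
      intro i y hy
      refine (Int.natAbs_sum_le _ _).trans ((Finset.sum_le_card_nsmul _ _ (H * B)
        fun j _ => ?_).trans ?_)
      · rw [Int.natAbs_mul, Int.natAbs_natCast]
        exact Nat.mul_le_mul (hH i j) (Finset.mem_range.1 (Fintype.mem_piFinset.1 hy j)).le
      · rw [Finset.card_univ, Fintype.card_fin, smul_eq_mul, hE, mul_assoc]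
    have hcor := hcore {i | inWindow k N (ψ i x)}
      (fun i => N + (ψ i x - (N : ZMod M)).val)
      (fun i y => reprN N (ψ i (x + fun j => ((y j : ℕ) : ZMod M)))) (fun i y hy => by
        rw [reprN, hψadd, Nat.cast_add, (val_add_and_inWindow_iff (hgood i) (hs i y hy)).1]
        ring)
    rw [card_natBox]
    push_cast
    refine le_trans (le_of_eq ?_) hcor
    congr 3
    refine Finset.sum_congr rfl fun y hy => ?_
    rw [Finset.prod_filter]
    refine Finset.prod_congr rfl fun i _ => ?_
    have hiff := (val_add_and_inWindow_iff (hgood i) (hs i y hy)).2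
    rw [← hψadd] at hiff
    split_ifs with h
    · exact nuGT_of_inWindow (hiff.2 h)
    · exact nuGT_of_not_inWindow fun h' => h (hiff.1 h')

/-- The integer `k! q` for a rational number `q` with denominator at most `k`. -/
def clearDenom (k : ℕ) (q : ℚ) : ℤ := q.num * (k.factorial / q.den : ℕ)

theorem clearDenom_cast {k : ℕ} {q : ℚ} (hq : q.den ≤ k) :
    (clearDenom k q : ℚ) = k.factorial * q := by
  have h1 : q.den ∣ k.factorial := Nat.dvd_factorial q.den_pos hq
  have h2 : (q.den : ℚ) ≠ 0 := by exact_mod_cast q.den_nz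
  rw [clearDenom, Int.cast_mul, Int.cast_natCast, Nat.cast_div h1 h2]
  conv_rhs => rw [← Rat.num_div_den q]
  ring

theorem ratZMod_mul_factorial {k M : ℕ} [Fact M.Prime] (hk : k < M) {q : ℚ} (hq : q.den ≤ k) :
    ratZMod q M * (k.factorial : ZMod M) = clearDenom k q := by
  have h1 : q.den ∣ k.factorial := Nat.dvd_factorial q.den_pos hq
  have h2 : (q.den : ZMod M) ≠ 0 := by
    rw [Ne, ZMod.natCast_eq_zero_iff]
    exact fun h => absurd (Nat.le_of_dvd q.den_pos h) (by omega)
  obtain ⟨r, hr⟩ := h1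
  rw [ratZMod, clearDenom, hr, Nat.mul_div_cancel_left _ q.den_pos]
  push_cast
  field_simp

theorem factorial_ne_zero_zmod {k M : ℕ} [Fact M.Prime] (hk : k < M) :
    (k.factorial : ZMod M) ≠ 0 := by
  rw [Ne, ZMod.natCast_eq_zero_iff, (Fact.out : M.Prime).dvd_factorial]
  omega

theorem exists_minor_ne_zero {t : ℕ} {u v : Fin t → ℚ} (hv : v ≠ 0) (h : ∀ q : ℚ, u ≠ q • v) :
    ∃ j l, u j * v l - u l * v j ≠ 0 := by
  by_contra! hcon
  obtain ⟨l, hl⟩ := Function.ne_iff.1 hv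
  refine h (u l / v l) (funext fun j => ?_)
  have hl' : v l ≠ 0 := hl
  have := hcon j l
  rw [Pi.smul_apply, smul_eq_mul]
  field_simp
  linarith

theorem sum_fin_eq_sum_zmod {t M : ℕ} [NeZero M] (G : (Fin t → ZMod M) → ℝ) :
    ∑ x : Fin t → Fin M, G (fun j => ((x j : ℕ) : ZMod M)) = ∑ x : Fin t → ZMod M, G x := by
  refine Fintype.sum_bijective (fun (x : Fin t → Fin M) j => ((x j : ℕ) : ZMod M)) ⟨?_, ?_⟩ _ _
    fun _ => rfl
  · intro x y hxy
    funext j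
    have h1 := congrArg ZMod.val (congrFun hxy j)
    simp only [ZMod.val_natCast_of_lt (x j).2, ZMod.val_natCast_of_lt (y j).2] at h1
    exact Fin.ext h1
  · intro z
    exact ⟨fun j => ⟨(z j).val, ZMod.val_lt _⟩, funext fun j => ZMod.natCast_zmod_val _⟩

theorem sum_ratZMod_eq_sum_clearDenom {m t k M : ℕ} [Fact M.Prime] (hk : k < M)
    (L : Fin m → Fin t → ℚ) (hL : ∀ i j, (L i j).den ≤ k) (f : ZMod M → ℝ) (b : Fin m → ZMod M) :
    ∑ x : Fin t → Fin M, ∏ i, f (∑ j, ratZMod (L i j) M * ((x j : ℕ) : ZMod M) + b i) =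
      ∑ x : Fin t → ZMod M, ∏ i, f (∑ j, (clearDenom k (L i j) : ZMod M) * x j + b i) := by
  rw [sum_fin_eq_sum_zmod fun x => ∏ i, f (∑ j, ratZMod (L i j) M * x j + b i)]
  refine (Fintype.sum_equiv (Equiv.piCongrRight fun _ =>
    Equiv.mulLeft₀ (k.factorial : ZMod M) (factorial_ne_zero_zmod hk)) _ _ fun x => ?_).symm
  refine Finset.prod_congr rfl fun i _ => ?_
  congr 2
  refine Finset.sum_congr rfl fun j _ => ?_
  rw [← ratZMod_mul_factorial hk (hL i j), mul_assoc]
  rfl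

theorem Wprim_eq_primorial (w : ℕ → ℕ) (N : ℕ) : Wprim w N = primorial (w N) := rfl

theorem squarefree_Wprim (w : ℕ → ℕ) (N : ℕ) : Squarefree (Wprim w N) := by
  refine Finset.squarefree_prod_of_pairwise_isCoprime (fun p hp q hq hpq => ?_)
    fun p hp => (Finset.mem_filter.1 hp).2.prime.squarefree
  exact Nat.coprime_iff_isRelPrime.1
    ((Nat.coprime_primes (Finset.mem_filter.1 hp).2 (Finset.mem_filter.1 hq).2).2 hpq)

theorem primesDvd_Wprim (w : ℕ → ℕ) (N : ℕ) : PrimesDvd (w N) (Wprim w N) := fun p hp hpw =>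
  Finset.dvd_prod_of_mem (fun p => p) (Finset.mem_filter.2 ⟨Finset.mem_range.2 (by omega), hp⟩)

theorem primorial_mul_one_add_log_le {w : ℕ} {y : ℝ} (hy : 0 ≤ y) (hw : (w : ℝ) ≤ y / 2) :
    (primorial w : ℝ) * (1 + Real.log (primorial w)) ≤ 7 * Real.exp (4 / 5 * y) := by
  have hlog2 := Real.log_two_lt_d9
  have hlog4 : Real.log 4 = 2 * Real.log 2 := by
    rw [show (4 : ℝ) = 2 ^ 2 by norm_num, Real.log_pow]
    norm_num
  have h0 : (0 : ℝ) < primorial w := by exact_mod_cast primorial_pos w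
  have h1 : (primorial w : ℝ) ≤ Real.exp (7 / 10 * y) := by
    calc (primorial w : ℝ) ≤ 4 ^ w := by exact_mod_cast primorial_le_four_pow w
      _ = Real.exp (w * Real.log 4) := by rw [Real.exp_nat_mul, Real.exp_log (by norm_num)]
      _ ≤ Real.exp (7 / 10 * y) := by
        refine Real.exp_le_exp.2 ?_
        rw [hlog4]
        nlinarith [Real.log_nonneg (one_le_two (α := ℝ)), Nat.cast_nonneg (α := ℝ) w]
  have h2 : Real.log (primorial w) ≤ 7 / 10 * y := by
    rw [Real.log_le_iff_le_exp h0]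
    exact h1
  have h3 : 1 + 7 / 10 * y ≤ 7 * Real.exp (1 / 10 * y) := by
    have := Real.add_one_le_exp (1 / 10 * y)
    linarith
  calc _ ≤ (primorial w : ℝ) * (7 * Real.exp (1 / 10 * y)) := by gcongr; linarith
    _ ≤ Real.exp (7 / 10 * y) * (7 * Real.exp (1 / 10 * y)) := by gcongr
    _ = 7 * Real.exp (4 / 5 * y) := by
      rw [mul_left_comm, ← Real.exp_add]
      congr 2
      ring

theorem log_Rpar {k M : ℕ} (hM : 0 < M) :
    Real.log (Rpar k M) = 1 / (k * 2 ^ (k + 4)) * Real.log M := by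
  rw [Rpar, Real.log_rpow (by exact_mod_cast hM)]

theorem Rpar_pow {k : ℕ} (hk : 0 < k) (M : ℕ) : Rpar k M ^ (k * 2 ^ (k + 4)) = M := by
  rw [Rpar, ← Real.rpow_natCast, ← Real.rpow_mul (Nat.cast_nonneg M)]
  push_cast
  rw [one_div_mul_cancel (by positivity), Real.rpow_one]

theorem one_lt_Rpar {k M : ℕ} (hk : 0 < k) (hM : 1 < M) : 1 < Rpar k M :=
  Real.one_lt_rpow (by exact_mod_cast hM) (by positivity)

theorem tendsto_Rpar {k : ℕ} (hk : 0 < k) {M : ℕ → ℕ} (hM : Tendsto M atTop atTop) :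
    Tendsto (fun N => Rpar k (M N)) atTop atTop :=
  (tendsto_rpow_atTop (by positivity : (0 : ℝ) < 1 / (k * 2 ^ (k + 4)))).comp
    (tendsto_natCast_atTop_atTop.comp hM)

theorem tendsto_of_rpow_lt {ε : ℝ} (hε : 0 < ε) {M : ℕ → ℕ}
    (hM : ∀ᶠ N : ℕ in atTop, (N : ℝ) ^ ε < M N) : Tendsto M atTop atTop := by
  rw [← tendsto_natCast_atTop_iff (R := ℝ)]
  exact tendsto_atTop_mono' _ (hM.mono fun _ h => h.le)
    ((tendsto_rpow_atTop hε).comp tendsto_natCast_atTop_atTop)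

theorem eventually_Wprim_mul_le {k : ℕ} (hk : 0 < k) {ε : ℝ} (hε : 0 < ε) {M w : ℕ → ℕ}
    (hM : ∀ᶠ N : ℕ in atTop, (N : ℝ) ^ ε < M N)
    (hwb : ∀ᶠ N : ℕ in atTop, (w N : ℝ) ≤ Real.log (Real.log N) / 2) {η : ℝ} (hη : 0 < η) :
    ∀ᶠ N : ℕ in atTop, (Wprim w N : ℝ) * (1 + Real.log (Wprim w N)) ≤
      η * Real.log (Rpar k (M N)) := by
  have hlog : Tendsto (fun N : ℕ => Real.log N) atTop atTop :=
    Real.tendsto_log_atTop.comp tendsto_natCast_atTop_atTop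
  have hloglog : Tendsto (fun N : ℕ => Real.log (Real.log N)) atTop atTop :=
    Real.tendsto_log_atTop.comp hlog
  set κ : ℝ := η * (1 / (k * 2 ^ (k + 4))) * ε with hκ
  have hκ0 : 0 < κ := by positivity
  have hbig : ∀ᶠ N : ℕ in atTop, 7 / κ ≤ Real.exp (1 / 5 * Real.log (Real.log N)) :=
    (Real.tendsto_exp_atTop.comp (hloglog.const_mul_atTop (by norm_num : (0 : ℝ) < 1 / 5))
      ).eventually_ge_atTop _
  filter_upwards [hM, hwb, hbig, hlog.eventually_gt_atTop 0, hloglog.eventually_ge_atTop 0,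
    eventually_gt_atTop 0] with N h1 h2 h3 h4 h5 h6
  have hN : (0 : ℝ) < N := by exact_mod_cast h6
  have hM0 : (0 : ℝ) < M N := lt_trans (Real.rpow_pos_of_pos hN ε) h1
  have hlogM : ε * Real.log N ≤ Real.log (M N) := by
    rw [← Real.log_rpow hN]
    exact Real.log_le_log (Real.rpow_pos_of_pos hN ε) h1.le
  rw [Wprim_eq_primorial, log_Rpar (by exact_mod_cast hM0)]
  set y := Real.log (Real.log N) with hy
  have hexp : Real.log N = Real.exp (4 / 5 * y) * Real.exp (1 / 5 * y) := by
    rw [← Real.exp_add, ← add_mul, hy]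
    norm_num
    exact (Real.exp_log h4).symm
  refine (primorial_mul_one_add_log_le h5 h2).trans ?_
  rw [div_le_iff₀ hκ0] at h3
  calc 7 * Real.exp (4 / 5 * y) ≤ Real.exp (1 / 5 * y) * κ * Real.exp (4 / 5 * y) := by gcongr
    _ = η * (1 / (k * 2 ^ (k + 4)) * (ε * Real.log N)) := by rw [hexp, hκ]; ring
    _ ≤ η * (1 / (k * 2 ^ (k + 4)) * Real.log (M N)) := by gcongr

theorem shift_error_le {m k M : ℕ} (hk : 0 < k) (hm : m ≤ k * 2 ^ (k - 1)) {R δ : ℝ} (hR : 1 < R)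
    (hRM : R ^ (k * 2 ^ (k + 4)) = M) {D : ℝ} (hD : 0 ≤ D) (hδ : m * (12 * D + 2) ≤ δ * R) :
    m * (6 * (D * ⌈R ^ (6 * m + 1)⌉₊) + 2) * (R ^ (3 * m) / M) ≤ δ := by
  have hR0 : 0 < R := by linarith
  have hexp : 9 * m + 2 ≤ k * 2 ^ (k + 4) := by
    have h1 : 2 ^ (k + 4) = 32 * 2 ^ (k - 1) := by
      rw [show k + 4 = 5 + (k - 1) by omega, pow_add]
      norm_num
    have h2 : 1 ≤ k * 2 ^ (k - 1) := Nat.mul_pos hk (by positivity)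
    rw [h1, mul_left_comm]
    omega
  have hM : R ^ (9 * m + 2) ≤ M := by
    rw [← hRM]
    exact pow_le_pow_right₀ hR.le hexp
  have h1 : (1 : ℝ) ≤ R ^ (6 * m + 1) := one_le_pow₀ hR.le
  have hceil : (⌈R ^ (6 * m + 1)⌉₊ : ℝ) ≤ 2 * R ^ (6 * m + 1) := by
    have := Nat.ceil_lt_add_one (zero_le_one.trans h1)
    linarith
  calc _ ≤ m * (6 * (D * (2 * R ^ (6 * m + 1))) + 2 * R ^ (6 * m + 1)) *
        (R ^ (3 * m) / R ^ (9 * m + 2)) := by gcongr; linarith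
    _ = m * (12 * D + 2) / R := by
      rw [show R ^ (9 * m + 2) = R ^ (6 * m + 1) * R ^ (3 * m) * R by ring]
      field_simp
      ring
    _ ≤ δ := by rwa [div_le_iff₀ hR0]

/-- the family `ν` satisfies the `(k·2^{k-1}, 3k-4, k)`-linear forms condition. -/
theorem nu_linear_forms (k : ℕ) (hk : 3 < k)
    (ε : ℝ) (hε : 0 < ε) (M w : ℕ → ℕ)
    (hM : ∀ N, Nat.Prime (M N))
    (hMN : ∀ᶠ N : ℕ in atTop, (N : ℝ) ^ ε < M N ∧ M N ≤ N)
    (hw : Tendsto w atTop atTop)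
    (hwb : ∀ᶠ N : ℕ in atTop, (w N : ℝ) ≤ Real.log (Real.log N) / 2) :
    LinearFormsCondition M (fun N => fun n : ZMod (M N) => nuGT k N (Wprim w N) n)
      (k * 2 ^ (k - 1)) (3 * k - 4) k := by
  intro m t hm _ L hL hL0 hLL δ hδ
  have hk0 : 0 < k := by omega
  set c : Fin m → Fin t → ℤ := fun i j => clearDenom k (L i j) with hc
  have hcL : ∀ i j, (c i j : ℚ) = k.factorial * L i j := fun i j => clearDenom_cast (hL i j).2
  have hkf : (k.factorial : ℚ) ≠ 0 := by exact_mod_cast k.factorial_ne_zero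
  have hc0 : ∀ i, ∃ j, c i j ≠ 0 := by
    intro i
    obtain ⟨j, hj⟩ := Function.ne_iff.1 (hL0 i)
    refine ⟨j, fun h => mul_ne_zero hkf hj ?_⟩
    rw [← hcL, h, Int.cast_zero]
  have hcc : ∀ i i', i ≠ i' → ∃ j l, c i j * c i' l - c i l * c i' j ≠ 0 := by
    intro i i' hii
    obtain ⟨j, l, hjl⟩ := exists_minor_ne_zero (hL0 i') (hLL i i' hii)
    refine ⟨j, l, fun h => mul_ne_zero (pow_ne_zero 2 hkf) hjl ?_⟩
    have h' : ((c i j * c i' l - c i l * c i' j : ℤ) : ℚ) = 0 := by rw [h, Int.cast_zero]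
    push_cast [hcL] at h'
    linear_combination h'
  obtain ⟨H, hH⟩ := exists_natAbs_le c
  obtain ⟨w₀, η, hη, hcore⟩ := exists_avg_prod_LambdaR_sq_subset c hc0 hcc (half_pos hδ)
  have hMN' := hMN.mono fun _ h => h.1
  have hMtop := tendsto_of_rpow_lt hε hMN'
  have hRbig : ∀ᶠ N : ℕ in atTop, m * (12 * (t * H : ℝ) + 2) / (δ / 2) ≤ Rpar k (M N) :=
    (tendsto_Rpar hk0 hMtop).eventually_ge_atTop _
  refine eventually_atTop.1 ?_
  filter_upwards [hRbig, hMtop.eventually_gt_atTop H, hw.eventually_ge_atTop w₀,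
    eventually_Wprim_mul_le hk0 hε hMN' hwb hη] with N hRN hMH hwN hWN hkM b
  have := Fact.mk (hM N)
  have hR := one_lt_Rpar hk0 (hM N).one_lt
  rw [sum_ratZMod_eq_sum_clearDenom hkM L (fun i j => (hL i j).2)
    (fun n => nuGT k N (Wprim w N) n)]
  refine (abs_avg_nuGT_sub_one_le (H := H) (B := ⌈Rpar k (M N) ^ (6 * m + 1)⌉₊) c (fun i h0 => ?_)
    (fun i j => (hH i i j j).1) (Nat.ceil_pos.2 (by positivity)) hR (half_pos hδ).le
    (hcore (Wprim w N) (w N) _ (Rpar k (M N)) (squarefree_Wprim w N) (primesDvd_Wprim w N) hwN hR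
      hWN (Nat.le_ceil _)) b).trans ?_
  · obtain ⟨j, hj⟩ := hc0 i
    refine not_dvd_of_natAbs_lt hj ((hH i i j j).1.trans_lt hMH) ?_
    rw [← ZMod.intCast_zmod_eq_zero_iff_dvd]
    exact congrFun h0 j
  · have := shift_error_le hk0 hm hR (Rpar_pow hk0 (M N)) (D := t * H) (δ := δ / 2) (by positivity)
      (by rwa [div_le_iff₀' (half_pos hδ)] at hRN)
    linarith

end
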